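/- Let 1 < p, q < ∞ satisfy |1/2 − 1/p| < 1/q. Then there is a constant C_{p,q} such that for every m ∈ L^∞(ℝ), the Fourier multiplier operator A_m satisfies ‖A_m‖_{L^p(ℝ)→L^p(ℝ)} ≤ C_{p,q} · sup_{I∈Δ} ‖m‖_{V_q(I)}, where Δ = {ε[2^k,2^{k+1}) : ε∈{±1}, k∈ℤ} are the lacunary dyadic intervals. -/

import Mathlib

open MeasureTheory Complex
open scoped ENNReal NNReal

/-- The Fourier transform `f̂(ξ) = ∫ f(x) e^{-i x ξ} dx`. -/
noncomputable def ft (f : ℝ → ℂ) (ξ : ℝ) : ℂ :=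
  ∫ x : ℝ, f x * Complex.exp (-(Complex.I * (x : ℂ) * (ξ : ℂ)))

/-- The Fourier multiplier operator `A_m f(x) = ∫ m(ξ) f̂(ξ) e^{i x ξ} dξ`. -/
noncomputable def multOp (m : ℝ → ℂ) (f : ℝ → ℂ) (x : ℝ) : ℂ :=
  ∫ ξ : ℝ, m ξ * ft f ξ * Complex.exp (Complex.I * (ξ : ℂ) * (x : ℂ))

/-- The left endpoint of the lacunary interval `ε[2^k, 2^{k+1})`. -/
noncomputable def lacLo (k : ℤ) (ε : Bool) : ℝ :=
  if ε then (2:ℝ) ^ k else -(2:ℝ) ^ (k + 1)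

/-- The right endpoint of the lacunary interval `ε[2^k, 2^{k+1})`. -/
noncomputable def lacHi (k : ℤ) (ε : Bool) : ℝ :=
  if ε then (2:ℝ) ^ (k + 1) else -(2:ℝ) ^ k

section Maximal
open Set Metric

/-- The layer-cake identity for powers of an extended nonnegative number. -/
lemma lintegral_indicator_rpow_sub_one (p : ℝ) (hp : 0 < p) (a : ℝ≥0∞) :
    ∫⁻ t in Ioi (0:ℝ), (if ENNReal.ofReal t < a then ENNReal.ofReal (t ^ (p - 1)) else 0)
      = a ^ p / ENNReal.ofReal p := by
  have key : ∀ b : ℝ, 0 ≤ b → ∫⁻ t in Ioo 0 b, ENNReal.ofReal (t ^ (p - 1))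
      = ENNReal.ofReal (b ^ p / p) := by
    intro b hb
    have hInt : IntervalIntegrable (fun t : ℝ => t ^ (p - 1)) volume 0 b :=
      intervalIntegral.intervalIntegrable_rpow' (by linarith)
    rw [restrict_Ioo_eq_restrict_Ioc, ← ofReal_integral_eq_lintegral_ofReal
      ((intervalIntegrable_iff_integrableOn_Ioc_of_le hb).1 hInt)
      ((ae_restrict_mem measurableSet_Ioc).mono fun t ht => Real.rpow_nonneg ht.1.le _),
      ← intervalIntegral.integral_of_le hb, integral_rpow (Or.inl (by linarith))]
    simp [Real.zero_rpow hp.ne']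
  have fin : ∀ b : ℝ, 0 ≤ b →
      ∫⁻ t in Ioi (0:ℝ), (if t < b then ENNReal.ofReal (t ^ (p - 1)) else 0)
      = ENNReal.ofReal (b ^ p / p) := by
    intro b hb
    rw [← key b hb, ← Ioi_inter_Iio, inter_comm, ← Measure.restrict_restrict measurableSet_Iio,
      ← lintegral_indicator measurableSet_Iio]
    rfl
  induction a with
  | top =>
    rw [ENNReal.top_rpow_of_pos hp, ENNReal.top_div_of_ne_top ENNReal.ofReal_ne_top]
    refine ENNReal.eq_top_of_forall_nnreal_le fun r => ?_
    have hr := fin ((r * p) ^ (1 / p)) (by positivity)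
    have h1 : (((r:ℝ) * p) ^ (1 / p)) ^ p = r * p := by
      rw [← Real.rpow_mul (by positivity), one_div_mul_cancel hp.ne', Real.rpow_one]
    rw [h1, mul_div_cancel_right₀ _ hp.ne', ENNReal.ofReal_coe_nnreal] at hr
    rw [← hr]
    refine lintegral_mono fun t => ?_
    simp only [ENNReal.ofReal_lt_top, if_true]
    split_ifs <;> simp
  | coe b =>
    have := fin b b.coe_nonneg
    rw [ENNReal.ofReal_div_of_pos hp, ← ENNReal.ofReal_rpow_of_nonneg b.coe_nonneg hp.le,
      ENNReal.ofReal_coe_nnreal] at this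
    rw [← this]
    refine setLIntegral_congr_fun measurableSet_Ioi fun t ht => ?_
    have : (ENNReal.ofReal t < (b:ℝ≥0∞)) ↔ t < b := by
      rw [← ENNReal.ofReal_coe_nnreal, ENNReal.ofReal_lt_ofReal_iff_of_nonneg (le_of_lt ht)]
    simp only [this]

/-- The uncentred Hardy–Littlewood maximal function on the line. -/
noncomputable def hlMax (h : ℝ → ℝ≥0∞) (x : ℝ) : ℝ≥0∞ :=
  ⨆ (c : ℝ) (r : ℝ) (_ : 0 < r) (_ : x ∈ ball c r),
    (∫⁻ y in ball c r, h y) / ENNReal.ofReal (2 * r)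

lemma measurable_hlMax (h : ℝ → ℝ≥0∞) : Measurable (hlMax h) := by
  apply LowerSemicontinuous.measurable
  refine lowerSemicontinuous_iSup fun c => lowerSemicontinuous_iSup fun r =>
    lowerSemicontinuous_iSup fun hr => ?_
  intro x t ht
  by_cases hx : x ∈ ball c r
  · filter_upwards [isOpen_ball.mem_nhds hx] with z hz
    simpa [hx, hz] using ht
  · simp [hx] at ht

lemma hlMax_weak (h : ℝ → ℝ≥0∞) (t : ℝ≥0∞) (ht : t ≠ 0) (ht' : t ≠ ∞) :
    t * volume {x | t < hlMax h x} ≤ 5 * ∫⁻ y, h y := by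
  by_cases hI : ∫⁻ y, h y = ∞
  · simp [hI]
  set T : Set (ℝ × ℝ) := {a | 0 < a.2 ∧ t * ENNReal.ofReal (2 * a.2) < ∫⁻ y in ball a.1 a.2, h y}
  have hR : ∀ a ∈ T, a.2 ≤ ((∫⁻ y, h y) / t).toReal := by
    rintro ⟨c, r⟩ ⟨hr, hlt⟩
    have h1 : ENNReal.ofReal r ≤ (∫⁻ y, h y) / t := by
      rw [ENNReal.le_div_iff_mul_le (Or.inl ht) (Or.inl ht'), mul_comm]
      refine le_trans ?_ (hlt.le.trans (setLIntegral_le_lintegral _ _))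
      gcongr; simp only at hr ⊢; linarith
    have h2 := ENNReal.toReal_mono (ENNReal.div_ne_top hI ht) h1
    rwa [ENNReal.toReal_ofReal (le_of_lt hr)] at h2
  obtain ⟨u, huT, hdisj, hcov⟩ := Vitali.exists_disjoint_subfamily_covering_enlargement_ball T
    (fun a => a.1) (fun a => a.2) _ hR 5 (by norm_num)
  have hcount : u.Countable := hdisj.countable_of_isOpen (fun a _ => isOpen_ball)
    fun a ha => nonempty_ball.2 (huT ha).1
  have hsub : {x | t < hlMax h x} ⊆ ⋃ a ∈ u, ball a.1 (5 * a.2) := by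
    intro x hx
    simp only [mem_ofPred_eq, hlMax, lt_iSup_iff] at hx
    obtain ⟨c, r, hr, hxc, hlt⟩ := hx
    have : (c, r) ∈ T := by
      refine ⟨hr, ?_⟩
      rwa [ENNReal.lt_div_iff_mul_lt (Or.inr ht') (Or.inr ht)] at hlt
    obtain ⟨b, hb, hb'⟩ := hcov _ this
    exact mem_iUnion₂.2 ⟨b, hb, hb' hxc⟩
  calc t * volume {x | t < hlMax h x}
      ≤ t * ∑' a : u, volume (ball a.1.1 (5 * a.1.2)) := by
        gcongr
        exact (measure_mono hsub).trans (measure_biUnion_le _ hcount _)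
    _ = ∑' a : u, t * volume (ball a.1.1 (5 * a.1.2)) := ENNReal.tsum_mul_left.symm
    _ ≤ ∑' a : u, 5 * ∫⁻ y in ball a.1.1 a.1.2, h y := by
        refine ENNReal.tsum_le_tsum fun a => ?_
        have h1 : volume (ball a.1.1 (5 * a.1.2)) = 5 * ENNReal.ofReal (2 * a.1.2) := by
          rw [Real.volume_ball, show 2 * (5 * a.1.2) = 5 * (2 * a.1.2) by ring,
            ENNReal.ofReal_mul (by norm_num)]
          norm_num
        rw [h1, mul_left_comm]
        gcongr
        exact (huT a.2).2.le
    _ = 5 * ∫⁻ y in ⋃ a ∈ u, ball a.1 a.2, h y := by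
        rw [ENNReal.tsum_mul_left, lintegral_biUnion hcount (fun a _ => measurableSet_ball) hdisj]
    _ ≤ 5 * ∫⁻ y, h y := 
        mul_le_mul_right (setLIntegral_le_lintegral _ _) _

lemma hlMax_le_add (h : ℝ → ℝ≥0∞) (t : ℝ≥0∞) (x : ℝ) :
    hlMax h x ≤ t + hlMax (fun y => if t < h y then h y else 0) x := by
  refine iSup_le fun c => iSup_le fun r => iSup_le fun hr => iSup_le fun hx => ?_
  have h1 : ∫⁻ y in ball c r, h y ≤ t * ENNReal.ofReal (2 * r)
      + ∫⁻ y in ball c r, (if t < h y then h y else 0) := by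
    calc ∫⁻ y in ball c r, h y ≤ ∫⁻ y in ball c r, (t + if t < h y then h y else 0) := by
          refine lintegral_mono fun y => ?_
          dsimp only
          split_ifs with hy
          · exact le_add_self
          · simpa using hy
      _ = _ := by
          rw [lintegral_add_left measurable_const]
          simp [Real.volume_ball]
  have hr0 : ENNReal.ofReal (2 * r) ≠ 0 := by simpa using hr
  calc (∫⁻ y in ball c r, h y) / ENNReal.ofReal (2 * r)
      ≤ (t * ENNReal.ofReal (2 * r)
      + ∫⁻ y in ball c r, (if t < h y then h y else 0)) / ENNReal.ofReal (2 * r) := by gcongr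
    _ = t + (∫⁻ y in ball c r, (if t < h y then h y else 0)) / ENNReal.ofReal (2 * r) := by
        rw [ENNReal.add_div, ENNReal.mul_div_cancel_right hr0 ENNReal.ofReal_ne_top]
    _ ≤ _ := by
        gcongr
        exact le_iSup_of_le c (le_iSup_of_le r (le_iSup_of_le hr (le_iSup_of_le hx le_rfl)))

/-- The Hardy–Littlewood maximal theorem. -/
lemma hlMax_strong (p : ℝ) (hp : 1 < p) : ∃ C : ℝ≥0∞, C ≠ ∞ ∧
    ∀ h : ℝ → ℝ≥0∞, Measurable h → ∫⁻ x, hlMax h x ^ p ≤ C * ∫⁻ x, h x ^ p := by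
  have hp0 : 0 < p := by linarith
  refine ⟨ENNReal.ofReal p * (10 * (2 ^ (p - 1) / ENNReal.ofReal (p - 1))), ?_, fun h hm => ?_⟩
  · refine ENNReal.mul_ne_top ENNReal.ofReal_ne_top (ENNReal.mul_ne_top (by simp) ?_)
    exact ENNReal.div_ne_top (ENNReal.rpow_ne_top_of_nonneg (by linarith) (by simp))
      (by simpa using hp)
  have swap : ∀ (s : ℝ) (g w : ℝ → ℝ≥0∞), Measurable g → Measurable w →
      ∫⁻ x, w x * ∫⁻ t in Ioi (0:ℝ), (if ENNReal.ofReal t < g x then ENNReal.ofReal (t ^ s) else 0)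
      = ∫⁻ t in Ioi (0:ℝ), ENNReal.ofReal (t ^ s) * ∫⁻ x in {x | ENNReal.ofReal t < g x}, w x := by
    intro s g w hg hw
    have hmeas : Measurable (fun z : ℝ × ℝ => w z.1 *
        (if ENNReal.ofReal z.2 < g z.1 then ENNReal.ofReal (z.2 ^ s) else 0)) := by
      refine (hw.comp measurable_fst).mul (Measurable.ite ?_ (by fun_prop) measurable_const)
      exact measurableSet_lt (by fun_prop) (hg.comp measurable_fst)
    calc _ = ∫⁻ x, ∫⁻ t in Ioi (0:ℝ), w x *
          (if ENNReal.ofReal t < g x then ENNReal.ofReal (t ^ s) else 0) := by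
          refine lintegral_congr fun x => ?_
          rw [lintegral_const_mul]
          exact Measurable.ite (measurableSet_lt (by fun_prop) measurable_const) (by fun_prop)
            measurable_const
      _ = _ := by
          rw [lintegral_lintegral_swap hmeas.aemeasurable]
          refine lintegral_congr fun t => ?_
          rw [← lintegral_indicator (measurableSet_lt measurable_const hg),
            ← lintegral_const_mul _ (hw.indicator (measurableSet_lt measurable_const hg))]
          refine lintegral_congr fun x => ?_
          by_cases hx : ENNReal.ofReal t < g x <;> simp [hx, mul_comm]
  have hpow : ∀ (s : ℝ), 0 < s → ∀ a : ℝ≥0∞, a ^ s = ENNReal.ofReal s *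
      ∫⁻ t in Ioi (0:ℝ), (if ENNReal.ofReal t < a then ENNReal.ofReal (t ^ (s - 1)) else 0) := by
    intro s hs a
    rw [lintegral_indicator_rpow_sub_one s hs, ENNReal.mul_div_cancel (by simpa using hs) (by simp)]
  have hweak : ∀ t : ℝ, 0 < t → volume {x | ENNReal.ofReal t < hlMax h x}
      ≤ 10 / ENNReal.ofReal t * ∫⁻ x in {x | ENNReal.ofReal t < 2 * h x}, h x := by
    intro t ht
    set s := ENNReal.ofReal (t / 2)
    have hs : s ≠ 0 := by simpa [s] using ht
    have hts : ENNReal.ofReal t = 2 * s := by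
      rw [show (2:ℝ≥0∞) = ENNReal.ofReal 2 by simp, ← ENNReal.ofReal_mul (by norm_num)]
      congr 1; ring
    have h1 := hlMax_weak (fun y => if s < h y then h y else 0) s hs ENNReal.ofReal_ne_top
    have h2 : {x | ENNReal.ofReal t < hlMax h x} ⊆
        {x | s < hlMax (fun y => if s < h y then h y else 0) x} := by
      intro x hx
      have h3 := lt_of_lt_of_le hx (hlMax_le_add h s x)
      rw [hts, two_mul] at h3
      exact (ENNReal.add_lt_add_iff_left ENNReal.ofReal_ne_top).1 h3
    have h4 : ∫⁻ y, (if s < h y then h y else 0) = ∫⁻ x in {x | ENNReal.ofReal t < 2 * h x}, h x := by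
      rw [← lintegral_indicator (measurableSet_lt measurable_const (hm.const_mul _))]
      refine lintegral_congr fun x => ?_
      have : (ENNReal.ofReal t < 2 * h x) ↔ s < h x := by
        rw [hts]; exact ENNReal.mul_lt_mul_iff_right (by simp) (by simp)
      simp [indicator, this]
    rw [h4] at h1
    refine (measure_mono h2).trans ?_
    generalize ∫⁻ x in {x | ENNReal.ofReal t < 2 * h x}, h x = A at h1
    rw [hts, ← ENNReal.mul_le_mul_iff_right hs ENNReal.ofReal_ne_top]
    refine h1.trans (le_of_eq ?_)
    rw [← mul_assoc]
    congr 1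
    rw [show (10:ℝ≥0∞) = 2 * 5 by norm_num, ENNReal.mul_div_mul_left _ _ (by simp) (by simp),
      ENNReal.mul_div_cancel hs ENNReal.ofReal_ne_top]
  calc ∫⁻ x, hlMax h x ^ p
      = ENNReal.ofReal p * ∫⁻ t in Ioi (0:ℝ), ENNReal.ofReal (t ^ (p - 1)) *
          volume {x | ENNReal.ofReal t < hlMax h x} := by
        have := swap (p - 1) (hlMax h) 1 (measurable_hlMax h) measurable_one
        simp only [Pi.one_apply, one_mul, setLIntegral_one] at this
        rw [← this, ← lintegral_const_mul']
        · exact lintegral_congr fun x => hpow p hp0 _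
        · simp
    _ ≤ ENNReal.ofReal p * ∫⁻ t in Ioi (0:ℝ), 10 * (ENNReal.ofReal (t ^ (p - 1 - 1)) *
          ∫⁻ x in {x | ENNReal.ofReal t < 2 * h x}, h x) := by
        gcongr ENNReal.ofReal p * ?_
        refine setLIntegral_mono' measurableSet_Ioi fun t ht => ?_
        refine (mul_le_mul_right (hweak t ht) _).trans (le_of_eq ?_)
        rw [Real.rpow_sub_one (ne_of_gt ht) (p - 1), ENNReal.ofReal_div_of_pos ht, div_eq_mul_inv,
          div_eq_mul_inv]
        generalize ENNReal.ofReal (t ^ (p - 1)) = a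
        ring
    _ = ENNReal.ofReal p * (10 * (∫⁻ x, h x * ((2 * h x) ^ (p - 1) / ENNReal.ofReal (p - 1)))) := by
        rw [lintegral_const_mul' _ _ (by simp), ← swap (p - 1 - 1) (fun x => 2 * h x) h
          (hm.const_mul _) hm]
        simp only [lintegral_indicator_rpow_sub_one (p - 1) (by linarith)]
    _ = _ := by
        rw [mul_assoc, mul_assoc]
        congr 2
        rw [← lintegral_const_mul _ (hm.pow_const _)]
        refine lintegral_congr fun x => ?_
        rw [ENNReal.mul_rpow_of_nonneg _ _ (by linarith), div_eq_mul_inv, div_eq_mul_inv]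
        have : h x ^ p = h x * h x ^ (p - 1) := by
          rcases eq_or_ne (h x) 0 with h0 | h0
          · simp [h0, hp0]
          rcases eq_or_ne (h x) ∞ with h0' | h0'
          · simp [h0', hp0, hp]
          nth_rewrite 2 [← ENNReal.rpow_one (h x)]
          rw [← ENNReal.rpow_add _ _ h0 h0']; congr 1; ring
        rw [this]; ring

end Maximal

section Poisson
open Set Metric

/-- The (unnormalised) Poisson kernel with frequency scale `l`. -/
noncomputable def pk (l x : ℝ) : ℝ≥0∞ := ENNReal.ofReal (l / (1 + (l * x) ^ 2))

/-- Convolution with the Poisson kernel. -/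
noncomputable def pconv (l : ℝ) (h : ℝ → ℝ≥0∞) (x : ℝ) : ℝ≥0∞ := ∫⁻ y, pk l (x - y) * h y

lemma measurable_pk (l : ℝ) : Measurable (pk l) := by
  unfold pk; fun_prop

lemma pk_neg (l x : ℝ) : pk l (-x) = pk l x := by simp [pk]

lemma measurable_pconv (l : ℝ) {h : ℝ → ℝ≥0∞} (hm : Measurable h) : Measurable (pconv l h) := by
  unfold pconv
  refine Measurable.lintegral_prod_right' (f := fun z : ℝ × ℝ => pk l (z.1 - z.2) * h z.2) ?_
  exact ((measurable_pk l).comp (measurable_fst.sub measurable_snd)).mul (hm.comp measurable_snd)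

lemma lintegral_pconv_mul (l : ℝ) {h w : ℝ → ℝ≥0∞} (hh : Measurable h) (hw : Measurable w) :
    ∫⁻ x, pconv l h x * w x = ∫⁻ x, h x * pconv l w x := by
  have hm : Measurable (fun z : ℝ × ℝ => pk l (z.1 - z.2) * h z.2 * w z.1) :=
    (((measurable_pk l).comp (measurable_fst.sub measurable_snd)).mul
      (hh.comp measurable_snd)).mul (hw.comp measurable_fst)
  have hp : ∀ x, Measurable fun y => pk l (x - y) := fun x =>
    (measurable_pk l).comp (measurable_const.sub measurable_id)
  calc ∫⁻ x, pconv l h x * w x = ∫⁻ x, ∫⁻ y, pk l (x - y) * h y * w x := by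
        refine lintegral_congr fun x => ?_
        exact (lintegral_mul_const _ ((hp x).mul hh)).symm
    _ = ∫⁻ y, ∫⁻ x, pk l (x - y) * h y * w x := lintegral_lintegral_swap hm.aemeasurable
    _ = _ := by
        refine lintegral_congr fun y => ?_
        refine Eq.trans ?_ (lintegral_const_mul _ ((hp y).mul hw))
        refine lintegral_congr fun x => ?_
        rw [← pk_neg, neg_sub]; ring

lemma pk_mul_le {l : ℝ} (hl : 0 < l) (x y z : ℝ) :
    pk l (x - z) ≤ ENNReal.ofReal (2 * (1 + (l * (x - y)) ^ 2)) * pk l (y - z) := by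
  rw [pk, pk, ← ENNReal.ofReal_mul (by positivity)]
  apply ENNReal.ofReal_le_ofReal
  rw [mul_div_assoc', div_le_div_iff₀ (by positivity) (by positivity)]
  have : 1 + (l * (y - z)) ^ 2 ≤ 2 * (1 + (l * (x - y)) ^ 2) * (1 + (l * (x - z)) ^ 2) := by
    nlinarith [sq_nonneg (l * (x - y) + l * (x - z)), sq_nonneg (l * (x - y) * (l * (x - z)))]
  nlinarith

lemma pconv_le_mul {l : ℝ} (hl : 0 < l) {h : ℝ → ℝ≥0∞} (x y : ℝ) :
    pconv l h x ≤ ENNReal.ofReal (2 * (1 + (l * (x - y)) ^ 2)) * pconv l h y := by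
  rw [pconv, pconv, ← lintegral_const_mul' _ _ ENNReal.ofReal_ne_top]
  refine lintegral_mono fun z => ?_
  dsimp only
  rw [← mul_assoc]
  gcongr
  exact pk_mul_le hl x y z

lemma pconv_le_hlMax {l : ℝ} (hl : 0 < l) {h : ℝ → ℝ≥0∞} (hm : Measurable h) (x : ℝ) :
    pconv l h x ≤ 16 * hlMax h x := by
  set c : ℕ → ℝ := fun i => l * 4 * (1 / 4) ^ i
  have hball : ∀ i : ℕ, MeasurableSet (ball x (2 ^ i / l)) := fun i => measurableSet_ball
  have hpt : ∀ y, pk l (x - y) ≤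
      ∑' i : ℕ, (ball x (2 ^ i / l)).indicator (fun _ => ENNReal.ofReal (c i)) y := by
    intro y
    set t := |l * (x - y)| with htdef
    have hmem : ∀ i : ℕ, y ∈ ball x (2 ^ i / l) ↔ t < 2 ^ i := by
      intro i
      rw [mem_ball, Real.dist_eq, lt_div_iff₀ hl, htdef, abs_mul, abs_of_pos hl, abs_sub_comm,
        mul_comm]
    have hex : ∃ i : ℕ, t < 2 ^ i := pow_unbounded_of_one_lt t one_lt_two
    classical
    set i := Nat.find hex with hi
    have h1 : t < 2 ^ i := Nat.find_spec hex
    refine le_trans ?_ (ENNReal.le_tsum i)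
    rw [indicator_of_mem ((hmem i).2 h1)]
    apply ENNReal.ofReal_le_ofReal
    have ht2 : (l * (x - y)) ^ 2 = t ^ 2 := (sq_abs _).symm
    rw [ht2, div_eq_mul_inv]
    simp only [c]
    rw [mul_assoc]
    gcongr
    rcases Nat.eq_zero_or_pos i with h0 | h0
    · rw [h0]
      have : (1 + t ^ 2)⁻¹ ≤ 1 := inv_le_one_of_one_le₀ (by nlinarith [sq_nonneg t])
      linarith
    · obtain ⟨j, hj⟩ : ∃ j, i = j + 1 := ⟨i - 1, by omega⟩
      have h2 : 2 ^ j ≤ t := not_lt.1 (Nat.find_min hex (m := j) (by omega))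
      rw [hj, one_div, inv_pow, pow_succ (4:ℝ) j, mul_inv]
      have h3 : (4:ℝ) ^ j ≤ t ^ 2 := by
        rw [show (4:ℝ) = 2 ^ 2 by norm_num, ← pow_mul, mul_comm, pow_mul]
        gcongr
      rw [show (4:ℝ) * ((4 ^ j)⁻¹ * 4⁻¹) = (4 ^ j)⁻¹ by ring]
      gcongr
      linarith
  have hsum : ∑' i : ℕ, (1 / 2 : ℝ≥0∞) ^ i = 2 := by
    rw [ENNReal.tsum_geometric, one_div, ENNReal.one_sub_inv_two, inv_inv]
  calc pconv l h x ≤ ∫⁻ y, ∑' i : ℕ,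
        (ball x (2 ^ i / l)).indicator (fun y => ENNReal.ofReal (c i) * h y) y := by
        refine lintegral_mono fun y => ?_
        refine (mul_le_mul_left (hpt y) _).trans (le_of_eq ?_)
        rw [← ENNReal.tsum_mul_right]
        refine tsum_congr fun i => ?_
        by_cases hy : y ∈ ball x (2 ^ i / l) <;> simp [hy]
    _ = ∑' i : ℕ, ENNReal.ofReal (c i) * ∫⁻ y in ball x (2 ^ i / l), h y := by
        rw [lintegral_tsum fun i => ((hm.const_mul _).indicator (hball i)).aemeasurable]
        refine tsum_congr fun i => ?_
        rw [lintegral_indicator (hball i), lintegral_const_mul _ hm]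
    _ ≤ ∑' i : ℕ, 8 * hlMax h x * (1 / 2) ^ i := by
        refine ENNReal.tsum_le_tsum fun i => ?_
        have hr : (0:ℝ) < 2 ^ i / l := by positivity
        have h1 : (∫⁻ y in ball x (2 ^ i / l), h y) ≤
            hlMax h x * ENNReal.ofReal (2 * (2 ^ i / l)) := by
          rw [← ENNReal.div_le_iff_le_mul (Or.inl (by simpa using hr)) (Or.inl ENNReal.ofReal_ne_top)]
          exact le_iSup_of_le x (le_iSup_of_le _ (le_iSup_of_le hr
            (le_iSup_of_le (mem_ball_self hr) le_rfl)))
        refine (mul_le_mul_right h1 _).trans (le_of_eq ?_)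
        rw [mul_left_comm, ← ENNReal.ofReal_mul (by positivity), mul_comm (8:ℝ≥0∞),
          mul_assoc (hlMax h x)]
        congr 1
        rw [show c i * (2 * (2 ^ i / l)) = 8 * (1 / 2) ^ i by
          simp only [c]
          rw [show (1 / 4 : ℝ) = (1 / 2) * (1 / 2) by norm_num, mul_pow]
          field_simp
          rw [mul_assoc, ← mul_pow]; norm_num]
        rw [ENNReal.ofReal_mul (by norm_num), ENNReal.ofReal_pow (by norm_num)]
        congr 2
        · simp
        · rw [ENNReal.ofReal_div_of_pos (by norm_num)]; simp
    _ = 16 * hlMax h x := by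
        rw [ENNReal.tsum_mul_left, hsum]; ring

/-- The maximal theorem in integer powers. -/
lemma hlMax_strong_pow (m : ℕ) (hm : 2 ≤ m) : ∃ C : ℝ≥0∞, C ≠ ∞ ∧
    ∀ h : ℝ → ℝ≥0∞, Measurable h → ∫⁻ x, hlMax h x ^ m ≤ C * ∫⁻ x, h x ^ m := by
  obtain ⟨C, hC, H⟩ := hlMax_strong m (by exact_mod_cast hm)
  refine ⟨C, hC, fun h hh => ?_⟩
  simpa only [ENNReal.rpow_natCast] using H h hh

/-- Absorption: a self-improving inequality solved by Hölder's inequality. -/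
lemma lintegral_pow_le_of_absorb {m : ℕ} (hm : 2 ≤ m) {W S V : ℝ → ℝ≥0∞} {K K' : ℝ≥0∞}
    (hS : Measurable S) (hV : Measurable V)
    (h1 : ∫⁻ x, W x ^ m ≤ K * ∫⁻ x, S x * V x ^ (m - 1))
    (h2 : ∫⁻ x, V x ^ m ≤ K' * ∫⁻ x, W x ^ m) (hfin : ∫⁻ x, W x ^ m ≠ ∞) :
    ∫⁻ x, W x ^ m ≤ K ^ m * K' ^ (m - 1) * ∫⁻ x, S x ^ m := by
  have hm0 : (m:ℝ) ≠ 0 := by positivity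
  have hm1 : (1:ℝ) < m := by exact_mod_cast hm
  have hcast : ((m - 1 : ℕ) : ℝ) = m - 1 := by
    rw [Nat.cast_sub (by omega)]; simp
  have hconj : (m:ℝ).HolderConjugate (m / (m - 1)) := Real.HolderConjugate.conjExponent hm1
  have hold := ENNReal.lintegral_mul_le_Lp_mul_Lq volume hconj hS.aemeasurable
    (hV.pow_const (m - 1)).aemeasurable
  have hVm : ∀ x, (V x ^ (m - 1)) ^ ((m:ℝ) / (m - 1)) = V x ^ m := by
    intro x
    rw [← ENNReal.rpow_natCast, ← ENNReal.rpow_mul, hcast, mul_div_cancel₀ _ (by linarith),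
      ENNReal.rpow_natCast]
  simp only [Pi.mul_apply, hVm, ENNReal.rpow_natCast] at hold
  set A := ∫⁻ x, W x ^ m
  set B := ∫⁻ x, S x ^ m
  have h3 : A ^ m ≤ K ^ m * (B * (K' * A) ^ (m - 1)) := by
    have h4 : A ≤ K * (B ^ (1 / (m:ℝ)) * (K' * A) ^ (1 / ((m:ℝ) / (m - 1)))) := by
      refine h1.trans (mul_le_mul_right (hold.trans ?_) _)
      gcongr
    refine (pow_le_pow_left' h4 m).trans (le_of_eq ?_)
    rw [mul_pow, mul_pow]
    congr 2
    · rw [← ENNReal.rpow_natCast, ← ENNReal.rpow_mul, one_div_mul_cancel hm0, ENNReal.rpow_one]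
    · rw [← ENNReal.rpow_natCast, ← ENNReal.rpow_mul, one_div_div, div_mul_cancel₀ _ hm0, ← hcast,
        ENNReal.rpow_natCast]
  rcases eq_or_ne A 0 with hA | hA
  · rw [hA]; exact zero_le
  have hA' : A ^ (m - 1) ≠ 0 := pow_ne_zero _ hA
  rw [← ENNReal.mul_le_mul_iff_right hA' (ENNReal.pow_ne_top hfin)]
  calc A ^ (m - 1) * A = A ^ m := by rw [← pow_succ]; congr 1; omega
    _ ≤ _ := h3
    _ = _ := by rw [mul_pow]; ring

end Poisson

section FourierBasics
open Set FourierTransform ComplexConjugate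

/-- The character `t ↦ exp (2 π i t)`. -/
noncomputable def ex (t : ℝ) : ℂ := Complex.exp (2 * Real.pi * t * I)

lemma norm_ex (t : ℝ) : ‖ex t‖ = 1 := by
  rw [ex, show (2 * Real.pi * t * I : ℂ) = ((2 * Real.pi * t : ℝ) : ℂ) * I by push_cast; ring]
  exact norm_exp_ofReal_mul_I _

lemma ex_add (s t : ℝ) : ex (s + t) = ex s * ex t := by
  rw [ex, ex, ex, ← Complex.exp_add]; congr 1; push_cast; ring

lemma ex_zero : ex 0 = 1 := by simp [ex]

lemma conj_ex (t : ℝ) : conj (ex t) = ex (-t) := by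
  rw [ex, ex, ← Complex.exp_conj]; congr 1; simp [Complex.conj_ofNat]

lemma continuous_ex : Continuous ex := by unfold ex; fun_prop

lemma measurable_ex : Measurable ex := continuous_ex.measurable

lemma fourier_eq_ex (f : ℝ → ℂ) (w : ℝ) : 𝓕 f w = ∫ v, ex (-(v * w)) * f v := by
  rw [Real.fourier_eq']
  congr 1; ext v
  rw [smul_eq_mul, ex]
  congr 2
  simp; ring

lemma fourierInv_eq_ex (f : ℝ → ℂ) (w : ℝ) : 𝓕⁻ f w = ∫ v, ex (v * w) * f v := by
  rw [Real.fourierInv_eq']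
  congr 1; ext v
  rw [smul_eq_mul, ex]
  congr 2
  simp; ring

lemma integrable_ex_mul {f : ℝ → ℂ} (hf : Integrable f) {u : ℝ → ℝ} (hu : Measurable u) :
    Integrable fun v => ex (u v) * f v :=
  hf.bdd_mul (measurable_ex.comp hu).aestronglyMeasurable (.of_forall fun _ => (norm_ex _).le)

lemma norm_fourierInv_le (f : ℝ → ℂ) (w : ℝ) : ‖𝓕⁻ f w‖ ≤ ∫ v, ‖f v‖ := by
  rw [fourierInv_eq_ex]
  refine (norm_integral_le_integral_norm _).trans (le_of_eq ?_)
  simp [norm_ex]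

lemma norm_fourier_le (f : ℝ → ℂ) (w : ℝ) : ‖𝓕 f w‖ ≤ ∫ v, ‖f v‖ := by
  rw [fourier_eq_ex]
  refine (norm_integral_le_integral_norm _).trans (le_of_eq ?_)
  simp [norm_ex]

lemma continuous_fourier_of_integrable {f : ℝ → ℂ} (hf : Integrable f) : Continuous (𝓕 f) := by
  rw [funext (fourier_eq_ex f)]
  refine continuous_of_dominated (fun w => ?_) (fun w => .of_forall fun v => ?_) hf.norm
    (.of_forall fun v => ?_)
  · exact (integrable_ex_mul hf (by fun_prop)).aestronglyMeasurable
  · simp [norm_ex]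
  · exact (continuous_ex.comp (by fun_prop)).mul continuous_const

lemma continuous_fourierInv_of_integrable {f : ℝ → ℂ} (hf : Integrable f) : Continuous (𝓕⁻ f) := by
  have : 𝓕⁻ f = fun w => 𝓕 f (-w) := funext (Real.fourierInv_eq_fourier_neg f)
  rw [this]
  exact (continuous_fourier_of_integrable hf).comp continuous_neg

/-- The Fourier transform is symmetric. -/
lemma integral_fourier_mul {f g : ℝ → ℂ} (hf : Integrable f) (hg : Integrable g) :
    ∫ ξ, 𝓕 f ξ * g ξ = ∫ x, f x * 𝓕 g x := by
  have := VectorFourier.integral_fourierIntegral_smul_eq_flip (L := innerₗ ℝ)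
    Real.continuous_fourierChar (by exact continuous_inner) hf hg
  rw [flip_innerₗ] at this
  exact this

/-- Multiplication by a Fourier transform on the frequency side is convolution. -/
lemma fourierInv_fourier_mul {k g : ℝ → ℂ} (hk : Integrable k) (hg : Integrable g) (x : ℝ) :
    𝓕⁻ (fun ξ => 𝓕 k ξ * g ξ) x = ∫ y, k y * 𝓕⁻ g (x - y) := by
  have h := integral_fourier_mul hk (integrable_ex_mul hg (u := fun ξ => ξ * x) (by fun_prop))
  rw [fourierInv_eq_ex]
  calc _ = ∫ ξ, 𝓕 k ξ * (ex (ξ * x) * g ξ) := by congr 1; ext ξ; ring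
    _ = _ := by
      rw [h]; congr 1; ext y
      rw [fourier_eq_ex, fourierInv_eq_ex]
      congr 2; ext ξ
      rw [← mul_assoc, ← ex_add]; congr 2; ring

/-- Plancherel's theorem for integrable functions in `L²`. -/
lemma lintegral_enorm_fourier_sq {g : ℝ → ℂ} (hg : Integrable g) (hg2 : MemLp g 2) :
    ∫⁻ ξ, ‖𝓕 g ξ‖ₑ ^ 2 = ∫⁻ x, ‖g x‖ₑ ^ 2 := by
  set G : Lp ℂ 2 (volume : Measure ℝ) := hg2.toLp g
  have hae : ∀ᵐ ξ, 𝓕 g ξ = (𝓕 G : Lp ℂ 2 (volume : Measure ℝ)) ξ := by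
    apply ae_eq_of_integral_contDiff_smul_eq
      (continuous_fourier_of_integrable hg).locallyIntegrable
      ((Lp.memLp _).locallyIntegrable (by norm_num))
    intro φ hφ hφc
    have hφC : ContDiff ℝ (⊤ : ℕ∞) fun x => (φ x : ℂ) := Complex.ofRealCLM.contDiff.comp hφ
    set Φ : SchwartzMap ℝ ℂ := HasCompactSupport.toSchwartzMap (f := fun x => (φ x : ℂ))
      (hφc.comp_left (g := fun r : ℝ => (r : ℂ)) (by simp)) hφC
    have h1 := DFunLike.congr_fun (Lp.fourier_toTemperedDistribution_eq G) Φ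
    rw [TemperedDistribution.fourier_apply, Lp.toTemperedDistribution_apply,
      Lp.toTemperedDistribution_apply] at h1
    have h2 : ∫ x, (𝓕 Φ) x • G x = ∫ x, (𝓕 Φ) x • g x := by
      refine integral_congr_ae ?_
      filter_upwards [hg2.coeFn_toLp] with x hx
      rw [hx]
    rw [h2] at h1
    have h3 : ∫ x, (𝓕 Φ) x • g x = ∫ x, Φ x • 𝓕 g x := by
      have := integral_fourier_mul Φ.integrable hg
      simpa only [smul_eq_mul, SchwartzMap.fourier_coe] using this
    rw [h3] at h1
    exact h1
  have key : ∀ h : ℝ → ℂ, ∫⁻ x, ‖h x‖ₑ ^ 2 = eLpNorm h 2 volume ^ 2 := by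
    intro h
    rw [eLpNorm_eq_lintegral_rpow_enorm_toReal (by simp) (by simp), ← ENNReal.rpow_natCast,
      ← ENNReal.rpow_mul]
    simp
  rw [key, key, eLpNorm_congr_ae hae, ← eLpNorm_congr_ae hg2.coeFn_toLp]
  have h4 := Lp.norm_fourier_eq G
  rw [Lp.norm_def, Lp.norm_def, ENNReal.toReal_eq_toReal_iff' (Lp.eLpNorm_ne_top _)
    (Lp.eLpNorm_ne_top _)] at h4
  rw [h4]

lemma lintegral_enorm_fourierInv_sq {g : ℝ → ℂ} (hg : Integrable g) (hg2 : MemLp g 2) :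
    ∫⁻ ξ, ‖𝓕⁻ g ξ‖ₑ ^ 2 = ∫⁻ x, ‖g x‖ₑ ^ 2 := by
  rw [← lintegral_enorm_fourier_sq hg hg2]
  simp only [Real.fourierInv_eq_fourier_neg]
  exact lintegral_neg_eq_self (μ := volume) (f := fun x => ‖𝓕 g x‖ₑ ^ 2)

/-- Bounded, measurable, integrable functions. -/
structure Nice (f : ℝ → ℂ) : Prop where
  measurable : Measurable f
  integrable : Integrable f
  bdd : ∃ B : ℝ, ∀ x, ‖f x‖ ≤ B

lemma Nice.memLp {f : ℝ → ℂ} (hf : Nice f) : MemLp f 2 := by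
  obtain ⟨B, hB⟩ := hf.bdd
  rw [memLp_two_iff_integrable_sq_norm hf.integrable.aestronglyMeasurable]
  simp only [sq]
  exact hf.integrable.norm.bdd_mul hf.integrable.aestronglyMeasurable.norm
    (.of_forall fun x => by simpa using hB x)

lemma Nice.mul_bdd {f u : ℝ → ℂ} (hf : Nice f) (hu : Measurable u) {B : ℝ}
    (hB : ∀ x, ‖u x‖ ≤ B) : Nice fun x => u x * f x := by
  obtain ⟨B', hB'⟩ := hf.bdd
  refine ⟨hu.mul hf.measurable, hf.integrable.bdd_mul hu.aestronglyMeasurable (.of_forall hB), B * B', fun x => ?_⟩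
  rw [norm_mul]
  exact mul_le_mul (hB x) (hB' x) (norm_nonneg _) ((norm_nonneg _).trans (hB x))

lemma Nice.bdd_mul_fourier {f u : ℝ → ℂ} (hu : Nice u) (hf : Integrable f) :
    Nice fun x => u x * 𝓕 f x := by
  have := hu.mul_bdd (continuous_fourier_of_integrable hf).measurable (norm_fourier_le f)
  simpa only [mul_comm] using this

lemma fourierInv_congr {f g : ℝ → ℂ} (h : ∀ x, f x = g x) (y : ℝ) : 𝓕⁻ f y = 𝓕⁻ g y := by
  rw [funext h]

lemma fourierInv_sum {ι : Type*} (s : Finset ι) {f : ι → ℝ → ℂ} (h : ∀ i ∈ s, Integrable (f i))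
    (y : ℝ) : 𝓕⁻ (fun x => ∑ i ∈ s, f i x) y = ∑ i ∈ s, 𝓕⁻ (f i) y := by
  simp only [fourierInv_eq_ex, Finset.mul_sum]
  exact integral_finsetSum _ fun i hi => integrable_ex_mul (h i hi) (by fun_prop)

/-- Modulated dilation of a Fourier transform pair. -/
lemma fourier_modulate_dilate (k : ℝ → ℂ) (a : ℝ) {l : ℝ} (hl : 0 < l) (ξ : ℝ) :
    𝓕 (fun y => l * (ex (a * y) * k (l * y))) ξ = 𝓕 k ((ξ - a) / l) := by
  rw [fourier_eq_ex, fourier_eq_ex]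
  have := Measure.integral_comp_mul_left (fun v => ex (-(v * ((ξ - a) / l))) * k v) l
  rw [abs_of_pos (inv_pos.2 hl)] at this
  calc _ = (l:ℂ) * ∫ y, ex (-(l * y * ((ξ - a) / l))) * k (l * y) := by
        rw [← integral_const_mul]
        congr 1; ext y
        rw [show -(l * y * ((ξ - a) / l)) = -(y * ξ) + a * y by field_simp; ring, ex_add]
        ring
    _ = _ := by
        rw [this, Complex.real_smul, ← mul_assoc]
        push_cast
        rw [mul_inv_cancel₀ (by exact_mod_cast hl.ne'), one_mul]

end FourierBasics

section Bumps
open Set FourierTransform ComplexConjugate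

lemma lintegral_pk {l : ℝ} (hl : 0 < l) : ∫⁻ y, pk l y = ENNReal.ofReal Real.pi := by
  have h1 : (fun y => l / (1 + (l * y) ^ 2)) = fun y => l * (1 + (l * y) ^ 2)⁻¹ := by
    ext y; rw [div_eq_mul_inv]
  have hInt : Integrable fun y => l / (1 + (l * y) ^ 2) := by
    rw [h1]
    exact (integrable_inv_one_add_sq.comp_mul_left' hl.ne').const_mul l
  unfold pk
  rw [← ofReal_integral_eq_lintegral_ofReal hInt (.of_forall fun y => by positivity), h1,
    integral_const_mul, Measure.integral_comp_mul_left (fun v => (1 + v ^ 2)⁻¹),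
    abs_of_pos (inv_pos.2 hl), integral_univ_inv_one_add_sq, smul_eq_mul, ← mul_assoc,
    mul_inv_cancel₀ hl.ne', one_mul]

lemma sq_lintegral_mul_le {u v : ℝ → ℝ≥0∞} (hu : Measurable u) (hv : Measurable v) :
    (∫⁻ y, u y * v y) ^ 2 ≤ (∫⁻ y, u y) * ∫⁻ y, u y * v y ^ 2 := by
  have hold := ENNReal.lintegral_mul_le_Lp_mul_Lq volume (p := 2) (q := 2)
    Real.HolderConjugate.two_two (f := fun y => u y ^ (1 / 2 : ℝ))
    (g := fun y => u y ^ (1 / 2 : ℝ) * v y)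
    (hu.pow_const _).aemeasurable ((hu.pow_const _).mul hv).aemeasurable
  have h1 : ∀ y, u y ^ (1 / 2 : ℝ) * (u y ^ (1 / 2 : ℝ) * v y) = u y * v y := by
    intro y
    rw [← mul_assoc, ← ENNReal.rpow_add_of_nonneg _ _ (by norm_num) (by norm_num)]
    norm_num
  have h2 : ∀ y, (u y ^ (1 / 2 : ℝ)) ^ (2:ℝ) = u y := by
    intro y; rw [← ENNReal.rpow_mul]; norm_num
  have h3 : ∀ y, (u y ^ (1 / 2 : ℝ) * v y) ^ (2:ℝ) = u y * v y ^ 2 := by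
    intro y; rw [ENNReal.mul_rpow_of_nonneg _ _ (by norm_num), h2]; norm_num
  simp only [Pi.mul_apply, h1, h2, h3] at hold
  refine (pow_le_pow_left' hold 2).trans (le_of_eq ?_)
  rw [mul_pow]
  have h4 : ∀ A : ℝ≥0∞, (A ^ (1 / 2 : ℝ)) ^ 2 = A := by
    intro A; rw [← ENNReal.rpow_natCast, ← ENNReal.rpow_mul]; norm_num
  rw [h4, h4]

lemma enorm_le_pk_of_decay {k : ℝ → ℂ} {C : ℝ} (hC : ∀ t, ‖k t‖ ≤ C * (1 + t ^ 2)⁻¹)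
    (a : ℝ) {l : ℝ} (hl : 0 < l) (y : ℝ) :
    ‖(l * (ex (a * y) * k (l * y)) : ℂ)‖ₑ ≤ ENNReal.ofReal C * pk l y := by
  have hC0 : 0 ≤ C := by
    have := (norm_nonneg _).trans (hC 0); simpa using this
  rw [pk, ← ENNReal.ofReal_mul hC0, ← ofReal_norm]
  apply ENNReal.ofReal_le_ofReal
  rw [norm_mul, norm_mul, norm_ex, one_mul, Complex.norm_real, Real.norm_of_nonneg hl.le,
    div_eq_mul_inv, mul_left_comm]
  gcongr
  exact hC _

lemma schwartz_decay (k : SchwartzMap ℝ ℂ) : ∃ C : ℝ, ∀ t, ‖k t‖ ≤ C * (1 + t ^ 2)⁻¹ := by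
  obtain ⟨C0, hC0⟩ := k.decay 0 0
  obtain ⟨C2, hC2⟩ := k.decay 2 0
  refine ⟨C0 + C2, fun t => ?_⟩
  have h0 := hC0.2 t
  have h2 := hC2.2 t
  simp only [pow_zero, one_mul, norm_iteratedFDeriv_zero, Real.norm_eq_abs, sq_abs] at h0 h2
  rw [← div_eq_mul_inv, le_div_iff₀ (by positivity)]
  linarith

/-- A frequency bump at scale `l` is controlled by Poisson averages at scale `l`. -/
lemma bump_bound (χ : SchwartzMap ℝ ℂ) : ∃ C : ℝ≥0∞, C ≠ ∞ ∧ ∀ (a l : ℝ), 0 < l →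
    ∀ g : ℝ → ℂ, Integrable g → ∀ x,
    ‖𝓕⁻ (fun ξ => χ ((ξ - a) / l) * g ξ) x‖ₑ ^ 2 ≤ C * pconv l (fun y => ‖𝓕⁻ g y‖ₑ ^ 2) x := by
  obtain ⟨C, hC⟩ := schwartz_decay (𝓕⁻ χ)
  refine ⟨ENNReal.ofReal C ^ 2 * ENNReal.ofReal Real.pi,
    ENNReal.mul_ne_top (by simp) (by simp), fun a l hl g hg x => ?_⟩
  set K : ℝ → ℂ := fun y => l * (ex (a * y) * (𝓕⁻ χ : SchwartzMap ℝ ℂ) (l * y)) with hKdef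
  have hK : Integrable K := by
    refine (integrable_ex_mul ?_ (by fun_prop)).const_mul _
    exact (𝓕⁻ χ : SchwartzMap ℝ ℂ).integrable.comp_mul_left' hl.ne'
  have hFK : ∀ ξ, 𝓕 K ξ = χ ((ξ - a) / l) := by
    intro ξ
    rw [hKdef, fourier_modulate_dilate _ a hl, ← SchwartzMap.fourier_coe, fourier_fourierInv_eq]
  have h1 : 𝓕⁻ (fun ξ => χ ((ξ - a) / l) * g ξ) x = ∫ y, K y * 𝓕⁻ g (x - y) := by
    rw [← fourierInv_fourier_mul hK hg]
    simp only [hFK]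
  have hG : Measurable fun y => ‖𝓕⁻ g y‖ₑ := (continuous_fourierInv_of_integrable hg).measurable.enorm
  have h2 : ‖𝓕⁻ (fun ξ => χ ((ξ - a) / l) * g ξ) x‖ₑ ≤
      ENNReal.ofReal C * ∫⁻ y, pk l (x - y) * ‖𝓕⁻ g y‖ₑ := by
    rw [h1]
    refine (enorm_integral_le_lintegral_enorm _).trans ?_
    rw [← lintegral_const_mul' _ _ (by simp),
      ← lintegral_sub_left_eq_self (fun y => ENNReal.ofReal C * (pk l (x - y) * ‖𝓕⁻ g y‖ₑ)) x]
    refine lintegral_mono fun y => ?_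
    simp only [enorm_mul, sub_sub_cancel]
    rw [← mul_assoc]
    gcongr
    exact enorm_le_pk_of_decay hC a hl y
  refine (pow_le_pow_left' h2 2).trans ?_
  rw [mul_pow, mul_assoc]
  gcongr
  have hpm : Measurable fun y => pk l (x - y) :=
    (measurable_pk l).comp (measurable_const.sub measurable_id)
  refine (sq_lintegral_mul_le hpm hG).trans ?_
  rw [lintegral_sub_left_eq_self (fun y => pk l y) x, lintegral_pk hl]
  rfl

/-- Multiplying the kernel by a power of the variable amounts to differentiating the bump, which
does not enlarge its support. -/
lemma exists_schwartz_pow_mul_fourierInv {S : Set ℝ} (hS : IsClosed S) (ψ : SchwartzMap ℝ ℂ)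
    (hψ : ∀ x ∉ S, ψ x = 0) (j : ℕ) : ∃ Ψ : SchwartzMap ℝ ℂ, (∀ x ∉ S, Ψ x = 0) ∧
      ∀ x : ℝ, (𝓕⁻ Ψ : SchwartzMap ℝ ℂ) x = (x:ℂ) ^ j * (𝓕⁻ ψ : SchwartzMap ℝ ℂ) x := by
  induction j with
  | zero => exact ⟨ψ, hψ, fun x => by simp⟩
  | succ j ih =>
    obtain ⟨Ψ, h0, h1⟩ := ih
    set c : ℂ := (-(2 * Real.pi * I))⁻¹
    refine ⟨c • SchwartzMap.derivCLM ℂ ℂ Ψ, fun x hx => ?_, fun x => ?_⟩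
    · have h2 : tsupport (Ψ : ℝ → ℂ) ⊆ S := by
        refine closure_minimal (fun y hy => ?_) hS
        by_contra hyS
        exact hy (h0 y hyS)
      have h3 : deriv Ψ x = 0 := by
        by_contra hne
        exact hx (h2 (support_deriv_subset hne))
      simp [h3]
    · have hd := congrFun (Real.fourier_deriv Ψ.integrable Ψ.differentiable
        (SchwartzMap.derivCLM ℂ ℂ Ψ).integrable) (-x)
      have h2 : (𝓕⁻ (SchwartzMap.derivCLM ℂ ℂ Ψ) : SchwartzMap ℝ ℂ) x
          = -(2 * Real.pi * I) * x * (𝓕⁻ Ψ : SchwartzMap ℝ ℂ) x := by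
        rw [SchwartzMap.fourierInv_coe, SchwartzMap.fourierInv_coe,
          Real.fourierInv_eq_fourier_neg, Real.fourierInv_eq_fourier_neg]
        refine Eq.trans hd ?_
        simp only [smul_eq_mul]; push_cast; ring
      have hc : c * -(2 * Real.pi * I) = 1 := inv_mul_cancel₀ (by simp [Real.pi_ne_zero])
      rw [fourierInv_smul, smul_apply, smul_eq_mul, h2, h1]
      linear_combination (x * (x ^ j * (𝓕⁻ ψ : SchwartzMap ℝ ℂ) x)) * hc

end Bumps

section LocalBessel
open Set FourierTransform ComplexConjugate

lemma nice_schwartz (φ : SchwartzMap ℝ ℂ) : Nice φ := by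
  obtain ⟨C, hC⟩ := φ.decay 0 0
  exact ⟨φ.continuous.measurable, φ.integrable, C, fun x => by simpa using hC.2 x⟩

/-- The bump `φ` transplanted to centre `a` and scale `l`. -/
noncomputable def bump (φ : ℝ → ℂ) (a l ξ : ℝ) : ℂ := φ ((ξ - a) / l)

lemma nice_bump (φ : SchwartzMap ℝ ℂ) (a : ℝ) {l : ℝ} (hl : 0 < l) : Nice (bump φ a l) := by
  obtain ⟨C, hC⟩ := (nice_schwartz φ).bdd
  refine ⟨φ.continuous.measurable.comp (by fun_prop), ?_, C, fun x => hC _⟩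
  exact (φ.integrable.comp_div hl.ne').comp_sub_right a

lemma fourierInv_bump (φ : SchwartzMap ℝ ℂ) (a : ℝ) {l : ℝ} (hl : 0 < l) (y : ℝ) :
    𝓕⁻ (bump φ a l) y = l * (ex (a * y) * (𝓕⁻ φ : SchwartzMap ℝ ℂ) (l * y)) := by
  set K : ℝ → ℂ := fun y => l * (ex (a * y) * (𝓕⁻ φ : SchwartzMap ℝ ℂ) (l * y)) with hKdef
  have hK : Integrable K := by
    refine (integrable_ex_mul ?_ (by fun_prop)).const_mul _
    exact (𝓕⁻ φ : SchwartzMap ℝ ℂ).integrable.comp_mul_left' hl.ne'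
  have hKc : Continuous K :=
    continuous_const.mul ((continuous_ex.comp (by fun_prop)).mul
      ((𝓕⁻ φ : SchwartzMap ℝ ℂ).continuous.comp (by fun_prop)))
  have hFK : 𝓕 K = bump φ a l := by
    ext ξ
    rw [hKdef, fourier_modulate_dilate _ a hl, ← SchwartzMap.fourier_coe, fourier_fourierInv_eq,
      bump]
  rw [← hFK, hKc.fourierInv_fourier_eq hK (hFK ▸ (nice_bump φ a hl).integrable)]

/-- The frequency-localised piece of `f`. -/
noncomputable def piece (φ : ℝ → ℂ) (a l : ℝ) (f : ℝ → ℂ) : ℝ → ℂ :=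
  𝓕⁻ fun ξ => bump φ a l ξ * 𝓕 f ξ

lemma piece_eq_integral (φ : SchwartzMap ℝ ℂ) (a : ℝ) {l : ℝ} (hl : 0 < l) {f : ℝ → ℂ}
    (hf : Integrable f) (x : ℝ) :
    piece φ a l f x = ∫ y, f y * (l * (ex (a * (x - y)) *
      (𝓕⁻ φ : SchwartzMap ℝ ℂ) (l * (x - y)))) := by
  have := fourierInv_fourier_mul hf (nice_bump φ a hl).integrable x
  simp only [fourierInv_bump φ a hl] at this
  rw [← this, piece]
  exact fourierInv_congr (fun ξ => mul_comm _ _) x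

lemma nice_piece_symbol (φ : SchwartzMap ℝ ℂ) (a : ℝ) {l : ℝ} (hl : 0 < l) {f : ℝ → ℂ}
    (hf : Integrable f) : Nice fun ξ => bump φ a l ξ * 𝓕 f ξ :=
  (nice_bump φ a hl).bdd_mul_fourier hf

lemma enorm_sq_eq (z : ℂ) : ‖z‖ₑ ^ 2 = ENNReal.ofReal (‖z‖ ^ 2) := by
  rw [ENNReal.ofReal_pow (norm_nonneg _), ofReal_norm]

lemma measurable_piece (φ : SchwartzMap ℝ ℂ) (a : ℝ) {l : ℝ} (hl : 0 < l) {f : ℝ → ℂ}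
    (hf : Integrable f) : Measurable (piece φ a l f) :=
  (continuous_fourierInv_of_integrable (nice_piece_symbol φ a hl hf).integrable).measurable

/-- The weight `(1 + μ² t²)⁻ⁿ`. -/
noncomputable def tw (μ : ℝ) (n : ℕ) (t : ℝ) : ℝ≥0∞ := ENNReal.ofReal ((1 + (μ * t) ^ 2)⁻¹ ^ n)

lemma weight_identity (φ : SchwartzMap ℝ ℂ) (n : ℕ) (Ψ : ℕ → SchwartzMap ℝ ℂ)
    (hΨ : ∀ j, ∀ x : ℝ, (𝓕⁻ (Ψ j) : SchwartzMap ℝ ℂ) x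
      = (x:ℂ) ^ j * (𝓕⁻ φ : SchwartzMap ℝ ℂ) x)
    (a : ℝ) {l : ℝ} (hl : 0 < l) {f : ℝ → ℂ} (μ z : ℝ) (c : ℝ → ℂ)
    (hc : ∀ x, c x * (1 + I * (μ * (x - z) : ℝ)) = 1) (hg : Integrable fun x => c x ^ n * f x)
    (hf : Integrable f) (x : ℝ) :
    c x ^ n * piece φ a l f x = ∑ j ∈ Finset.range (n + 1),
      (n.choose j : ℂ) * (-I * c x * (μ / l : ℝ)) ^ j * piece (Ψ j) a l (fun x => c x ^ n * f x) x := by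
  have hl' : (l:ℂ) ≠ 0 := by exact_mod_cast hl.ne'
  have hInt : ∀ j, Integrable fun y => (fun x => c x ^ n * f x) y * (l * (ex (a * (x - y)) *
      (𝓕⁻ (Ψ j) : SchwartzMap ℝ ℂ) (l * (x - y)))) := by
    intro j
    obtain ⟨B, hB⟩ := (nice_schwartz (𝓕⁻ (Ψ j))).bdd
    refine hg.mul_bdd (c := l * B) ?_ (.of_forall fun y => ?_)
    · exact (continuous_const.mul ((continuous_ex.comp (by fun_prop)).mul
        ((𝓕⁻ (Ψ j) : SchwartzMap ℝ ℂ).continuous.comp (by fun_prop)))).aestronglyMeasurable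
    · rw [norm_mul, norm_mul, norm_ex, one_mul, Complex.norm_real, Real.norm_of_nonneg hl.le]
      gcongr
      exact hB _
  simp only [piece_eq_integral _ a hl hg, piece_eq_integral _ a hl hf]
  simp only [← integral_const_mul]
  rw [← integral_finsetSum _ fun j _ => (hInt j).const_mul _]
  congr 1; ext y
  have h1 : (1 + -I * c x * (μ * (x - y) : ℝ)) * c y = c x := by
    have e1 := hc x
    have e2 := hc y
    push_cast at e1 e2 ⊢
    linear_combination c x * e2 - c y * e1
  have h2 : (1 + -I * c x * (μ * (x - y) : ℝ)) ^ n * c y ^ n = c x ^ n := by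
    rw [← mul_pow, h1]
  rw [← h2, add_comm (1:ℂ), add_pow]
  simp only [Finset.sum_mul, hΨ, one_pow, mul_one]
  refine Finset.sum_congr rfl fun j _ => ?_
  have h3 : (-I * c x * (μ * (x - y) : ℝ)) ^ j
      = (-I * c x * (μ / l : ℝ)) ^ j * ((l * (x - y) : ℝ) : ℂ) ^ j := by
    rw [← mul_pow]; congr 1; push_cast; field_simp
  rw [h3]; ring

lemma local_bessel {S : Set ℝ} (hS : IsClosed S) (φ : SchwartzMap ℝ ℂ)
    (hφ : ∀ x ∉ S, φ x = 0) (n N : ℕ) : ∃ C : ℝ≥0∞, C ≠ ∞ ∧ ∀ (ι : Type) (s : Finset ι)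
      (a l : ι → ℝ) (μ : ℝ), 0 < μ → (∀ i ∈ s, μ ≤ l i) →
      (∀ ξ, ∀ t ⊆ s, (∀ i ∈ t, (ξ - a i) / l i ∈ S) → t.card ≤ N) →
      ∀ f : ℝ → ℂ, Nice f → ∀ z,
      ∫⁻ x, tw μ n (x - z) * ∑ i ∈ s, ‖piece φ (a i) (l i) f x‖ₑ ^ 2
        ≤ C * ∫⁻ x, tw μ n (x - z) * ‖f x‖ₑ ^ 2 := by
  choose Ψ hΨS hΨ using exists_schwartz_pow_mul_fourierInv hS φ hφ
  choose B hB using fun j => (nice_schwartz (Ψ j)).bdd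
  refine ⟨∑ j ∈ Finset.range (n + 1), ENNReal.ofReal ((n + 1) * (n.choose j : ℝ) ^ 2)
    * (N * ENNReal.ofReal (B j ^ 2)), ?_, fun ι s a l μ hμ hl hov f hf z => ?_⟩
  · exact ENNReal.sum_ne_top.2 fun j _ => ENNReal.mul_ne_top (by simp)
      (ENNReal.mul_ne_top (by simp) (by simp))
  have hl0 : ∀ i ∈ s, 0 < l i := fun i hi => hμ.trans_le (hl i hi)
  set c : ℝ → ℂ := fun x => (1 + I * (μ * (x - z) : ℝ))⁻¹ with hcdef
  have hne : ∀ x, (1 + I * (μ * (x - z) : ℝ) : ℂ) ≠ 0 := by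
    intro x h
    have := congrArg Complex.re h
    simp at this
  have hcn : ∀ x, ‖c x‖ ^ 2 = (1 + (μ * (x - z)) ^ 2)⁻¹ := by
    intro x
    rw [hcdef]
    simp only [norm_inv, inv_pow]
    congr 1
    rw [← Complex.normSq_eq_norm_sq, Complex.normSq_apply]
    simp
    ring
  have hc1 : ∀ x, ‖c x‖ ≤ 1 := by
    intro x
    have h1 : ‖c x‖ ^ 2 ≤ 1 := by
      rw [hcn]; exact inv_le_one_of_one_le₀ (by nlinarith [sq_nonneg (μ * (x - z))])
    exact (sq_le_one_iff₀ (norm_nonneg _)).1 h1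
  have hcm : Measurable c := by rw [hcdef]; fun_prop
  set g : ℝ → ℂ := fun x => c x ^ n * f x with hgdef
  have hg : Nice g := hf.mul_bdd (hcm.pow_const n) (B := 1) fun x => by
    rw [norm_pow]; exact pow_le_one₀ (norm_nonneg _) (hc1 x)
  have htw : ∀ x (w : ℂ), tw μ n (x - z) * ‖w‖ₑ ^ 2 = ‖c x ^ n * w‖ₑ ^ 2 := by
    intro x w
    rw [enorm_sq_eq, enorm_sq_eq, tw, ← ENNReal.ofReal_mul (by positivity), norm_mul, norm_pow,
      ← hcn]
    congr 1; ring
  have hpt : ∀ i ∈ s, ∀ x, tw μ n (x - z) * ‖piece φ (a i) (l i) f x‖ₑ ^ 2 ≤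
      ∑ j ∈ Finset.range (n + 1), ENNReal.ofReal ((n + 1) * (n.choose j : ℝ) ^ 2) *
        ‖piece (Ψ j) (a i) (l i) g x‖ₑ ^ 2 := by
    intro i hi x
    rw [htw, weight_identity φ n Ψ hΨ (a i) (hl0 i hi) μ z c
      (fun x => inv_mul_cancel₀ (hne x)) hg.integrable hf.integrable x]
    simp only [enorm_sq_eq]
    have h0 : ∀ j, ENNReal.ofReal ((n + 1) * (n.choose j : ℝ) ^ 2) *
        ENNReal.ofReal (‖piece (Ψ j) (a i) (l i) g x‖ ^ 2) =
        ENNReal.ofReal ((n + 1) * ((n.choose j : ℝ) * ‖piece (Ψ j) (a i) (l i) g x‖) ^ 2) := by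
      intro j
      rw [← ENNReal.ofReal_mul (by positivity)]; congr 1; ring
    simp only [h0]
    rw [← ENNReal.ofReal_sum_of_nonneg fun j _ => by positivity]
    apply ENNReal.ofReal_le_ofReal
    rw [← Finset.mul_sum]
    have h1 : ‖∑ j ∈ Finset.range (n + 1),
      (n.choose j : ℂ) * (-I * c x * (μ / l i : ℝ)) ^ j * piece (Ψ j) (a i) (l i) g x‖ ≤
        ∑ j ∈ Finset.range (n + 1), (n.choose j : ℝ) * ‖piece (Ψ j) (a i) (l i) g x‖ := by
      refine (norm_sum_le _ _).trans (Finset.sum_le_sum fun j _ => ?_)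
      rw [norm_mul, norm_mul, norm_pow, norm_mul, norm_mul, norm_neg, norm_I, one_mul,
        Complex.norm_natCast, Complex.norm_real, Real.norm_of_nonneg
          (div_nonneg hμ.le (hl0 i hi).le)]
      have h2 : (‖c x‖ * (μ / l i)) ^ j ≤ 1 := by
        refine pow_le_one₀ (mul_nonneg (norm_nonneg _) (div_nonneg hμ.le (hl0 i hi).le)) ?_
        exact mul_le_one₀ (hc1 x) (div_nonneg hμ.le (hl0 i hi).le)
          ((div_le_one (hl0 i hi)).2 (hl i hi))
      gcongr
      exact mul_le_of_le_one_right (by positivity) h2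
    refine (pow_le_pow_left₀ (norm_nonneg _) h1 2).trans ?_
    refine sq_sum_le_card_mul_sum_sq.trans (le_of_eq ?_)
    simp
  have hpm : ∀ j, ∀ i ∈ s, Measurable fun x => ‖piece (Ψ j) (a i) (l i) g x‖ₑ ^ 2 :=
    fun j i hi => (measurable_piece (Ψ j) (a i) (hl0 i hi) hg.integrable).enorm.pow_const 2
  have hPl : ∀ j, ∑ i ∈ s, ∫⁻ x, ‖piece (Ψ j) (a i) (l i) g x‖ₑ ^ 2 ≤
      N * ENNReal.ofReal (B j ^ 2) * ∫⁻ x, ‖g x‖ₑ ^ 2 := by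
    intro j
    have hB0 : 0 ≤ B j := (norm_nonneg _).trans (hB j 0)
    calc ∑ i ∈ s, ∫⁻ x, ‖piece (Ψ j) (a i) (l i) g x‖ₑ ^ 2
        = ∑ i ∈ s, ∫⁻ ξ, ‖bump (Ψ j) (a i) (l i) ξ * 𝓕 g ξ‖ₑ ^ 2 := by
          refine Finset.sum_congr rfl fun i hi => ?_
          have := nice_piece_symbol (Ψ j) (a i) (hl0 i hi) hg.integrable
          exact lintegral_enorm_fourierInv_sq this.integrable this.memLp
      _ = ∫⁻ ξ, ∑ i ∈ s, ‖bump (Ψ j) (a i) (l i) ξ * 𝓕 g ξ‖ₑ ^ 2 := by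
          rw [lintegral_finsetSum' _ fun i hi => ?_]
          exact ((nice_piece_symbol (Ψ j) (a i) (hl0 i hi)
            hg.integrable).measurable.enorm.pow_const 2).aemeasurable
      _ ≤ ∫⁻ ξ, N * ENNReal.ofReal (B j ^ 2) * ‖𝓕 g ξ‖ₑ ^ 2 := by
          refine lintegral_mono fun ξ => ?_
          simp only [enorm_mul, mul_pow, ← Finset.sum_mul]
          gcongr
          classical
          set t := s.filter fun i => (ξ - a i) / l i ∈ S
          calc ∑ i ∈ s, ‖bump (Ψ j) (a i) (l i) ξ‖ₑ ^ 2
              = ∑ i ∈ t, ‖bump (Ψ j) (a i) (l i) ξ‖ₑ ^ 2 := by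
                refine (Finset.sum_subset (Finset.filter_subset _ _) fun i hi hit => ?_).symm
                have : (ξ - a i) / l i ∉ S := fun h => hit (Finset.mem_filter.2 ⟨hi, h⟩)
                rw [bump, hΨS j _ this]; simp
            _ ≤ ∑ i ∈ t, ENNReal.ofReal (B j ^ 2) := by
                refine Finset.sum_le_sum fun i _ => ?_
                rw [enorm_sq_eq]
                apply ENNReal.ofReal_le_ofReal
                gcongr
                exact hB j _
            _ ≤ N * ENNReal.ofReal (B j ^ 2) := by
                rw [Finset.sum_const, nsmul_eq_mul]
                gcongr
                exact hov ξ t (Finset.filter_subset _ _) fun i hi => (Finset.mem_filter.1 hi).2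
      _ = _ := by
          rw [lintegral_const_mul' _ _ (ENNReal.mul_ne_top (by simp) (by simp)),
            lintegral_enorm_fourier_sq hg.integrable hg.memLp]
  calc ∫⁻ x, tw μ n (x - z) * ∑ i ∈ s, ‖piece φ (a i) (l i) f x‖ₑ ^ 2
      ≤ ∫⁻ x, ∑ i ∈ s, ∑ j ∈ Finset.range (n + 1),
        ENNReal.ofReal ((n + 1) * (n.choose j : ℝ) ^ 2) *
        ‖piece (Ψ j) (a i) (l i) g x‖ₑ ^ 2 := by
        refine lintegral_mono fun x => ?_
        dsimp only
        rw [Finset.mul_sum]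
        exact Finset.sum_le_sum fun i hi => hpt i hi x
    _ = ∑ i ∈ s, ∑ j ∈ Finset.range (n + 1), ENNReal.ofReal ((n + 1) * (n.choose j : ℝ) ^ 2) *
        ∫⁻ x, ‖piece (Ψ j) (a i) (l i) g x‖ₑ ^ 2 := by
        rw [lintegral_finsetSum' _ fun i hi => ?_]
        · refine Finset.sum_congr rfl fun i hi => ?_
          rw [lintegral_finsetSum' _ fun j _ => ((hpm j i hi).const_mul _).aemeasurable]
          exact Finset.sum_congr rfl fun j _ => lintegral_const_mul _ (hpm j i hi)
        · exact (Finset.measurable_fun_sum _ fun j _ => (hpm j i hi).const_mul _).aemeasurable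
    _ ≤ ∑ j ∈ Finset.range (n + 1), ENNReal.ofReal ((n + 1) * (n.choose j : ℝ) ^ 2) *
        (N * ENNReal.ofReal (B j ^ 2) * ∫⁻ x, ‖g x‖ₑ ^ 2) := by
        rw [Finset.sum_comm]
        refine Finset.sum_le_sum fun j _ => ?_
        rw [← Finset.mul_sum]
        gcongr
        exact hPl j
    _ = _ := by
        simp only [htw, Finset.sum_mul, mul_assoc, hgdef]

end LocalBessel

section SmoothRdF
open Set FourierTransform ComplexConjugate

lemma measurable_tw (μ : ℝ) (n : ℕ) : Measurable (tw μ n) := by unfold tw; fun_prop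

lemma mul_tw_one (μ t : ℝ) (hμ : 0 < μ) : ENNReal.ofReal μ * tw μ 1 t = pk μ t := by
  rw [tw, pk, ← ENNReal.ofReal_mul hμ.le, pow_one, div_eq_mul_inv]

lemma tw_succ_mul (μ : ℝ) (e : ℕ) (t : ℝ) :
    tw μ (e + 1) t * ENNReal.ofReal ((1 + (μ * t) ^ 2) ^ e) = tw μ 1 t := by
  have h : 0 < 1 + (μ * t) ^ 2 := by positivity
  rw [tw, tw, ← ENNReal.ofReal_mul (by positivity), pow_succ, pow_one, inv_pow]
  congr 1; field_simp

/-- Averages of a slowly varying weight against the tail weight dominate it. -/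
lemma le_average_of_slow {μ : ℝ} (hμ : 0 < μ) {e : ℕ} {A : ℝ≥0∞} (hA : A ≠ ∞) {v : ℝ → ℝ≥0∞}
    (hslow : ∀ x y, v x ≤ A * ENNReal.ofReal ((1 + (μ * (x - y)) ^ 2) ^ e) * v y) (x : ℝ) :
    v x ≤ 4 ^ e * A * ENNReal.ofReal μ * ∫⁻ z, tw μ (e + 1) (x - z) * v z := by
  have h1 : ∀ z ∈ Metric.ball x μ⁻¹, v x ≤ 2 * 4 ^ e * A * (tw μ (e + 1) (x - z) * v z) := by
    intro z hz
    have hz' : (μ * (x - z)) ^ 2 ≤ 1 := by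
      rw [Metric.mem_ball, Real.dist_eq, abs_sub_comm] at hz
      rw [sq_le_one_iff_abs_le_one, abs_mul, abs_of_pos hμ]
      calc μ * |x - z| ≤ μ * μ⁻¹ := by gcongr
        _ = 1 := mul_inv_cancel₀ hμ.ne'
    have h2 : ENNReal.ofReal ((1 + (μ * (x - z)) ^ 2) ^ e) ≤ 2 * 4 ^ e * tw μ (e + 1) (x - z) := by
      have hpos : 0 < 1 + (μ * (x - z)) ^ 2 := by positivity
      rw [tw, show (2 * 4 ^ e : ℝ≥0∞) = ENNReal.ofReal (2 * 4 ^ e) by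
        rw [ENNReal.ofReal_mul (by norm_num), ENNReal.ofReal_pow (by norm_num)]; norm_num,
        ← ENNReal.ofReal_mul (by positivity)]
      apply ENNReal.ofReal_le_ofReal
      rw [inv_pow, ← div_eq_mul_inv, le_div_iff₀ (by positivity), ← pow_add]
      calc (1 + (μ * (x - z)) ^ 2) ^ (e + (e + 1)) ≤ 2 ^ (e + (e + 1)) := by
            gcongr; linarith
        _ = 2 * 4 ^ e := by
            rw [show (4:ℝ) = 2 * 2 by norm_num, mul_pow]; ring
    calc v x ≤ A * ENNReal.ofReal ((1 + (μ * (x - z)) ^ 2) ^ e) * v z := hslow x z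
      _ ≤ A * (2 * 4 ^ e * tw μ (e + 1) (x - z)) * v z := by gcongr
      _ = _ := by ring
  have h3 : v x * ENNReal.ofReal (2 * μ⁻¹) ≤
      2 * 4 ^ e * A * ∫⁻ z, tw μ (e + 1) (x - z) * v z := by
    calc v x * ENNReal.ofReal (2 * μ⁻¹) = ∫⁻ z in Metric.ball x μ⁻¹, v x := by
          rw [setLIntegral_const, Real.volume_ball]
      _ ≤ ∫⁻ z in Metric.ball x μ⁻¹, 2 * 4 ^ e * A * (tw μ (e + 1) (x - z) * v z) :=
          setLIntegral_mono' Metric.isOpen_ball.measurableSet h1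
      _ ≤ ∫⁻ z, 2 * 4 ^ e * A * (tw μ (e + 1) (x - z) * v z) := setLIntegral_le_lintegral _ _
      _ = _ := lintegral_const_mul' _ _ (ENNReal.mul_ne_top (ENNReal.mul_ne_top (by simp)
          (ENNReal.pow_ne_top (by simp))) hA)
  have h4 : ENNReal.ofReal (2 * μ⁻¹) * ENNReal.ofReal μ = 2 := by
    rw [← ENNReal.ofReal_mul (by positivity), mul_assoc, inv_mul_cancel₀ hμ.ne']; norm_num
  have h5 : v x * 2 ≤ (4 ^ e * A * ENNReal.ofReal μ * ∫⁻ z, tw μ (e + 1) (x - z) * v z) * 2 := by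
    calc v x * 2 = v x * ENNReal.ofReal (2 * μ⁻¹) * ENNReal.ofReal μ := by rw [mul_assoc, h4]
      _ ≤ (2 * 4 ^ e * A * ∫⁻ z, tw μ (e + 1) (x - z) * v z) * ENNReal.ofReal μ := by gcongr
      _ = _ := by ring
  exact (ENNReal.mul_le_mul_iff_left (by simp) (by simp)).1 h5

lemma average_le_of_slow {μ : ℝ} (hμ : 0 < μ) {e : ℕ} {A : ℝ≥0∞} {v : ℝ → ℝ≥0∞}
    (hslow : ∀ x y, v x ≤ A * ENNReal.ofReal ((1 + (μ * (x - y)) ^ 2) ^ e) * v y) (x : ℝ) :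
    ENNReal.ofReal μ * ∫⁻ z, tw μ (e + 1) (x - z) * v z ≤ A * ENNReal.ofReal Real.pi * v x := by
  have hpm : Measurable fun y => pk μ (x - y) :=
    (measurable_pk μ).comp (measurable_const.sub measurable_id)
  calc _ = ∫⁻ z, ENNReal.ofReal μ * (tw μ (e + 1) (x - z) * v z) :=
        (lintegral_const_mul' _ _ (by simp)).symm
    _ ≤ ∫⁻ z, A * v x * pk μ (x - z) := by
        refine lintegral_mono fun z => ?_
        dsimp only
        calc _ ≤ ENNReal.ofReal μ * (tw μ (e + 1) (x - z) *
              (A * ENNReal.ofReal ((1 + (μ * (z - x)) ^ 2) ^ e) * v x)) := by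
              gcongr; exact hslow z x
          _ = A * v x * (ENNReal.ofReal μ * (tw μ (e + 1) (x - z) *
              ENNReal.ofReal ((1 + (μ * (x - z)) ^ 2) ^ e))) := by
              rw [show (μ * (z - x)) ^ 2 = (μ * (x - z)) ^ 2 by ring]; ring
          _ = _ := by rw [tw_succ_mul, mul_tw_one _ _ hμ]
    _ = _ := by
        rw [lintegral_const_mul _ hpm, lintegral_sub_left_eq_self (fun y => pk μ y) x,
          lintegral_pk hμ]
        ring

lemma weighted_bessel {S : Set ℝ} (hS : IsClosed S) (φ : SchwartzMap ℝ ℂ)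
    (hφ : ∀ x ∉ S, φ x = 0) (e N : ℕ) (A : ℝ≥0∞) (hA : A ≠ ∞) :
    ∃ C : ℝ≥0∞, C ≠ ∞ ∧ ∀ (ι : Type) (s : Finset ι)
      (a l : ι → ℝ) (μ : ℝ), 0 < μ → (∀ i ∈ s, μ ≤ l i) →
      (∀ ξ, ∀ t ⊆ s, (∀ i ∈ t, (ξ - a i) / l i ∈ S) → t.card ≤ N) →
      ∀ f : ℝ → ℂ, Nice f → ∀ v : ℝ → ℝ≥0∞, Measurable v →
      (∀ x y, v x ≤ A * ENNReal.ofReal ((1 + (μ * (x - y)) ^ 2) ^ e) * v y) →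
      ∫⁻ x, v x * ∑ i ∈ s, ‖piece φ (a i) (l i) f x‖ₑ ^ 2 ≤ C * ∫⁻ x, v x * ‖f x‖ₑ ^ 2 := by
  obtain ⟨C, hC, H⟩ := local_bessel hS φ hφ (e + 1) N
  refine ⟨4 ^ e * A * (C * (A * ENNReal.ofReal Real.pi)), ?_,
    fun ι s a l μ hμ hl hov f hf v hv hslow => ?_⟩
  · exact ENNReal.mul_ne_top (ENNReal.mul_ne_top (ENNReal.pow_ne_top (by simp)) hA)
      (ENNReal.mul_ne_top hC (ENNReal.mul_ne_top hA (by simp)))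
  set G : ℝ → ℝ≥0∞ := fun x => ∑ i ∈ s, ‖piece φ (a i) (l i) f x‖ₑ ^ 2
  have hG : Measurable G := Finset.measurable_fun_sum _ fun i hi =>
    (measurable_piece φ (a i) (hμ.trans_le (hl i hi)) hf.integrable).enorm.pow_const 2
  have hf2 : Measurable fun x => ‖f x‖ₑ ^ 2 := hf.measurable.enorm.pow_const 2
  have hk : Measurable fun z : ℝ × ℝ => tw μ (e + 1) (z.1 - z.2) :=
    (measurable_tw μ (e + 1)).comp (measurable_fst.sub measurable_snd)
  have htx : ∀ x, Measurable fun z => tw μ (e + 1) (x - z) := fun x =>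
    (measurable_tw μ (e + 1)).comp (measurable_const.sub measurable_id)
  have swap : ∀ h : ℝ → ℝ≥0∞, Measurable h →
      ∫⁻ x, (∫⁻ z, tw μ (e + 1) (x - z) * v z) * h x =
      ∫⁻ z, v z * ∫⁻ x, tw μ (e + 1) (x - z) * h x := by
    intro h hh
    calc _ = ∫⁻ x, ∫⁻ z, tw μ (e + 1) (x - z) * v z * h x := by
          refine lintegral_congr fun x => ?_
          exact (lintegral_mul_const _ ((htx x).mul hv)).symm
      _ = ∫⁻ z, ∫⁻ x, tw μ (e + 1) (x - z) * v z * h x :=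
          lintegral_lintegral_swap ((hk.mul (hv.comp measurable_snd)).mul
            (hh.comp measurable_fst)).aemeasurable
      _ = _ := by
          refine lintegral_congr fun z => ?_
          have htz : Measurable fun x => tw μ (e + 1) (x - z) :=
            (measurable_tw μ (e + 1)).comp (measurable_id.sub measurable_const)
          refine Eq.trans ?_ (lintegral_const_mul _ (htz.mul hh))
          refine lintegral_congr fun x => ?_
          ring
  have hc1 : 4 ^ e * A * ENNReal.ofReal μ ≠ ∞ :=
    ENNReal.mul_ne_top (ENNReal.mul_ne_top (ENNReal.pow_ne_top (by simp)) hA) (by simp)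
  calc ∫⁻ x, v x * G x
      ≤ ∫⁻ x, (4 ^ e * A * ENNReal.ofReal μ) * ((∫⁻ z, tw μ (e + 1) (x - z) * v z) * G x) := by
        refine lintegral_mono fun x => ?_
        dsimp only
        rw [← mul_assoc]
        gcongr
        exact le_average_of_slow hμ hA hslow x
    _ = 4 ^ e * A * ENNReal.ofReal μ * ∫⁻ z, v z * ∫⁻ x, tw μ (e + 1) (x - z) * G x := by
        rw [lintegral_const_mul' _ _ hc1, swap G hG]
    _ ≤ 4 ^ e * A * ENNReal.ofReal μ *
        ∫⁻ z, v z * (C * ∫⁻ x, tw μ (e + 1) (x - z) * ‖f x‖ₑ ^ 2) := by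
        gcongr with z
        exact H ι s a l μ hμ hl hov f hf z
    _ = 4 ^ e * A * C * ∫⁻ x, ENNReal.ofReal μ * (∫⁻ z, tw μ (e + 1) (x - z) * v z) * ‖f x‖ₑ ^ 2 := by
        simp only [mul_left_comm _ C, mul_assoc (ENNReal.ofReal μ)]
        rw [lintegral_const_mul' _ _ hC, ← swap _ hf2, lintegral_const_mul' _ _ (by simp)]
        ring
    _ ≤ 4 ^ e * A * C * ∫⁻ x, A * ENNReal.ofReal Real.pi * (v x * ‖f x‖ₑ ^ 2) := by
        refine mul_le_mul_right (lintegral_mono fun x => ?_) _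
        dsimp only
        rw [← mul_assoc (A * _)]
        exact mul_le_mul_left (average_le_of_slow hμ hslow x) _
    _ = _ := by
        rw [lintegral_const_mul' _ _ (ENNReal.mul_ne_top hA (by simp))]
        ring

lemma pow_sub_le (x y : ℝ≥0∞) (m : ℕ) : (x + y) ^ (m + 1) ≤ y ^ (m + 1) + (m + 1) * x * (x + y) ^ m := by
  induction m with
  | zero => simp [add_comm]
  | succ m ih =>
    calc (x + y) ^ (m + 1 + 1) = x * (x + y) ^ (m + 1) + y * (x + y) ^ (m + 1) := by ring
      _ ≤ x * (x + y) ^ (m + 1) + y * (y ^ (m + 1) + (m + 1) * x * (x + y) ^ m) := by gcongr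
      _ ≤ x * (x + y) ^ (m + 1) + (y ^ (m + 1 + 1) + (m + 1) * x * ((x + y) * (x + y) ^ m)) := by
          rw [mul_add]
          gcongr _ + (?_ + ?_)
          · rw [pow_succ' y (m + 1)]
          · rw [mul_left_comm]
            gcongr
            exact le_add_self
      _ = _ := by push_cast; ring

/-- Expansion of a power of a sum along an ordering of the summands. -/
lemma sum_pow_le_ordered {ι : Type} [DecidableEq ι] (l : ι → ℝ) (b : ι → ℝ≥0∞) (m : ℕ)
    (s : Finset ι) : (∑ i ∈ s, b i) ^ (m + 1) ≤
      (m + 1) * ∑ i ∈ s, b i * (∑ j ∈ s with l j ≤ l i, b j) ^ m := by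
  induction s using Finset.induction_on_max_value l with
  | empty => simp
  | insert i s his hmax ih =>
    rw [Finset.sum_insert his, Finset.sum_insert his]
    refine (pow_sub_le _ _ m).trans ?_
    rw [mul_add, add_comm, mul_assoc]
    gcongr ?_ + ?_
    · gcongr
      have : (insert i s).filter (fun j => l j ≤ l i) = insert i s := by
        rw [Finset.filter_eq_self]
        intro j hj
        rcases Finset.mem_insert.1 hj with rfl | hj
        · exact le_rfl
        · exact hmax j hj
      rw [this, Finset.sum_insert his]
    · refine ih.trans ?_
      gcongr
      exact Finset.subset_insert _ _

end SmoothRdF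

section SmoothRdF
open Set FourierTransform ComplexConjugate

lemma lintegral_pow_ne_top {S : ℝ → ℝ≥0∞} {B : ℝ≥0∞} (hB : B ≠ ∞) (hS : ∀ x, S x ≤ B)
    (hInt : ∫⁻ x, S x ≠ ∞) {m : ℕ} (hm : 1 ≤ m) : ∫⁻ x, S x ^ m ≠ ∞ := by
  obtain ⟨m, rfl⟩ : ∃ k, m = k + 1 := ⟨m - 1, by omega⟩
  have : ∫⁻ x, S x ^ (m + 1) ≤ B ^ m * ∫⁻ x, S x := by
    rw [← lintegral_const_mul' _ _ (ENNReal.pow_ne_top hB)]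
    refine lintegral_mono fun x => ?_
    dsimp only
    rw [pow_succ]
    gcongr
    exact hS x
  exact ne_top_of_le_ne_top (ENNReal.mul_ne_top (ENNReal.pow_ne_top hB) hInt) this

lemma pconv_const {l : ℝ} (hl : 0 < l) (B : ℝ≥0∞) (x : ℝ) :
    pconv l (fun _ => B) x = ENNReal.ofReal Real.pi * B := by
  have hpm : Measurable fun y => pk l (x - y) :=
    (measurable_pk l).comp (measurable_const.sub measurable_id)
  rw [pconv, lintegral_mul_const _ hpm, lintegral_sub_left_eq_self (fun y => pk l y) x,
    lintegral_pk hl]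

lemma pconv_mono (l : ℝ) {h w : ℝ → ℝ≥0∞} (hhw : ∀ x, h x ≤ w x) (x : ℝ) :
    pconv l h x ≤ pconv l w x :=
  lintegral_mono fun y => mul_le_mul_right (hhw y) _

lemma lintegral_pconv {l : ℝ} (hl : 0 < l) {h : ℝ → ℝ≥0∞} (hh : Measurable h) :
    ∫⁻ x, pconv l h x = ENNReal.ofReal Real.pi * ∫⁻ x, h x := by
  have := lintegral_pconv_mul l hh (measurable_const (a := (1:ℝ≥0∞)))
  simp only [mul_one, pconv_const hl] at this
  rw [this, lintegral_mul_const _ hh, mul_comm]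

lemma enorm_fourierInv_sq_bdd (g : ℝ → ℂ) :
    ∃ B : ℝ≥0∞, B ≠ ∞ ∧ ∀ x, ‖𝓕⁻ g x‖ₑ ^ 2 ≤ B := by
  refine ⟨ENNReal.ofReal ((∫ y, ‖g y‖) ^ 2), by simp, fun x => ?_⟩
  rw [enorm_sq_eq]
  gcongr
  exact norm_fourierInv_le _ _

lemma lintegral_enorm_fourierInv_sq_ne_top {g : ℝ → ℂ} (hg : Nice g) :
    ∫⁻ x, ‖𝓕⁻ g x‖ₑ ^ 2 ≠ ∞ := by
  rw [lintegral_enorm_fourierInv_sq hg.integrable hg.memLp]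
  have := (hg.memLp.eLpNorm_lt_top)
  rw [eLpNorm_lt_top_iff_lintegral_rpow_enorm_lt_top (by simp) (by simp)] at this
  simpa using this.ne

/-- Poisson averages at varying scales are bounded on `ℓ¹`-valued `L^m`. -/
lemma lintegral_sum_pconv_pow {m : ℕ} (hm : 2 ≤ m) : ∃ C : ℝ≥0∞, C ≠ ∞ ∧
    ∀ (ι : Type) (s : Finset ι) (l : ι → ℝ) (b : ι → ℝ → ℝ≥0∞), (∀ i ∈ s, 0 < l i) →
      (∀ i ∈ s, Measurable (b i)) → ∫⁻ x, (∑ i ∈ s, pconv (l i) (b i) x) ^ m ≠ ∞ →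
      ∫⁻ x, (∑ i ∈ s, pconv (l i) (b i) x) ^ m ≤ C * ∫⁻ x, (∑ i ∈ s, b i x) ^ m := by
  have hm1 : (1:ℝ) < m := by exact_mod_cast hm
  have hcast : ((m - 1 : ℕ) : ℝ) = m - 1 := by
    rw [Nat.cast_sub (by omega)]; simp
  obtain ⟨C, hC, H⟩ := hlMax_strong (m / (m - 1)) ((one_lt_div (by linarith)).2 (by linarith))
  refine ⟨16 ^ m * C ^ (m - 1), ENNReal.mul_ne_top (ENNReal.pow_ne_top (by simp))
    (ENNReal.pow_ne_top hC), fun ι s l b hl hb hfin => ?_⟩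
  set W : ℝ → ℝ≥0∞ := fun x => ∑ i ∈ s, pconv (l i) (b i) x with hW
  have hWm : Measurable W := Finset.measurable_fun_sum _ fun i hi => measurable_pconv _ (hb i hi)
  have hWm' : Measurable fun x => W x ^ (m - 1) := hWm.pow_const _
  set M := hlMax fun x => W x ^ (m - 1)
  have hM : Measurable M := measurable_hlMax _
  have hpow : ∀ x, (M x ^ ((m:ℝ) - 1)⁻¹) ^ (m - 1) = M x := fun x => by
    rw [← ENNReal.rpow_natCast, ← ENNReal.rpow_mul, hcast, inv_mul_cancel₀ (by linarith),
      ENNReal.rpow_one]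
  refine lintegral_pow_le_of_absorb hm (V := fun x => M x ^ ((m:ℝ) - 1)⁻¹)
    (Finset.measurable_fun_sum _ hb) (hM.pow_const _) ?_ ?_ hfin
  · simp only [hpow]
    calc ∫⁻ x, W x ^ m = ∫⁻ x, ∑ i ∈ s, pconv (l i) (b i) x * W x ^ (m - 1) := by
          refine lintegral_congr fun x => ?_
          rw [← Finset.sum_mul, ← pow_succ']
          congr 1; omega
      _ = ∑ i ∈ s, ∫⁻ x, b i x * pconv (l i) (fun x => W x ^ (m - 1)) x := by
          rw [lintegral_finsetSum' _ fun i hi =>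
            ((measurable_pconv _ (hb i hi)).fun_mul hWm').aemeasurable]
          exact Finset.sum_congr rfl fun i hi => lintegral_pconv_mul _ (hb i hi) hWm'
      _ ≤ ∑ i ∈ s, ∫⁻ x, b i x * (16 * M x) := by
          refine Finset.sum_le_sum fun i hi => lintegral_mono fun x => ?_
          exact mul_le_mul_right (pconv_le_hlMax (hl i hi) hWm' x) _
      _ = ∫⁻ x, 16 * ((∑ i ∈ s, b i x) * M x) := by
          rw [← lintegral_finsetSum' _ fun i hi =>
            ((hb i hi).fun_mul (hM.const_mul 16)).aemeasurable]
          refine lintegral_congr fun x => ?_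
          rw [← Finset.sum_mul]; ring
      _ = _ := lintegral_const_mul' _ _ (by simp)
  · calc ∫⁻ x, (M x ^ ((m:ℝ) - 1)⁻¹) ^ m = ∫⁻ x, M x ^ ((m:ℝ) / (m - 1)) := by
          refine lintegral_congr fun x => ?_
          rw [← ENNReal.rpow_natCast, ← ENNReal.rpow_mul]
          congr 1; field_simp
      _ ≤ C * ∫⁻ x, (W x ^ (m - 1)) ^ ((m:ℝ) / (m - 1)) := H _ hWm'
      _ = _ := by
          congr 1
          refine lintegral_congr fun x => ?_
          rw [← ENNReal.rpow_natCast, ← ENNReal.rpow_mul, ← ENNReal.rpow_natCast, hcast,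
            mul_div_cancel₀ _ (by linarith)]

lemma exists_schwartz_eq_one {S : Set ℝ} (hS : IsCompact S) :
    ∃ χ : SchwartzMap ℝ ℂ, ∀ x ∈ S, χ x = 1 := by
  obtain ⟨R, hR, hSR⟩ := hS.isBounded.subset_closedBall_lt 0 0
  let f : ContDiffBump (0:ℝ) := ⟨R, R + 1, hR, by linarith⟩
  have h1 : HasCompactSupport fun x => (f x : ℂ) :=
    f.hasCompactSupport.comp_left (g := fun t : ℝ => (t:ℂ)) (by simp)
  have h2 : ContDiff ℝ ((⊤ : ℕ∞) : WithTop ℕ∞) fun x => (f x : ℂ) := Complex.ofRealCLM.contDiff.comp f.contDiff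
  refine ⟨h1.toSchwartzMap h2, fun x hx => ?_⟩
  have := f.one_of_mem_closedBall (hSR hx)
  simp [this]

lemma sum_pow_le_ordered_pairs {ι : Type} [DecidableEq ι] (l : ι → ℝ) (b : ι → ℝ≥0∞) (n : ℕ)
    (s : Finset ι) : (∑ i ∈ s, b i) ^ (n + 2) ≤ (n + 2) * (n + 1) *
      ∑ i ∈ s, (b i * (∑ j ∈ s with l j ≤ l i, b j) ^ n) * ∑ j ∈ s with l i ≤ l j, b j := by
  calc (∑ i ∈ s, b i) ^ (n + 2) ≤ (n + 2) * ∑ i ∈ s, b i * (∑ j ∈ s with l j ≤ l i, b j) ^ (n + 1) := by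
        refine (sum_pow_le_ordered l b (n + 1) s).trans (le_of_eq ?_)
        push_cast; ring
    _ ≤ (n + 2) * ∑ i ∈ s, b i * ((n + 1) * ∑ k ∈ s with l k ≤ l i,
          b k * (∑ j ∈ s with l j ≤ l k, b j) ^ n) := by
        gcongr with i hi
        refine (sum_pow_le_ordered l b n _).trans ?_
        gcongr with k hk
        exact Finset.filter_subset _ _
    _ = (n + 2) * (n + 1) * ∑ i ∈ s, ∑ k ∈ s, if l k ≤ l i then
          b i * (b k * (∑ j ∈ s with l j ≤ l k, b j) ^ n) else 0 := by
        rw [mul_assoc, Finset.mul_sum (a := (n + 1 : ℝ≥0∞))]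
        congr 1
        refine Finset.sum_congr rfl fun i hi => ?_
        rw [mul_left_comm, ← Finset.sum_filter, Finset.mul_sum]
    _ = _ := by
        rw [Finset.sum_comm]
        congr 1
        refine Finset.sum_congr rfl fun i hi => ?_
        rw [← Finset.sum_filter, Finset.mul_sum]
        exact Finset.sum_congr rfl fun j hj => mul_comm _ _

/-- Square functions of smooth pieces with finitely overlapping spectra are bounded on `L^{2m}`. -/
lemma smooth_rdf {S : Set ℝ} (hS : IsCompact S) (φ : SchwartzMap ℝ ℂ)
    (hφ : ∀ x ∉ S, φ x = 0) (N : ℕ) {m : ℕ} (hm : 2 ≤ m) :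
    ∃ C : ℝ≥0∞, C ≠ ∞ ∧ ∀ (ι : Type) (s : Finset ι) (a l : ι → ℝ), (∀ i ∈ s, 0 < l i) →
      (∀ ξ, ∀ t ⊆ s, (∀ i ∈ t, (ξ - a i) / l i ∈ S) → t.card ≤ N) →
      ∀ f : ℝ → ℂ, Nice f →
      ∫⁻ x, (∑ i ∈ s, ‖piece φ (a i) (l i) f x‖ₑ ^ 2) ^ m ≤ C * ∫⁻ x, (‖f x‖ₑ ^ 2) ^ m := by
  obtain ⟨n, rfl⟩ : ∃ k, m = k + 2 := ⟨m - 2, by omega⟩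
  obtain ⟨χ, hχ⟩ := exists_schwartz_eq_one hS
  obtain ⟨C₁, hC₁, H₁⟩ := bump_bound χ
  obtain ⟨C₂, hC₂, H₂⟩ := weighted_bessel hS.isClosed φ hφ (n + 1) N (2 ^ (n + 1))
    (ENNReal.pow_ne_top (by simp))
  obtain ⟨C₃, hC₃, H₃⟩ := lintegral_sum_pconv_pow hm
  set K : ℝ≥0∞ := (n + 2) * (n + 1) * (C₁ ^ (n + 1) * C₂) with hK
  have hc0 : ((n:ℝ≥0∞) + 2) * (n + 1) ≠ ∞ := by exact_mod_cast ENNReal.natCast_ne_top ((n + 2) * (n + 1))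
  have hKtop : K ≠ ∞ := ENNReal.mul_ne_top hc0 (ENNReal.mul_ne_top (ENNReal.pow_ne_top hC₁) hC₂)
  refine ⟨K ^ (n + 2) * C₃ ^ (n + 2 - 1), ENNReal.mul_ne_top (ENNReal.pow_ne_top hKtop)
    (ENNReal.pow_ne_top hC₃), fun ι s a l hl hov f hf => ?_⟩
  classical
  set b : ι → ℝ → ℝ≥0∞ := fun i x => ‖piece φ (a i) (l i) f x‖ₑ ^ 2 with hb
  have hbm : ∀ i ∈ s, Measurable (b i) := fun i hi =>
    (measurable_piece φ (a i) (hl i hi) hf.integrable).enorm.pow_const 2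
  set c : ι → ℝ → ℝ≥0∞ := fun i => pconv (l i) (b i) with hc
  have hcm : ∀ i ∈ s, Measurable (c i) := fun i hi => measurable_pconv _ (hbm i hi)
  have hbc : ∀ i ∈ s, ∀ x, b i x ≤ C₁ * c i x := by
    intro i hi x
    refine le_trans (le_of_eq ?_) (H₁ (a i) (l i) (hl i hi) _
      (nice_piece_symbol φ (a i) (hl i hi) hf.integrable).integrable x)
    simp only [hb, piece]
    congr 2
    refine fourierInv_congr (fun ξ => ?_) x
    by_cases h : (ξ - a i) / l i ∈ S
    · rw [hχ _ h, one_mul]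
    · simp [bump, hφ _ h]
  have hfinb : ∀ i ∈ s, (∃ B : ℝ≥0∞, B ≠ ∞ ∧ ∀ x, b i x ≤ B) ∧ ∫⁻ x, b i x ≠ ∞ := fun i hi =>
    ⟨enorm_fourierInv_sq_bdd _,
      lintegral_enorm_fourierInv_sq_ne_top (nice_piece_symbol φ (a i) (hl i hi) hf.integrable)⟩
  have hfin1 : ∫⁻ x, (∑ i ∈ s, b i x) ^ (n + 2) ≠ ∞ := by
    choose! B hB using fun i hi => (hfinb i hi).1
    refine lintegral_pow_ne_top (B := ∑ i ∈ s, B i) (ENNReal.sum_ne_top.2 fun i hi => (hB i hi).1)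
      (fun x => Finset.sum_le_sum fun i hi => (hB i hi).2 x) ?_ (by omega)
    rw [lintegral_finsetSum' _ fun i hi => (hbm i hi).aemeasurable]
    exact ENNReal.sum_ne_top.2 fun i hi => (hfinb i hi).2
  have hfin2 : ∫⁻ x, (∑ i ∈ s, c i x) ^ (n + 2) ≠ ∞ := by
    choose! B hB using fun i hi => (hfinb i hi).1
    refine lintegral_pow_ne_top (B := ∑ i ∈ s, ENNReal.ofReal Real.pi * B i)
      (ENNReal.sum_ne_top.2 fun i hi => ENNReal.mul_ne_top (by simp) (hB i hi).1)
      (fun x => Finset.sum_le_sum fun i hi => ?_) ?_ (by omega)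
    · rw [← pconv_const (hl i hi) (B i) x]
      exact pconv_mono _ (hB i hi).2 x
    rw [lintegral_finsetSum' _ fun i hi => (hcm i hi).aemeasurable]
    refine ENNReal.sum_ne_top.2 fun i hi => ?_
    rw [lintegral_pconv (hl i hi) (hbm i hi)]
    exact ENNReal.mul_ne_top (by simp) (hfinb i hi).2
  set v : ι → ℝ → ℝ≥0∞ := fun i x => c i x * (∑ j ∈ s with l j ≤ l i, c j x) ^ n with hv
  have hvm : ∀ i ∈ s, Measurable (v i) := fun i hi => (hcm i hi).mul
    ((Finset.measurable_fun_sum _ fun j hj => hcm j (Finset.mem_filter.1 hj).1).pow_const n)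
  have hf2 : Measurable fun x => ‖f x‖ₑ ^ 2 := hf.measurable.enorm.pow_const 2
  have hslow : ∀ i ∈ s, ∀ x y, v i x ≤
      2 ^ (n + 1) * ENNReal.ofReal ((1 + (l i * (x - y)) ^ 2) ^ (n + 1)) * v i y := by
    intro i hi x y
    have h1 : ∀ j ∈ s, l j ≤ l i → c j x ≤ 2 * ENNReal.ofReal (1 + (l i * (x - y)) ^ 2) * c j y := by
      intro j hj hji
      refine (pconv_le_mul (hl j hj) x y).trans ?_
      rw [ENNReal.ofReal_mul (by norm_num), ENNReal.ofReal_ofNat]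
      refine mul_le_mul_left (mul_le_mul_right (ENNReal.ofReal_le_ofReal ?_) _) _
      rw [mul_pow, mul_pow]
      have := (hl j hj).le
      gcongr
    calc v i x ≤ (2 * ENNReal.ofReal (1 + (l i * (x - y)) ^ 2) * c i y) *
          (∑ j ∈ s with l j ≤ l i, 2 * ENNReal.ofReal (1 + (l i * (x - y)) ^ 2) * c j y) ^ n := by
          simp only [hv]
          gcongr with j hj
          · exact h1 i hi le_rfl
          · exact h1 j (Finset.mem_filter.1 hj).1 (Finset.mem_filter.1 hj).2
      _ = _ := by
          rw [← Finset.mul_sum, ENNReal.ofReal_pow (by positivity)]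
          ring
  have main : ∫⁻ x, (∑ i ∈ s, b i x) ^ (n + 2) ≤
      K * ∫⁻ x, ‖f x‖ₑ ^ 2 * (∑ i ∈ s, c i x) ^ (n + 2 - 1) := by
    calc ∫⁻ x, (∑ i ∈ s, b i x) ^ (n + 2)
        ≤ ∫⁻ x, (n + 2) * (n + 1) * C₁ ^ (n + 1) *
            ∑ i ∈ s, v i x * ∑ j ∈ s with l i ≤ l j, b j x := by
          refine lintegral_mono fun x => ?_
          refine (sum_pow_le_ordered_pairs l (fun i => b i x) n s).trans ?_
          rw [mul_assoc _ (C₁ ^ (n + 1))]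
          refine mul_le_mul_right ?_ _
          rw [Finset.mul_sum]
          refine Finset.sum_le_sum fun i hi => ?_
          rw [← mul_assoc]
          refine mul_le_mul_left ?_ _
          calc b i x * (∑ j ∈ s with l j ≤ l i, b j x) ^ n
              ≤ C₁ * c i x * (∑ j ∈ s with l j ≤ l i, C₁ * c j x) ^ n := by
                gcongr with j hj
                · exact hbc i hi x
                · exact hbc j (Finset.mem_filter.1 hj).1 x
            _ = _ := by rw [← Finset.mul_sum]; simp only [hv]; ring
      _ = (n + 2) * (n + 1) * C₁ ^ (n + 1) *
            ∑ i ∈ s, ∫⁻ x, v i x * ∑ j ∈ s with l i ≤ l j, b j x := by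
          rw [lintegral_const_mul' _ _ (ENNReal.mul_ne_top hc0 (ENNReal.pow_ne_top hC₁)),
            lintegral_finsetSum' _ fun i hi => ((hvm i hi).fun_mul (Finset.measurable_fun_sum _
              fun j hj => hbm j (Finset.mem_filter.1 hj).1)).aemeasurable]
      _ ≤ (n + 2) * (n + 1) * C₁ ^ (n + 1) * ∑ i ∈ s, C₂ * ∫⁻ x, v i x * ‖f x‖ₑ ^ 2 := by
          gcongr with i hi
          exact H₂ ι _ a l (l i) (hl i hi) (fun j hj => (Finset.mem_filter.1 hj).2)
            (fun ξ t ht => hov ξ t (ht.trans (Finset.filter_subset _ _))) f hf (v i) (hvm i hi)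
            (hslow i hi)
      _ = K * ∫⁻ x, ∑ i ∈ s, v i x * ‖f x‖ₑ ^ 2 := by
          rw [lintegral_finsetSum' _ fun i hi => ((hvm i hi).fun_mul hf2).aemeasurable,
            ← Finset.mul_sum, hK]
          ring
      _ ≤ _ := by
          refine mul_le_mul_right (lintegral_mono fun x => ?_) _
          dsimp only
          rw [← Finset.sum_mul, mul_comm]
          refine mul_le_mul_right ?_ _
          rw [show n + 2 - 1 = n + 1 by omega, pow_succ', Finset.sum_mul]
          refine Finset.sum_le_sum fun i hi => ?_
          simp only [hv]
          gcongr
          exact Finset.filter_subset _ _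
  exact lintegral_pow_le_of_absorb hm hf2 (Finset.measurable_fun_sum _ hcm) main
    (H₃ ι s l b hl hbm hfin2) hfin1

end SmoothRdF

section LittlewoodPaley
open Set FourierTransform ComplexConjugate

/-- `F` is the inverse Fourier transform of an integrable function vanishing off `S`. -/
def Spec (S : Set ℝ) (F : ℝ → ℂ) : Prop :=
  ∃ g : ℝ → ℂ, Integrable g ∧ (∀ ξ ∉ S, g ξ = 0) ∧ ∀ x, F x = 𝓕⁻ g x

lemma Spec.mul {S T U : Set ℝ} {F G : ℝ → ℂ} (hF : Spec S F) (hG : Spec T G)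
    (hU : ∀ a ∈ S, ∀ b ∈ T, a + b ∈ U) : Spec U fun x => F x * G x := by
  obtain ⟨f, hf, hfS, hfF⟩ := hF
  obtain ⟨g, hg, hgT, hgG⟩ := hG
  refine ⟨convolution f g (ContinuousLinearMap.mul ℂ ℂ) volume, hf.integrable_convolution _ hg,
    fun ξ hξ => ?_, fun x => ?_⟩
  · rw [convolution_def]
    refine integral_eq_zero_of_ae (.of_forall fun t => ?_)
    by_cases ht : t ∈ S
    · by_cases ht' : ξ - t ∈ T
      · exact absurd (by simpa using hU t ht _ ht') hξ
      · simp [hgT _ ht']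
    · simp [hfS _ ht]
  · dsimp only
    rw [hfF, hgG, Real.fourierInv_eq_fourier_neg, Real.fourierInv_eq_fourier_neg,
      Real.fourierInv_eq_fourier_neg, Real.fourier_mul_convolution_eq hf hg]

lemma Spec.sum {ι : Type*} {S : Set ℝ} {F : ι → ℝ → ℂ} {s : Finset ι} (h : ∀ i ∈ s, Spec S (F i)) :
    Spec S fun x => ∑ i ∈ s, F i x := by
  choose! g hg hgS hgF using h
  refine ⟨fun ξ => ∑ i ∈ s, g i ξ, integrable_finsetSum _ hg,
    fun ξ hξ => Finset.sum_eq_zero fun i hi => hgS i hi ξ hξ, fun x => ?_⟩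
  rw [fourierInv_sum _ hg]
  exact Finset.sum_congr rfl fun i hi => hgF i hi x

lemma Spec.conj {S T : Set ℝ} {F : ℝ → ℂ} (hF : Spec S F) (hT : ∀ a ∈ S, -a ∈ T) :
    Spec T fun x => conj (F x) := by
  obtain ⟨f, hf, hfS, hfF⟩ := hF
  refine ⟨fun ξ => conj (f (-ξ)), ?_, fun ξ hξ => ?_, fun x => ?_⟩
  · have := hf.comp_neg
    exact (LinearIsometryEquiv.integrable_comp_iff conjLIE).2 this
  · dsimp only
    rw [hfS, map_zero]
    intro h
    exact hξ (by simpa using hT _ h)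
  · dsimp only
    rw [hfF, fourierInv_eq_ex, fourierInv_eq_ex, ← integral_conj,
      ← integral_neg_eq_self fun v => ex (v * x) * conj (f (-v))]
    congr 1
    ext v
    rw [map_mul, conj_ex]
    simp

lemma Spec.integral_eq_zero {S : Set ℝ} {F : ℝ → ℂ} (hF : Spec S F) (hInt : Integrable F)
    {r : ℝ} (hr : 0 < r) (hS : ∀ ξ ∈ S, r ≤ |ξ|) : ∫ x, F x = 0 := by
  obtain ⟨f, hf, hfS, hfF⟩ := hF
  have hF' : F = 𝓕⁻ f := funext hfF
  have hloc : ∀ᶠ ξ in nhds (0:ℝ), f ξ = 0 := by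
    filter_upwards [Metric.ball_mem_nhds (0:ℝ) hr] with ξ hξ
    refine hfS ξ fun h => ?_
    rw [Metric.mem_ball, Real.dist_eq, sub_zero] at hξ
    exact absurd (hS ξ h) (not_le.2 hξ)
  have hcont : ContinuousAt f 0 :=
    (continuousAt_congr (g := fun _ => (0:ℂ)) hloc).2 continuousAt_const
  have h1 : 𝓕 (𝓕⁻ f) 0 = f 0 := by
    refine hf.fourier_fourierInv_eq ?_ hcont
    have : 𝓕 f = fun x => F (-x) := by
      ext x
      rw [hfF, Real.fourierInv_eq_fourier_neg, neg_neg]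
    rw [this]
    exact hInt.comp_neg
  rw [fourier_eq_ex, hloc.self_of_nhds, ← hF'] at h1
  simpa [ex_zero] using h1

lemma Spec.mul_pow {F G : ℝ → ℂ} {r ρ : ℝ} (hF : Spec {ξ | |ξ| ≤ ρ} F)
    (hG : Spec {ξ | r ≤ |ξ|} G) (n : ℕ) :
    Spec {ξ | r - n * ρ ≤ |ξ|} fun x => G x * F x ^ n := by
  induction n with
  | zero => simpa using hG
  | succ n ih =>
    have := ih.mul hF (U := {ξ | r - (n + 1 : ℕ) * ρ ≤ |ξ|}) ?_
    · simpa only [pow_succ, mul_assoc] using this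
    · intro a ha b hb
      simp only [mem_ofPred_eq] at *
      have := abs_sub_abs_le_abs_sub a (-b)
      rw [abs_neg, sub_neg_eq_add] at this
      push_cast
      linarith

/-- The second-order Taylor bound behind the square function estimate. -/
lemma taylor_pow_le (m : ℕ) : ∃ C : ℝ, 0 ≤ C ∧ ∀ w x d : ℝ, 0 ≤ w → 0 ≤ d → 0 ≤ w + x + d →
    x ^ 2 ≤ 4 * w * d →
    (w + x + d) ^ (m + 1) ≤ w ^ (m + 1) + (m + 1) * w ^ m * x + C * (d * (w + d) ^ m) := by
  induction m with
  | zero => exact ⟨1, by norm_num, fun w x d _ _ _ _ => by simp⟩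
  | succ m ih =>
    obtain ⟨C, hC, H⟩ := ih
    refine ⟨5 * (m + 1) + 1 + 2 * C, by positivity, fun w x d hw hd hs hx => ?_⟩
    have hxd : |x| ≤ w + d := abs_le_of_sq_le_sq (by nlinarith [sq_nonneg (w - d)]) (by positivity)
    have hxd' := (abs_le.1 hxd).2
    have hwm : w ^ m ≤ (w + d) ^ m := by gcongr; linarith
    have hwm1 : w ^ (m + 1) ≤ (w + d) ^ (m + 1) := by gcongr; linarith
    have h1 := mul_le_mul_of_nonneg_right (H w x d hw hd hs hx) hs
    have e1 : w ^ m * x ^ 2 ≤ 4 * (d * (w + d) ^ (m + 1)) := by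
      calc w ^ m * x ^ 2 ≤ w ^ m * (4 * w * d) := by gcongr
        _ = 4 * (d * w ^ (m + 1)) := by ring
        _ ≤ _ := by gcongr
    have e2 : w ^ m * x * d ≤ d * (w + d) ^ (m + 1) := by
      calc w ^ m * x * d ≤ w ^ m * (w + d) * d := by gcongr
        _ ≤ (w + d) ^ m * (w + d) * d := by gcongr
        _ = _ := by ring
    have e3 : w ^ (m + 1) * d ≤ d * (w + d) ^ (m + 1) := by
      rw [mul_comm]; gcongr
    have e4 : C * (d * (w + d) ^ m) * (w + x + d) ≤ 2 * C * (d * (w + d) ^ (m + 1)) := by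
      calc C * (d * (w + d) ^ m) * (w + x + d) ≤ C * (d * (w + d) ^ m) * (2 * (w + d)) := by
            gcongr; linarith
        _ = _ := by ring
    have hm : (0:ℝ) ≤ m + 1 := by positivity
    have e5 := mul_le_mul_of_nonneg_left e1 hm
    have e6 := mul_le_mul_of_nonneg_left e2 hm
    calc (w + x + d) ^ (m + 1 + 1) = (w + x + d) ^ (m + 1) * (w + x + d) := pow_succ _ _
      _ ≤ _ := h1
      _ = w ^ (m + 1 + 1) + (m + 1 + 1) * w ^ (m + 1) * x + (w ^ (m + 1) * d
          + (m + 1) * (w ^ m * x ^ 2) + (m + 1) * (w ^ m * x * d)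
          + C * (d * (w + d) ^ m) * (w + x + d)) := by ring
      _ ≤ _ := by push_cast; linarith

lemma Nice.memLp_fourierInv {g : ℝ → ℂ} (hg : Nice g) : MemLp (𝓕⁻ g) 2 := by
  refine ⟨(continuous_fourierInv_of_integrable hg.integrable).aestronglyMeasurable, ?_⟩
  rw [eLpNorm_lt_top_iff_lintegral_rpow_enorm_lt_top (by simp) (by simp)]
  simpa using (lintegral_enorm_fourierInv_sq_ne_top hg).lt_top

lemma Nice.sum {ι : Type*} {s : Finset ι} {g : ι → ℝ → ℂ} (h : ∀ i ∈ s, Nice (g i)) :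
    Nice fun ξ => ∑ i ∈ s, g i ξ := by
  choose! B hB using fun i hi => (h i hi).bdd
  exact ⟨Finset.measurable_fun_sum _ fun i hi => (h i hi).measurable,
    integrable_finsetSum _ fun i hi => (h i hi).integrable, ∑ i ∈ s, B i,
    fun x => (norm_sum_le _ _).trans (Finset.sum_le_sum fun i hi => hB i hi x)⟩

/-- Telescoped form of the square function estimate for lacunary spectra. -/
lemma integral_square_function_pow_le (m : ℕ) : ∃ C : ℝ, 0 ≤ C ∧ ∀ (D : ℝ), 1 ≤ D →
    ∀ (ι : Type) (s : Finset ι) (a : ι → ℝ) (lam : ℕ → ℝ), (∀ k, 0 < lam k) →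
    (∀ k, 2 * (m + 1) * D * lam k ≤ lam (k + 1)) → ∀ g : ι → ℕ → ℝ → ℂ, (∀ J k, Nice (g J k)) →
    (∀ J k ξ, g J k ξ ≠ 0 → lam k ≤ |ξ - a J| ∧ |ξ - a J| ≤ D * lam k) →
    ∀ (w d : ℕ → ℝ → ℝ),
    (∀ k x, w k x = ∑ J ∈ s, ‖𝓕⁻ (fun ξ => ∑ i ∈ Finset.range k, g J i ξ) x‖ ^ 2) →
    (∀ k x, d k x = ∑ J ∈ s, ‖𝓕⁻ (g J k) x‖ ^ 2) → ∀ n,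
    Integrable (fun x => w n x ^ (m + 1)) ∧
    (∀ k, Integrable (fun x => d k x * (w k x + d k x) ^ m)) ∧
    ∫ x, w n x ^ (m + 1) ≤ C * ∑ k ∈ Finset.range n, ∫ x, d k x * (w k x + d k x) ^ m := by
  obtain ⟨C, hC, H⟩ := taylor_pow_le m
  refine ⟨C, hC, fun D hD ι s a lam hlam hΓ g hg hsupp w d hw hd n => ?_⟩
  set P : ι → ℕ → ℝ → ℂ := fun J k => 𝓕⁻ fun ξ => ∑ i ∈ Finset.range k, g J i ξ with hP
  set F : ι → ℕ → ℝ → ℂ := fun J k => 𝓕⁻ (g J k) with hF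
  have hPs : ∀ J k, Nice fun ξ => ∑ i ∈ Finset.range k, g J i ξ := fun J k =>
    Nice.sum fun i _ => hg J i
  have hPc : ∀ J k, Continuous (P J k) := fun J k =>
    continuous_fourierInv_of_integrable (hPs J k).integrable
  have hFc : ∀ J k, Continuous (F J k) := fun J k =>
    continuous_fourierInv_of_integrable (hg J k).integrable
  have hPL : ∀ J k, MemLp (P J k) 2 := fun J k => (hPs J k).memLp_fourierInv
  have hFL : ∀ J k, MemLp (F J k) 2 := fun J k => (hg J k).memLp_fourierInv
  have hPF : ∀ J k x, P J (k + 1) x = P J k x + F J k x := by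
    intro J k x
    simp only [hP, hF, fourierInv_sum _ fun i _ => (hg J i).integrable, Finset.sum_range_succ]
  have hwe : ∀ k, w k = fun x => ∑ J ∈ s, ‖P J k x‖ ^ 2 := fun k => funext (hw k)
  have hde : ∀ k, d k = fun x => ∑ J ∈ s, ‖F J k x‖ ^ 2 := fun k => funext (hd k)
  have hwc : ∀ k, Continuous (w k) := fun k => by rw [hwe]; fun_prop
  have hdc : ∀ k, Continuous (d k) := fun k => by rw [hde]; fun_prop
  have hwi : ∀ k, Integrable (w k) := fun k => by
    rw [hwe]
    exact integrable_finsetSum _ fun J _ => (memLp_two_iff_integrable_sq_norm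
      (hPc J k).aestronglyMeasurable).1 (hPL J k)
  have hdi : ∀ k, Integrable (d k) := fun k => by
    rw [hde]
    exact integrable_finsetSum _ fun J _ => (memLp_two_iff_integrable_sq_norm
      (hFc J k).aestronglyMeasurable).1 (hFL J k)
  have hw0 : ∀ k x, 0 ≤ w k x := fun k x => by rw [hw]; positivity
  have hd0 : ∀ k x, 0 ≤ d k x := fun k x => by rw [hd]; positivity
  have hwb : ∀ k, ∃ B, ∀ x, w k x ≤ B := fun k => by
    refine ⟨∑ J ∈ s, (∫ ξ, ‖∑ i ∈ Finset.range k, g J i ξ‖) ^ 2, fun x => ?_⟩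
    rw [hw]
    gcongr with J hJ
    exact norm_fourierInv_le _ _
  have hdb : ∀ k, ∃ B, ∀ x, d k x ≤ B := fun k => by
    refine ⟨∑ J ∈ s, (∫ ξ, ‖g J k ξ‖) ^ 2, fun x => ?_⟩
    rw [hd]
    gcongr with J hJ
    exact norm_fourierInv_le _ _
  have hbdd : ∀ {u v : ℝ → ℝ}, Integrable u → Continuous v → (∀ x, 0 ≤ v x) →
      (∃ B, ∀ x, v x ≤ B) → ∀ e : ℕ, Integrable fun x => u x * v x ^ e := by
    rintro u v hu hv hv0 ⟨B, hB⟩ e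
    refine hu.mul_bdd (c := B ^ e) (hv.pow e).aestronglyMeasurable (.of_forall fun x => ?_)
    rw [Real.norm_of_nonneg (pow_nonneg (hv0 x) e)]
    exact pow_le_pow_left₀ (hv0 x) (hB x) e
  have hwpow : ∀ k, Integrable fun x => w k x ^ (m + 1) := fun k => by
    simpa only [pow_succ'] using hbdd (hwi k) (hwc k) (hw0 k) (hwb k) m
  have hdpow : ∀ k, Integrable fun x => d k x * (w k x + d k x) ^ m := fun k => by
    obtain ⟨B, hB⟩ := hwb k
    obtain ⟨B', hB'⟩ := hdb k
    exact hbdd (hdi k) ((hwc k).add (hdc k)) (fun x => add_nonneg (hw0 k x) (hd0 k x))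
      ⟨B + B', fun x => add_le_add (hB x) (hB' x)⟩ m
  refine ⟨hwpow n, hdpow, ?_⟩
  set X : ℕ → ℝ → ℝ := fun k x => 2 * (∑ J ∈ s, F J k x * conj (P J k x)).re with hX
  have hwX : ∀ k x, w (k + 1) x = w k x + X k x + d k x := by
    intro k x
    simp only [hX, re_sum, Finset.mul_sum, hwe, hde, ← Finset.sum_add_distrib]
    refine Finset.sum_congr rfl fun J _ => ?_
    rw [hPF, ← normSq_eq_norm_sq, ← normSq_eq_norm_sq, ← normSq_eq_norm_sq, add_comm (P J k x),
      normSq_add]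
    ring
  have hX2 : ∀ k x, X k x ^ 2 ≤ 4 * w k x * d k x := by
    intro k x
    have h1 : |(∑ J ∈ s, F J k x * conj (P J k x)).re| ≤ ∑ J ∈ s, ‖F J k x‖ * ‖P J k x‖ := by
      refine (abs_re_le_norm _).trans ((norm_sum_le _ _).trans (le_of_eq ?_))
      simp
    have h2 := Finset.sum_mul_sq_le_sq_mul_sq s (fun J => ‖F J k x‖) fun J => ‖P J k x‖
    have h3 : (∑ J ∈ s, F J k x * conj (P J k x)).re ^ 2 ≤
        (∑ J ∈ s, ‖F J k x‖ * ‖P J k x‖) ^ 2 := sq_le_sq' (abs_le.1 h1).1 (abs_le.1 h1).2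
    simp only [hX, hwe, hde]
    nlinarith
  have hXi : ∀ k, Integrable (X k) := fun k => by
    have : X k = fun x => w (k + 1) x - w k x - d k x := by ext x; rw [hwX]; ring
    rw [this]
    exact ((hwi (k + 1)).sub (hwi k)).sub (hdi k)
  have hXw : ∀ k, Integrable fun x => X k x * w k x ^ m := fun k =>
    hbdd (hXi k) (hwc k) (hw0 k) (hwb k) m
  have hzero : ∀ k, ∫ x, X k x * w k x ^ m = 0 := by
    intro k
    rcases Nat.eq_zero_or_pos k with rfl | hk
    · simp [hX, hP, fourierInv_eq_ex]
    set ρ := D * lam (k - 1) with hρ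
    have hmono : ∀ i < k, lam i ≤ lam (k - 1) := by
      have hmon : Monotone lam := monotone_nat_of_le_succ fun i => by
        refine le_trans ?_ (hΓ i)
        have : 1 ≤ 2 * (m + 1) * D := by nlinarith [(Nat.cast_nonneg m : (0:ℝ) ≤ m)]
        nlinarith [hlam i]
      exact fun i hi => hmon (by omega)
    have hρk : 2 * (m + 1) * ρ ≤ lam k := by
      have := hΓ (k - 1)
      rw [Nat.sub_add_cancel hk] at this
      rw [hρ]; linarith
    have hρ0 : 0 < ρ := mul_pos (by linarith) (hlam _)
    have hSP : ∀ J, Spec {ξ | |ξ - a J| ≤ ρ} (P J k) := fun J => by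
      refine ⟨_, (hPs J k).integrable, fun ξ hξ => ?_, fun x => rfl⟩
      refine Finset.sum_eq_zero fun i hi => ?_
      by_contra h
      refine hξ ((hsupp J i ξ h).2.trans ?_)
      exact mul_le_mul_of_nonneg_left (hmono i (Finset.mem_range.1 hi)) (by linarith)
    have hSPc : ∀ J, Spec {ξ | |ξ + a J| ≤ ρ} fun x => conj (P J k x) := fun J =>
      (hSP J).conj fun ξ hξ => by
        simp only [mem_ofPred_eq] at *
        rwa [← abs_neg, neg_add, neg_neg, ← sub_eq_add_neg]
    have hSF : ∀ J, Spec {ξ | lam k ≤ |ξ - a J|} (F J k) := fun J => by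
      refine ⟨_, (hg J k).integrable, fun ξ hξ => ?_, fun x => rfl⟩
      by_contra h
      exact hξ (hsupp J k ξ h).1
    have hSW : Spec {ξ | |ξ| ≤ 2 * ρ} fun x => ∑ J ∈ s, P J k x * conj (P J k x) :=
      Spec.sum fun J _ => (hSP J).mul (hSPc J) fun ξ hξ η hη => by
        simp only [mem_ofPred_eq, abs_le] at *
        constructor <;> linarith
    have hSG : Spec {ξ | lam k - ρ ≤ |ξ|} fun x => ∑ J ∈ s, F J k x * conj (P J k x) :=
      Spec.sum fun J _ => (hSF J).mul (hSPc J) fun ξ hξ η hη => by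
        simp only [mem_ofPred_eq] at *
        have h1 := abs_sub_abs_le_abs_sub (ξ - a J) (-(η + a J))
        rw [abs_neg, show ξ - a J - -(η + a J) = ξ + η by ring] at h1
        linarith
    have hS := hSW.mul_pow hSG m
    have hWw : ∀ x, ∑ J ∈ s, P J k x * conj (P J k x) = ((w k x : ℝ) : ℂ) := fun x => by
      rw [hwe]; push_cast
      exact Finset.sum_congr rfl fun J _ => by rw [mul_conj, normSq_eq_norm_sq]; push_cast; rfl
    simp only [hWw] at hS
    have hGi : Integrable fun x => (∑ J ∈ s, F J k x * conj (P J k x)) * ((w k x : ℝ) : ℂ) ^ m := by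
      have h1 : Integrable fun x => ∑ J ∈ s, F J k x * conj (P J k x) :=
        integrable_finsetSum _ fun J _ => (hFL J k).integrable_mul (hPL J k).star
      obtain ⟨B, hB⟩ := hwb k
      refine h1.mul_bdd (c := B ^ m) (by have := hwc k; fun_prop) (.of_forall fun x => ?_)
      rw [norm_pow, Complex.norm_real, Real.norm_of_nonneg (hw0 k x)]
      exact pow_le_pow_left₀ (hw0 k x) (hB x) m
    have h0 := hS.integral_eq_zero hGi (r := ρ) hρ0 fun ξ hξ => by
      simp only [mem_ofPred_eq] at hξ
      nlinarith
    calc ∫ x, X k x * w k x ^ m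
        = ∫ x, 2 * ((∑ J ∈ s, F J k x * conj (P J k x)) * ((w k x : ℝ) : ℂ) ^ m).re := by
          congr 1; ext x
          rw [← ofReal_pow, re_mul_ofReal, hX]; ring
      _ = 2 * (∫ x, (∑ J ∈ s, F J k x * conj (P J k x)) * ((w k x : ℝ) : ℂ) ^ m).re := by
          rw [integral_const_mul]
          congr 1
          exact integral_re hGi
      _ = 0 := by rw [h0]; simp
  induction n with
  | zero => simp [hwe, hP, fourierInv_eq_ex]
  | succ n ih =>
    rw [Finset.sum_range_succ, mul_add]
    have key : ∀ x, w (n + 1) x ^ (m + 1) ≤ w n x ^ (m + 1) + (m + 1) * (X n x * w n x ^ m) +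
        C * (d n x * (w n x + d n x) ^ m) := fun x => by
      have := H (w n x) (X n x) (d n x) (hw0 n x) (hd0 n x) (by rw [← hwX]; exact hw0 _ x) (hX2 n x)
      rw [hwX]; linarith
    calc ∫ x, w (n + 1) x ^ (m + 1)
        ≤ ∫ x, (w n x ^ (m + 1) + (m + 1) * (X n x * w n x ^ m) +
          C * (d n x * (w n x + d n x) ^ m)) :=
          integral_mono (hwpow _) (((hwpow n).add ((hXw n).const_mul _)).add
            ((hdpow n).const_mul _)) key
      _ = (∫ x, w n x ^ (m + 1)) + C * ∫ x, d n x * (w n x + d n x) ^ m := by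
          rw [integral_add ((hwpow n).fun_add ((hXw n).const_mul _)) ((hdpow n).const_mul _),
            integral_add (hwpow n) ((hXw n).const_mul _), integral_const_mul, integral_const_mul,
            hzero, mul_zero, add_zero]
      _ ≤ _ := by gcongr

end LittlewoodPaley

section LittlewoodPaley
open Set FourierTransform ComplexConjugate

lemma exists_schwartz_cutoff : ∃ χ : SchwartzMap ℝ ℂ,
    (∀ x : ℝ, |x| ≤ 1 → χ x = 1) ∧ ∀ x : ℝ, 2 ≤ |x| → χ x = 0 := by
  let f : ContDiffBump (0:ℝ) := ⟨1, 2, one_pos, one_lt_two⟩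
  have h1 : HasCompactSupport fun x => (f x : ℂ) :=
    f.hasCompactSupport.comp_left (g := fun t : ℝ => (t:ℂ)) (by simp)
  have h2 : ContDiff ℝ ((⊤ : ℕ∞) : WithTop ℕ∞) fun x => (f x : ℂ) :=
    Complex.ofRealCLM.contDiff.comp f.contDiff
  refine ⟨h1.toSchwartzMap h2, fun x hx => ?_, fun x hx => ?_⟩
  · have := f.one_of_mem_closedBall (x := x) (by simpa using hx)
    simp [this]
  · have := f.zero_of_le_dist (x := x) (by simpa using hx)
    simp [this]

lemma sum_pconv {ι : Type*} (s : Finset ι) (l : ℝ) {b : ι → ℝ → ℝ≥0∞} (hb : ∀ i ∈ s, Measurable (b i))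
    (x : ℝ) : ∑ i ∈ s, pconv l (b i) x = pconv l (fun y => ∑ i ∈ s, b i y) x := by
  have hpm : Measurable fun y => pk l (x - y) :=
    (measurable_pk l).comp (measurable_const.sub measurable_id)
  simp only [pconv, Finset.mul_sum]
  exact (lintegral_finsetSum' _ fun i hi => (hpm.fun_mul (hb i hi)).aemeasurable).symm

lemma enorm_sub_sq_le (z w : ℂ) : ‖z - w‖ₑ ^ 2 ≤ 2 * (‖z‖ₑ ^ 2 + ‖w‖ₑ ^ 2) := by
  rw [enorm_sq_eq, enorm_sq_eq, enorm_sq_eq, ← ENNReal.ofReal_add (by positivity) (by positivity),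
    ← ENNReal.ofReal_ofNat, ← ENNReal.ofReal_mul (by norm_num)]
  apply ENNReal.ofReal_le_ofReal
  have := norm_sub_le z w
  nlinarith [norm_nonneg (z - w), norm_nonneg z, norm_nonneg w, sq_nonneg (‖z‖ - ‖w‖)]

/-- Lacunary sums are controlled in `L^{2m}` by their square function, vector-valued form with
centres of lacunarity depending on the coordinate. -/
lemma lintegral_lacunary_sum_pow_le {m : ℕ} (hm : 2 ≤ m) {D : ℝ} (hD : 1 ≤ D) :
    ∃ C : ℝ≥0∞, C ≠ ∞ ∧ ∀ (ι : Type) (s : Finset ι) (a : ι → ℝ) (lam : ℕ → ℝ), (∀ k, 0 < lam k) →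
    (∀ k, 2 * m * D * lam k ≤ lam (k + 1)) → ∀ g : ι → ℕ → ℝ → ℂ, (∀ J k, Nice (g J k)) →
    (∀ J k ξ, g J k ξ ≠ 0 → lam k ≤ |ξ - a J| ∧ |ξ - a J| ≤ D * lam k) → ∀ n,
    ∫⁻ x, (∑ J ∈ s, ‖𝓕⁻ (fun ξ => ∑ i ∈ Finset.range n, g J i ξ) x‖ₑ ^ 2) ^ m ≤
      C * ∫⁻ x, (∑ J ∈ s, ∑ k ∈ Finset.range n, ‖𝓕⁻ (g J k) x‖ₑ ^ 2) ^ m := by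
  obtain ⟨m, rfl⟩ : ∃ k, m = k + 1 := ⟨m - 1, by omega⟩
  obtain ⟨χ, hχ1, hχ0⟩ := exists_schwartz_cutoff
  obtain ⟨C₁, hC₁, H₁⟩ := bump_bound χ
  obtain ⟨C₂, hC₂, H₂⟩ := integral_square_function_pow_le m
  obtain ⟨C₃, hC₃, H₃⟩ := hlMax_strong_pow (m + 1) hm
  set c : ℝ≥0∞ := C₁ * 16 with hc
  have hctop : c ≠ ∞ := ENNReal.mul_ne_top hC₁ (by simp)
  set K : ℝ≥0∞ := ENNReal.ofReal C₂ * (5 * c) ^ m with hK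
  have hKtop : K ≠ ∞ := ENNReal.mul_ne_top (by simp)
    (ENNReal.pow_ne_top (ENNReal.mul_ne_top (by simp) hctop))
  refine ⟨K ^ (m + 1) * C₃ ^ (m + 1 - 1), ENNReal.mul_ne_top (ENNReal.pow_ne_top hKtop)
    (ENNReal.pow_ne_top hC₃), fun ι s a lam hlam hΓ g hg hsupp n => ?_⟩
  push_cast at hΓ
  set P : ι → ℕ → ℝ → ℂ := fun J k => 𝓕⁻ fun ξ => ∑ i ∈ Finset.range k, g J i ξ with hP
  have hPs : ∀ J k, Nice fun ξ => ∑ i ∈ Finset.range k, g J i ξ := fun J k =>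
    Nice.sum fun i _ => hg J i
  have hPc : ∀ J k, Continuous (P J k) := fun J k =>
    continuous_fourierInv_of_integrable (hPs J k).integrable
  have hFc : ∀ J k, Continuous (𝓕⁻ (g J k)) := fun J k =>
    continuous_fourierInv_of_integrable (hg J k).integrable
  have hPF : ∀ J k x, 𝓕⁻ (g J k) x = P J (k + 1) x - P J k x := by
    intro J k x
    simp only [hP, fourierInv_sum _ fun i _ => (hg J i).integrable, Finset.sum_range_succ]
    ring
  set W : ℕ → ℝ → ℝ≥0∞ := fun k x => ∑ J ∈ s, ‖P J k x‖ₑ ^ 2 with hW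
  set E : ℕ → ℝ → ℝ≥0∞ := fun k x => ∑ J ∈ s, ‖𝓕⁻ (g J k) x‖ₑ ^ 2 with hE
  have hbm : ∀ J, Measurable fun x => ‖P J n x‖ₑ ^ 2 := fun J =>
    (hPc J n).measurable.enorm.pow_const 2
  have hWm : Measurable (W n) := Finset.measurable_fun_sum _ fun J _ => hbm J
  have hEm : ∀ k, Measurable (E k) := fun k => Finset.measurable_fun_sum _ fun J _ =>
    (hFc J k).measurable.enorm.pow_const 2
  have hmon : Monotone lam := monotone_nat_of_le_succ fun i => by
    refine le_trans ?_ (hΓ i)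
    have : 1 ≤ 2 * (m + 1) * D := by nlinarith [(Nat.cast_nonneg m : (0:ℝ) ≤ m)]
    nlinarith [hlam i]
  have hWle : ∀ k ≤ n, ∀ x, W k x ≤ c * hlMax (W n) x := by
    intro k hk x
    rcases Nat.eq_zero_or_pos k with rfl | hk0
    · simp [hW, hP, fourierInv_eq_ex]
    set l := D * lam (k - 1) with hl
    have hl0 : 0 < l := mul_pos (by linarith) (hlam _)
    have hlk : 2 * l ≤ lam k := by
      have := hΓ (k - 1)
      rw [Nat.sub_add_cancel hk0] at this
      nlinarith [(Nat.cast_nonneg m : (0:ℝ) ≤ m)]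
    calc W k x ≤ ∑ J ∈ s, C₁ * pconv l (fun y => ‖P J n y‖ₑ ^ 2) x := by
          refine Finset.sum_le_sum fun J _ => ?_
          refine le_trans (le_of_eq ?_) (H₁ (a J) l hl0 _ (hPs J n).integrable x)
          simp only [hP]
          congr 2
          refine fourierInv_congr (fun ξ => ?_) x
          rw [Finset.mul_sum, ← Finset.sum_subset (Finset.range_mono hk)]
          · refine Finset.sum_congr rfl fun i hi => ?_
            by_cases h : g J i ξ = 0
            · rw [h, mul_zero]
            rw [hχ1, one_mul]
            rw [abs_div, abs_of_pos hl0, div_le_one hl0]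
            refine (hsupp J i ξ h).2.trans ?_
            have := Finset.mem_range.1 hi
            exact mul_le_mul_of_nonneg_left (hmon (by omega)) (by linarith)
          · intro i _ hi
            by_cases h : g J i ξ = 0
            · rw [h, mul_zero]
            rw [hχ0, zero_mul]
            rw [abs_div, abs_of_pos hl0, le_div_iff₀ hl0]
            refine hlk.trans (le_trans ?_ (hsupp J i ξ h).1)
            exact hmon (by simpa using hi)
      _ = C₁ * pconv l (W n) x := by
          rw [← Finset.mul_sum, sum_pconv _ _ fun J _ => hbm J]
      _ ≤ C₁ * (16 * hlMax (W n) x) := by gcongr; exact pconv_le_hlMax hl0 hWm x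
      _ = _ := by ring
  have hWE : ∀ k < n, ∀ x, W k x + E k x ≤ 5 * c * hlMax (W n) x := by
    intro k hk x
    have h1 : E k x ≤ 2 * (W (k + 1) x + W k x) := by
      simp only [hE, hW, hPF]
      rw [← Finset.sum_add_distrib, Finset.mul_sum]
      exact Finset.sum_le_sum fun J _ => enorm_sub_sq_le _ _
    calc W k x + E k x ≤ c * hlMax (W n) x + 2 * (c * hlMax (W n) x + c * hlMax (W n) x) :=
          add_le_add (hWle k hk.le x) (h1.trans (by gcongr <;> exact hWle _ (by omega) x))
      _ = _ := by ring
  obtain ⟨hwint, hdint, hle⟩ := H₂ D hD ι s a lam hlam hΓ g hg hsupp _ _ (fun _ _ => rfl)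
    (fun _ _ => rfl) n
  have hWr : ∀ k x, W k x = ENNReal.ofReal (∑ J ∈ s, ‖P J k x‖ ^ 2) := fun k x => by
    rw [ENNReal.ofReal_sum_of_nonneg fun _ _ => by positivity]
    exact Finset.sum_congr rfl fun J _ => enorm_sq_eq _
  have hEr : ∀ k x, E k x = ENNReal.ofReal (∑ J ∈ s, ‖𝓕⁻ (g J k) x‖ ^ 2) := fun k x => by
    rw [ENNReal.ofReal_sum_of_nonneg fun _ _ => by positivity]
    exact Finset.sum_congr rfl fun J _ => enorm_sq_eq _
  have hWint : ∫⁻ x, W n x ^ (m + 1) = ENNReal.ofReal (∫ x, (∑ J ∈ s, ‖P J n x‖ ^ 2) ^ (m + 1)) := by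
    rw [ofReal_integral_eq_lintegral_ofReal hwint (.of_forall fun x => by positivity)]
    refine lintegral_congr fun x => ?_
    rw [hWr, ENNReal.ofReal_pow (by positivity)]
  have hEint : ∀ k, ENNReal.ofReal (∫ x, (∑ J ∈ s, ‖𝓕⁻ (g J k) x‖ ^ 2) *
      ((∑ J ∈ s, ‖P J k x‖ ^ 2) + ∑ J ∈ s, ‖𝓕⁻ (g J k) x‖ ^ 2) ^ m) =
      ∫⁻ x, E k x * (W k x + E k x) ^ m := by
    intro k
    rw [ofReal_integral_eq_lintegral_ofReal (hdint k) (.of_forall fun x => by positivity)]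
    refine lintegral_congr fun x => ?_
    rw [hWr, hEr, ENNReal.ofReal_mul (by positivity), ENNReal.ofReal_pow (by positivity),
      ENNReal.ofReal_add (by positivity) (by positivity)]
  have hM : Measurable (hlMax (W n)) := measurable_hlMax _
  have main : ∫⁻ x, W n x ^ (m + 1) ≤
      K * ∫⁻ x, (∑ J ∈ s, ∑ k ∈ Finset.range n, ‖𝓕⁻ (g J k) x‖ₑ ^ 2) *
        hlMax (W n) x ^ (m + 1 - 1) := by
    calc ∫⁻ x, W n x ^ (m + 1)
        ≤ ENNReal.ofReal C₂ * ∑ k ∈ Finset.range n, ∫⁻ x, E k x * (W k x + E k x) ^ m := by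
          rw [hWint]
          refine (ENNReal.ofReal_le_ofReal hle).trans ?_
          rw [ENNReal.ofReal_mul hC₂, ENNReal.ofReal_sum_of_nonneg
            fun k _ => integral_nonneg fun x => by positivity]
          gcongr with k
          exact (hEint k).le
      _ ≤ ENNReal.ofReal C₂ * ∑ k ∈ Finset.range n,
            ∫⁻ x, (5 * c) ^ m * (E k x * hlMax (W n) x ^ m) := by
          refine mul_le_mul_right (Finset.sum_le_sum fun k hk => lintegral_mono fun x => ?_) _
          dsimp only
          rw [mul_left_comm, ← mul_pow]
          refine mul_le_mul_right (pow_le_pow_left' ?_ m) _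
          exact hWE k (Finset.mem_range.1 hk) x
      _ = K * ∑ k ∈ Finset.range n, ∫⁻ x, E k x * hlMax (W n) x ^ m := by
          simp only [lintegral_const_mul' _ _ (ENNReal.pow_ne_top (n := m)
            (ENNReal.mul_ne_top (by simp : (5:ℝ≥0∞) ≠ ∞) hctop))]
          rw [← Finset.mul_sum, hK, mul_assoc]
      _ = _ := by
          rw [← lintegral_finsetSum' _ fun k _ => ((hEm k).fun_mul (hM.pow_const m)).aemeasurable]
          congr 1
          refine lintegral_congr fun x => ?_
          rw [← Finset.sum_mul, Finset.sum_comm]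
          rfl
  refine lintegral_pow_le_of_absorb hm ?_ hM main (H₃ _ hWm) ?_
  · exact Finset.measurable_fun_sum _ fun J _ => Finset.measurable_fun_sum _ fun k _ =>
      (hFc J k).measurable.enorm.pow_const 2
  · change ∫⁻ x, W n x ^ (m + 1) ≠ ∞
    rw [hWint]; simp

end LittlewoodPaley

section LittlewoodPaley
open Set FourierTransform ComplexConjugate

lemma sum_pow_le_card_pow_mul {ι : Type*} (s : Finset ι) (b : ι → ℝ≥0∞) {m : ℕ} (hm : m ≠ 0) :
    (∑ i ∈ s, b i) ^ m ≤ (s.card : ℝ≥0∞) ^ m * ∑ i ∈ s, b i ^ m := by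
  rcases s.eq_empty_or_nonempty with rfl | hs
  · simp [hm]
  obtain ⟨j, hj, hmax⟩ := s.exists_max_image b hs
  calc (∑ i ∈ s, b i) ^ m ≤ (s.card * b j) ^ m := by
        gcongr
        simpa using Finset.sum_le_card_nsmul s b (b j) hmax
    _ = (s.card : ℝ≥0∞) ^ m * b j ^ m := mul_pow _ _ _
    _ ≤ _ := by
        gcongr
        exact Finset.single_le_sum (f := fun i => b i ^ m) (fun i _ => zero_le) hj

lemma enorm_sum_sq_le {ι : Type*} (s : Finset ι) (z : ι → ℂ) :
    ‖∑ i ∈ s, z i‖ₑ ^ 2 ≤ s.card * ∑ i ∈ s, ‖z i‖ₑ ^ 2 := by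
  have h : ‖∑ i ∈ s, z i‖ ^ 2 ≤ s.card * ∑ i ∈ s, ‖z i‖ ^ 2 := by
    refine le_trans ?_ (sq_sum_le_card_mul_sum_sq (s := s) (f := fun i => ‖z i‖))
    gcongr
    exact norm_sum_le _ _
  simp only [enorm_sq_eq]
  rw [← ENNReal.ofReal_sum_of_nonneg fun _ _ => by positivity, ← ENNReal.ofReal_natCast,
    ← ENNReal.ofReal_mul (by positivity)]
  exact ENNReal.ofReal_le_ofReal h

lemma sum_range_mul_eq {M : Type*} [AddCommMonoid M] (h : ℕ → M) (n L : ℕ) :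
    ∑ i ∈ Finset.range (L * n), h i = ∑ r ∈ Finset.range L, ∑ k ∈ Finset.range n, h (L * k + r) := by
  rw [Finset.sum_comm]
  induction n with
  | zero => simp
  | succ n ih => rw [Nat.mul_succ, Finset.sum_range_add, ih, Finset.sum_range_succ]

lemma nice_zero : Nice fun _ => (0:ℂ) :=
  ⟨measurable_const, integrable_zero _ _ _, 0, by simp⟩

lemma fourierInv_zero_fun (x : ℝ) : 𝓕⁻ (fun _ : ℝ => (0:ℂ)) x = 0 := by simp [fourierInv_eq_ex]

/-- Dyadic version of the square function estimate. -/
lemma lintegral_dyadic_sum_pow_le {m : ℕ} (hm : 2 ≤ m) {D : ℝ} (hD : 1 ≤ D) :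
    ∃ C : ℝ≥0∞, C ≠ ∞ ∧ ∀ (ι : Type) (s : Finset ι) (a : ι → ℝ) (c : ℝ), 0 < c →
    ∀ g : ι → ℕ → ℝ → ℂ, (∀ J k, Nice (g J k)) →
    (∀ J k ξ, g J k ξ ≠ 0 → c * 2 ^ k ≤ |ξ - a J| ∧ |ξ - a J| ≤ D * (c * 2 ^ k)) → ∀ n,
    ∫⁻ x, (∑ J ∈ s, ‖𝓕⁻ (fun ξ => ∑ i ∈ Finset.range n, g J i ξ) x‖ₑ ^ 2) ^ m ≤
      C * ∫⁻ x, (∑ J ∈ s, ∑ k ∈ Finset.range n, ‖𝓕⁻ (g J k) x‖ₑ ^ 2) ^ m := by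
  obtain ⟨C, hC, H⟩ := lintegral_lacunary_sum_pow_le hm hD
  obtain ⟨L, hL⟩ := pow_unbounded_of_one_lt (2 * m * D) (one_lt_two (α := ℝ))
  have hL0 : 0 < L := by
    rcases Nat.eq_zero_or_pos L with rfl | h
    · have : (2:ℝ) ≤ m := by exact_mod_cast hm
      simp at hL; nlinarith
    · exact h
  refine ⟨L ^ m * (L ^ m * (L * C)), by finiteness, fun ι s a c hc g₀ hg₀ hsupp₀ n => ?_⟩
  set g : ι → ℕ → ℝ → ℂ := fun J k => if k < n then g₀ J k else fun _ => 0 with hgdef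
  have hg : ∀ J k, Nice (g J k) := fun J k => by
    simp only [hgdef]; split_ifs
    · exact hg₀ J k
    · exact nice_zero
  have hsupp : ∀ J k ξ, g J k ξ ≠ 0 → c * 2 ^ k ≤ |ξ - a J| ∧ |ξ - a J| ≤ D * (c * 2 ^ k) := by
    intro J k ξ h
    simp only [hgdef] at h; split_ifs at h
    · exact hsupp₀ J k ξ h
    · exact absurd rfl h
  have hsub : Finset.range n ⊆ Finset.range (L * n) :=
    Finset.range_mono (Nat.le_mul_of_pos_left n hL0)
  have hext : ∀ {M : Type} [AddCommMonoid M] (h : ℕ → M), (∀ k, ¬ k < n → h k = 0) →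
      ∑ k ∈ Finset.range n, h k = ∑ k ∈ Finset.range (L * n), h k := fun h hz =>
    Finset.sum_subset hsub fun k _ hk => hz k (by simpa using hk)
  have hgg : ∀ J k, k < n → g J k = g₀ J k := fun J k hk => by simp [hgdef, hk]
  have hgz : ∀ J k, ¬ k < n → g J k = fun _ => 0 := fun J k hk => by simp [hgdef, hk]
  have hS1 : ∀ J ξ, ∑ i ∈ Finset.range n, g₀ J i ξ =
      ∑ r ∈ Finset.range L, ∑ k ∈ Finset.range n, g J (L * k + r) ξ := fun J ξ => by
    rw [← sum_range_mul_eq fun i => g J i ξ, ← hext _ fun k hk => by rw [hgz J k hk]]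
    exact Finset.sum_congr rfl fun i hi => by rw [hgg J i (Finset.mem_range.1 hi)]
  have hS2 : ∀ J x, ∑ k ∈ Finset.range n, ‖𝓕⁻ (g₀ J k) x‖ₑ ^ 2 =
      ∑ r ∈ Finset.range L, ∑ k ∈ Finset.range n, ‖𝓕⁻ (g J (L * k + r)) x‖ₑ ^ 2 := fun J x => by
    rw [← sum_range_mul_eq fun i => ‖𝓕⁻ (g J i) x‖ₑ ^ 2,
      ← hext _ fun k hk => by rw [hgz J k hk, fourierInv_zero_fun]; simp]
    exact Finset.sum_congr rfl fun i hi => by rw [hgg J i (Finset.mem_range.1 hi)]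
  set A : ℕ → ℝ → ℝ≥0∞ := fun r x =>
    ∑ J ∈ s, ‖𝓕⁻ (fun ξ => ∑ k ∈ Finset.range n, g J (L * k + r) ξ) x‖ₑ ^ 2 with hA
  have hAm : ∀ r, Measurable (A r) := fun r => Finset.measurable_fun_sum _ fun J _ =>
    (continuous_fourierInv_of_integrable
      (Nice.sum fun k _ => hg J (L * k + r)).integrable).measurable.enorm.pow_const 2
  have key : ∀ r < L, ∫⁻ x, A r x ^ m ≤
      C * ∫⁻ x, (∑ J ∈ s, ∑ k ∈ Finset.range n, ‖𝓕⁻ (g₀ J k) x‖ₑ ^ 2) ^ m := by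
    intro r hr
    refine (H ι s a (fun k => c * 2 ^ (L * k + r)) (fun k => by positivity) (fun k => ?_)
      (fun J k => g J (L * k + r)) (fun J k => hg J _) (fun J k ξ h => hsupp J _ ξ h) n).trans ?_
    · calc 2 * m * D * (c * 2 ^ (L * k + r)) ≤ 2 ^ L * (c * 2 ^ (L * k + r)) := by gcongr
        _ = _ := by ring
    · refine mul_le_mul_right (lintegral_mono fun x => ?_) _
      dsimp only
      refine pow_le_pow_left' (Finset.sum_le_sum fun J hJ => ?_) m
      rw [hS2]
      exact Finset.single_le_sum (f := fun r => ∑ k ∈ Finset.range n,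
        ‖𝓕⁻ (g J (L * k + r)) x‖ₑ ^ 2) (fun i _ => zero_le) (Finset.mem_range.2 hr)
  calc ∫⁻ x, (∑ J ∈ s, ‖𝓕⁻ (fun ξ => ∑ i ∈ Finset.range n, g₀ J i ξ) x‖ₑ ^ 2) ^ m
      ≤ ∫⁻ x, L ^ m * (L ^ m * ∑ r ∈ Finset.range L, A r x ^ m) := by
        refine lintegral_mono fun x => ?_
        calc (∑ J ∈ s, ‖𝓕⁻ (fun ξ => ∑ i ∈ Finset.range n, g₀ J i ξ) x‖ₑ ^ 2) ^ m
            ≤ (L * ∑ r ∈ Finset.range L, A r x) ^ m := by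
              gcongr
              rw [Finset.sum_comm, Finset.mul_sum]
              refine Finset.sum_le_sum fun J _ => ?_
              rw [fourierInv_congr (hS1 J), fourierInv_sum _ fun r _ =>
                (Nice.sum fun k _ => hg J (L * k + r)).integrable]
              simpa using enorm_sum_sq_le (Finset.range L)
                fun r => 𝓕⁻ (fun ξ => ∑ k ∈ Finset.range n, g J (L * k + r) ξ) x
          _ = L ^ m * (∑ r ∈ Finset.range L, A r x) ^ m := mul_pow _ _ _
          _ ≤ _ := by
              gcongr
              simpa using sum_pow_le_card_pow_mul (Finset.range L) (fun r => A r x)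
                (by omega : m ≠ 0)
    _ = L ^ m * (L ^ m * ∑ r ∈ Finset.range L, ∫⁻ x, A r x ^ m) := by
        rw [lintegral_const_mul' _ _ (by finiteness), lintegral_const_mul' _ _ (by finiteness),
          lintegral_finsetSum' _ fun r _ => ((hAm r).pow_const m).aemeasurable]
    _ ≤ L ^ m * (L ^ m * ∑ r ∈ Finset.range L,
          C * ∫⁻ x, (∑ J ∈ s, ∑ k ∈ Finset.range n, ‖𝓕⁻ (g₀ J k) x‖ₑ ^ 2) ^ m) := by
        gcongr with r hr; exact key r (Finset.mem_range.1 hr)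
    _ = _ := by rw [Finset.sum_const, Finset.card_range, nsmul_eq_mul]; ring

end LittlewoodPaley

section RubioDeFrancia
open Set FourierTransform ComplexConjugate

/-- Square function estimate for the dyadic pieces that resolve one endpoint of each interval. -/
lemma lintegral_endpoint_sum_pow_le {m : ℕ} (hm : 2 ≤ m) {S S₀ : Set ℝ} (hS : IsCompact S)
    (hS1 : ∀ y ∈ S, 1 / 6 ≤ |y| ∧ |y| ≤ 2 / 3)
    (hS0 : ∀ y ∈ S, ∀ r : ℝ, 0 < r → r ≤ 1 → r * y ∈ S₀)
    (ψ : SchwartzMap ℝ ℂ) (hψ : ∀ x ∉ S, ψ x = 0) :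
    ∃ C : ℝ≥0∞, C ≠ ∞ ∧ ∀ (ι : Type) [Fintype ι] (e l : ι → ℝ), (∀ J, 0 < l J) →
    (∀ ξ J J', (ξ - e J) / l J ∈ S₀ → (ξ - e J') / l J' ∈ S₀ → J = J') →
    ∀ δ : ℝ, 0 < δ → ∀ N : ι → ℕ, (∀ J, 2 ^ N J * δ ≤ l J ∧ l J < 2 ^ (N J + 1) * δ) →
    ∀ f : ℝ → ℂ, Nice f →
    ∫⁻ x, (∑ J, ‖𝓕⁻ (fun ξ => (∑ t ∈ Finset.range (N J + 1), ψ (2 ^ t * ((ξ - e J) / l J))) * 𝓕 f ξ)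
      x‖ₑ ^ 2) ^ m ≤ C * ∫⁻ x, (‖f x‖ₑ ^ 2) ^ m := by
  obtain ⟨C₁, hC₁, H₁⟩ := lintegral_dyadic_sum_pow_le hm (D := 8) (by norm_num)
  obtain ⟨C₂, hC₂, H₂⟩ := smooth_rdf hS ψ hψ 3 hm
  refine ⟨C₁ * C₂, by finiteness, fun ι _ e l hl hdisj δ hδ N hN f hf => ?_⟩
  classical
  set L : ι → ℕ → ℝ := fun J t => l J / 2 ^ N J * 2 ^ t with hLdef
  have hL : ∀ J t, 0 < L J t := fun J t => by have := hl J; positivity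
  have hL1 : ∀ J, δ ≤ l J / 2 ^ N J ∧ l J / 2 ^ N J ≤ 2 * δ := fun J => by
    obtain ⟨h1, h2⟩ := hN J
    constructor
    · rw [le_div_iff₀ (by positivity)]; linarith
    · rw [div_le_iff₀ (by positivity)]; rw [pow_succ] at h2; linarith
  set g : ι → ℕ → ℝ → ℂ := fun J t =>
    if t ≤ N J then fun ξ => bump ψ (e J) (L J t) ξ * 𝓕 f ξ else fun _ => 0 with hg
  set n := Finset.univ.sup N + 1 with hn
  have hNn : ∀ J, N J + 1 ≤ n := fun J => by
    have : N J ≤ Finset.univ.sup N := Finset.le_sup (f := N) (Finset.mem_univ J)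
    omega
  have hgn : ∀ J k, Nice (g J k) := fun J k => by
    simp only [hg]; split_ifs
    · exact nice_piece_symbol ψ _ (hL J k) hf.integrable
    · exact nice_zero
  have habs : ∀ J k ξ, (ξ - e J) / L J k ∈ S → l J / 2 ^ N J * 2 ^ k / 6 ≤ |ξ - e J| ∧
      |ξ - e J| ≤ 2 / 3 * (l J / 2 ^ N J * 2 ^ k) := fun J k ξ h => by
    obtain ⟨h1, h2⟩ := hS1 _ h
    rw [abs_div, abs_of_pos (hL J k)] at h1 h2
    rw [le_div_iff₀ (hL J k)] at h1
    rw [div_le_iff₀ (hL J k)] at h2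
    exact ⟨by simp only [hLdef] at h1; linarith, h2⟩
  have hsupp : ∀ J k ξ, g J k ξ ≠ 0 → δ / 6 * 2 ^ k ≤ |ξ - e J| ∧
      |ξ - e J| ≤ 8 * (δ / 6 * 2 ^ k) := fun J k ξ h => by
    simp only [hg] at h
    split_ifs at h
    swap
    · exact absurd rfl h
    have hmem : (ξ - e J) / L J k ∈ S := by
      by_contra hc
      exact h (by simp only [bump, hψ _ hc, zero_mul])
    obtain ⟨h1, h2⟩ := habs J k ξ hmem
    obtain ⟨h3, h4⟩ := hL1 J
    have hk : (0:ℝ) < 2 ^ k := by positivity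
    constructor
    · nlinarith
    · nlinarith
  have hsum : ∀ J ξ, (∑ t ∈ Finset.range (N J + 1), ψ (2 ^ t * ((ξ - e J) / l J))) * 𝓕 f ξ =
      ∑ i ∈ Finset.range n, g J i ξ := fun J ξ => by
    rw [← Finset.sum_subset (Finset.range_mono (hNn J)) (f := fun i => g J i ξ), Finset.sum_mul,
      ← Finset.sum_range_reflect]
    · refine Finset.sum_congr rfl fun t ht => ?_
      have ht' : t ≤ N J := by simpa [Nat.lt_succ_iff] using ht
      simp only [hg, if_pos ht', bump, hLdef]
      congr 2
      rw [show N J + 1 - 1 - t = N J - t by omega, pow_sub₀ _ two_ne_zero ht']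
      have := (hl J).ne'
      field_simp
    · intro k _ hk
      have : ¬ k ≤ N J := by simpa [Nat.lt_succ_iff] using hk
      simp [hg, this]
  set s : Finset (ι × ℕ) := (Finset.univ ×ˢ Finset.range n).filter fun i => i.2 ≤ N i.1 with hs
  have hpieces : ∀ x, ∑ J, ∑ k ∈ Finset.range n, ‖𝓕⁻ (g J k) x‖ₑ ^ 2 =
      ∑ i ∈ s, ‖piece ψ (e i.1) (L i.1 i.2) f x‖ₑ ^ 2 := fun x => by
    rw [hs, Finset.sum_filter, Finset.sum_product]
    refine Finset.sum_congr rfl fun J _ => Finset.sum_congr rfl fun k _ => ?_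
    simp only [hg]
    split_ifs
    · rfl
    · rw [fourierInv_zero_fun]; simp
  have hover : ∀ ξ, ∀ t ⊆ s, (∀ i ∈ t, (ξ - e i.1) / L i.1 i.2 ∈ S) → t.card ≤ 3 := by
    intro ξ t hts ht
    rcases t.eq_empty_or_nonempty with rfl | hne
    · simp
    obtain ⟨i₀, hi₀, hmin⟩ := t.exists_min_image (fun i => i.2) hne
    have hmem : ∀ i ∈ t, (ξ - e i.1) / l i.1 ∈ S₀ := fun i hi => by
      have hiN : i.2 ≤ N i.1 := (Finset.mem_filter.1 (hts hi)).2
      have := hS0 _ (ht i hi) (2 ^ i.2 / 2 ^ N i.1) (by positivity)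
        ((div_le_one (by positivity)).2 (pow_le_pow_right₀ (by norm_num) hiN))
      convert this using 1
      simp only [hLdef]
      have := (hl i.1).ne'
      field_simp
    have hsub : t ⊆ (Finset.range 3).image fun j => (i₀.1, i₀.2 + j) := by
      intro i hi
      have hJ : i.1 = i₀.1 := hdisj ξ _ _ (hmem i hi) (hmem i₀ hi₀)
      have h1 := (habs _ _ _ (ht i hi)).1
      have h2 := (habs _ _ _ (ht i₀ hi₀)).2
      rw [hJ] at h1
      have hpos : 0 < l i₀.1 / 2 ^ N i₀.1 := by have := hl i₀.1; positivity
      have h3 : (2:ℝ) ^ i.2 ≤ 2 ^ (i₀.2 + 2) := by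
        rw [pow_add]
        nlinarith [le_trans h1 h2]
      have h4 : i.2 ≤ i₀.2 + 2 := (pow_le_pow_iff_right₀ (by norm_num)).1 h3
      have h5 := hmin i hi
      refine Finset.mem_image.2 ⟨i.2 - i₀.2, Finset.mem_range.2 (by omega), ?_⟩
      exact Prod.ext hJ.symm (by simp only; omega)
    exact (Finset.card_le_card hsub).trans (Finset.card_image_le.trans (by simp))
  calc _ = ∫⁻ x, (∑ J, ‖𝓕⁻ (fun ξ => ∑ i ∈ Finset.range n, g J i ξ) x‖ₑ ^ 2) ^ m := by
        simp only [hsum]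
    _ ≤ C₁ * ∫⁻ x, (∑ J, ∑ k ∈ Finset.range n, ‖𝓕⁻ (g J k) x‖ₑ ^ 2) ^ m :=
        H₁ ι Finset.univ e (δ / 6) (by positivity) g hgn hsupp n
    _ ≤ C₁ * (C₂ * ∫⁻ x, (‖f x‖ₑ ^ 2) ^ m) := by
        simp only [hpieces]
        exact mul_le_mul_right (H₂ (ι × ℕ) s (fun i => e i.1) (fun i => L i.1 i.2)
          (fun i _ => hL _ _) hover f hf) _
    _ = _ := by ring

end RubioDeFrancia

section SharpCutoffs
open Set FourierTransform ComplexConjugate Filter Topology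

lemma tendsto_fourierInv {u : ℕ → ℝ → ℂ} {v : ℝ → ℂ} {b : ℝ → ℝ} (hu : ∀ n, Measurable (u n))
    (hb : Integrable b) (hub : ∀ n ξ, ‖u n ξ‖ ≤ b ξ)
    (huv : ∀ ξ, Tendsto (fun n => u n ξ) atTop (𝓝 (v ξ))) (x : ℝ) :
    Tendsto (fun n => 𝓕⁻ (u n) x) atTop (𝓝 (𝓕⁻ v x)) := by
  simp only [fourierInv_eq_ex]
  refine tendsto_integral_of_dominated_convergence b (fun n => ?_) hb (fun n => .of_forall fun ξ => ?_)
    (.of_forall fun ξ => (huv ξ).const_mul _)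
  · exact ((measurable_ex.comp (by fun_prop)).mul (hu n)).aestronglyMeasurable
  · rw [norm_mul, norm_ex, one_mul]; exact hub n ξ

lemma lintegral_le_of_tendsto {F : ℕ → ℝ → ℝ≥0∞} {G : ℝ → ℝ≥0∞} {K : ℝ≥0∞}
    (hF : ∀ n, Measurable (F n)) (hFG : ∀ x, Tendsto (fun n => F n x) atTop (𝓝 (G x)))
    (hK : ∀ n, ∫⁻ x, F n x ≤ K) : ∫⁻ x, G x ≤ K := by
  calc ∫⁻ x, G x = ∫⁻ x, liminf (fun n => F n x) atTop :=
        lintegral_congr fun x => (hFG x).liminf_eq.symm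
    _ ≤ liminf (fun n => ∫⁻ x, F n x) atTop := lintegral_liminf_le hF
    _ ≤ K := by
        refine liminf_le_of_le (by isBoundedDefault) fun b hb => ?_
        obtain ⟨n, hn⟩ := hb.exists
        exact hn.trans (hK n)

/-- A smooth increasing function equal to `0` on `(-∞, 1/3]` and to `1` on `[2/3, ∞)`. -/
noncomputable def smoothStep (x : ℝ) : ℝ := Real.smoothTransition (3 * x - 1)

lemma smoothStep_of_le {x : ℝ} (h : x ≤ 1 / 3) : smoothStep x = 0 :=
  Real.smoothTransition.zero_of_nonpos (by linarith)

lemma smoothStep_of_ge {x : ℝ} (h : 2 / 3 ≤ x) : smoothStep x = 1 :=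
  Real.smoothTransition.one_of_one_le (by linarith)

lemma smoothStep_one_sub (x : ℝ) : smoothStep (1 - x) = 1 - smoothStep x := by
  have h := (Real.smoothTransition.pos_denom (3 * x - 1)).ne'
  rw [smoothStep, smoothStep, Real.smoothTransition, Real.smoothTransition, eq_sub_iff_add_eq,
    show 1 - (3 * (1 - x) - 1) = 3 * x - 1 by ring, show 3 * (1 - x) - 1 = 1 - (3 * x - 1) by ring,
    add_comm (expNegInvGlue (1 - (3 * x - 1))), ← add_div, add_comm (expNegInvGlue (1 - (3 * x - 1))),
    div_self h]

lemma abs_smoothStep_sub_le (x y : ℝ) : |smoothStep x - smoothStep y| ≤ 1 := by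
  have h1 := Real.smoothTransition.nonneg (3 * x - 1)
  have h2 := Real.smoothTransition.le_one (3 * x - 1)
  have h3 := Real.smoothTransition.nonneg (3 * y - 1)
  have h4 := Real.smoothTransition.le_one (3 * y - 1)
  rw [abs_le]; unfold smoothStep; constructor <;> linarith

lemma contDiff_smoothStep : ContDiff ℝ (⊤ : ℕ∞) smoothStep :=
  Real.smoothTransition.contDiff.comp (by fun_prop)

/-- A Schwartz function whose dilates telescope to a difference of smooth steps. -/
lemma exists_schwartz_smoothStep (σ : ℝ) (hσ : σ = 1 ∨ σ = -1) :
    ∃ ψ : SchwartzMap ℝ ℂ, ∀ x, ψ x = ((smoothStep (2 * (σ * x)) - smoothStep (σ * x) : ℝ) : ℂ) := by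
  set h : ℝ → ℂ := fun x => ((smoothStep (2 * (σ * x)) - smoothStep (σ * x) : ℝ) : ℂ) with hh
  have hc : ContDiff ℝ (⊤ : ℕ∞) h :=
    ofRealCLM.contDiff.comp ((contDiff_smoothStep.comp (by fun_prop)).sub
      (contDiff_smoothStep.comp (by fun_prop)))
  have hs : HasCompactSupport h := by
    refine HasCompactSupport.intro (isCompact_Icc (a := (-1:ℝ)) (b := 1)) fun x hx => ?_
    have hx' : 1 < |x| := by
      by_contra hc; exact hx (abs_le.1 (not_lt.1 hc))
    have : |σ * x| = |x| := by rcases hσ with rfl | rfl <;> simp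
    rw [← this] at hx'
    rcases lt_abs.1 hx' with h1 | h1
    · simp only [hh]; rw [smoothStep_of_ge (by linarith), smoothStep_of_ge (by linarith)]; simp
    · simp only [hh]; rw [smoothStep_of_le (by linarith), smoothStep_of_le (by linarith)]; simp
  exact ⟨hs.toSchwartzMap hc, fun x => rfl⟩

/-- The profile `1_{y > 0} - smoothStep y`. -/
noncomputable def sharpEnd (y : ℝ) : ℝ := (if 0 < y then 1 else 0) - smoothStep y

lemma measurable_sharpEnd : Measurable sharpEnd :=
  (Measurable.ite measurableSet_Ioi measurable_const measurable_const).sub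
    contDiff_smoothStep.continuous.measurable

lemma sharpEnd_add_sharpEnd (y : ℝ) :
    sharpEnd y + sharpEnd (1 - y) = if 0 < y ∧ y < 1 then 1 else 0 := by
  rw [sharpEnd, sharpEnd, smoothStep_one_sub]
  by_cases h1 : 0 < y <;> by_cases h2 : y < 1 <;> simp [h1, h2]
  linarith

lemma sum_smoothStep (y : ℝ) (n : ℕ) :
    ∑ t ∈ Finset.range n, (smoothStep (2 * (2 ^ t * y)) - smoothStep (2 ^ t * y)) =
      smoothStep (2 ^ n * y) - smoothStep y := by
  induction n with
  | zero => simp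
  | succ n ih => rw [Finset.sum_range_succ, ih, pow_succ]; ring_nf

lemma smoothStep_sub_eq_zero {y : ℝ} (hy : y ∉ Icc 0 1) (n : ℕ) :
    smoothStep (2 ^ n * y) - smoothStep y = 0 := by
  have hn : (1:ℝ) ≤ 2 ^ n := one_le_pow₀ (by norm_num)
  rcases lt_or_ge y 0 with h | h
  · rw [smoothStep_of_le (by nlinarith), smoothStep_of_le (by linarith), sub_self]
  · have : 1 < y := by by_contra hc; exact hy ⟨h, not_lt.1 hc⟩
    rw [smoothStep_of_ge (by nlinarith), smoothStep_of_ge (by linarith), sub_self]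

lemma tendsto_smoothStep_sub (y : ℝ) {N : ℕ → ℕ} (hN : Tendsto N atTop atTop) :
    Tendsto (fun R => smoothStep (2 ^ N R * y) - smoothStep y) atTop (𝓝 (sharpEnd y)) := by
  refine Tendsto.sub_const ?_ _
  refine tendsto_const_nhds.congr' ?_
  by_cases hy : 0 < y
  · have h1 : Tendsto (fun R => (2:ℝ) ^ N R * y) atTop atTop :=
      ((tendsto_pow_atTop_atTop_of_one_lt one_lt_two).comp hN).atTop_mul_const hy
    filter_upwards [h1.eventually_ge_atTop (2 / 3)] with R hR
    rw [smoothStep_of_ge hR, if_pos hy]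
  · refine .of_forall fun R => ?_
    have : (0:ℝ) < 2 ^ N R := by positivity
    simp only [if_neg hy]
    rw [smoothStep_of_le (by nlinarith)]

end SharpCutoffs

section SharpSquareFunction
open Set FourierTransform ComplexConjugate Filter Topology

lemma lintegral_sharpEnd_sum_pow_le {m : ℕ} (hm : 2 ≤ m) (σ : ℝ) (hσ : σ = 1 ∨ σ = -1) :
    ∃ C : ℝ≥0∞, C ≠ ∞ ∧ ∀ (ι : Type) [Fintype ι] (e l : ι → ℝ), (∀ J, 0 < l J) →
    (∀ ξ J J', σ * ((ξ - e J) / l J) ∈ Ioo 0 1 → σ * ((ξ - e J') / l J') ∈ Ioo 0 1 → J = J') →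
    ∀ f : ℝ → ℂ, Nice f →
    ∫⁻ x, (∑ J, ‖𝓕⁻ (fun ξ => (sharpEnd (σ * ((ξ - e J) / l J)) : ℂ) * 𝓕 f ξ) x‖ₑ ^ 2) ^ m ≤
      C * ∫⁻ x, (‖f x‖ₑ ^ 2) ^ m := by
  obtain ⟨ψ, hψ⟩ := exists_schwartz_smoothStep σ hσ
  have habs : ∀ x, |σ * x| = |x| := fun x => by rcases hσ with rfl | rfl <;> simp
  have hS1 : ∀ y ∈ {y : ℝ | σ * y ∈ Icc (1 / 6) (2 / 3)}, 1 / 6 ≤ |y| ∧ |y| ≤ 2 / 3 := by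
    rintro y ⟨h1, h2⟩
    rw [← habs, abs_of_pos (by linarith)]
    exact ⟨h1, h2⟩
  have hS : IsCompact {y : ℝ | σ * y ∈ Icc (1 / 6) (2 / 3)} := by
    refine (isCompact_Icc (a := (-1:ℝ)) (b := 1)).of_isClosed_subset
      (isClosed_Icc.preimage (by fun_prop)) fun y hy => ?_
    have := (hS1 y hy).2
    exact abs_le.1 (by linarith)
  have hS0 : ∀ y ∈ {y : ℝ | σ * y ∈ Icc (1 / 6) (2 / 3)}, ∀ r : ℝ, 0 < r → r ≤ 1 →
      r * y ∈ {y | σ * y ∈ Ioo 0 1} := by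
    rintro y ⟨h1, h2⟩ r hr hr1
    have h : σ * (r * y) = r * (σ * y) := by ring
    rw [mem_ofPred_eq, h]
    exact ⟨by nlinarith, by nlinarith⟩
  have hψ0 : ∀ x ∉ {y : ℝ | σ * y ∈ Icc (1 / 6) (2 / 3)}, ψ x = 0 := by
    intro x hx
    rw [hψ]
    rw [mem_ofPred_eq, mem_Icc, not_and_or, not_le, not_le] at hx
    rcases hx with h | h
    · rw [smoothStep_of_le (by linarith), smoothStep_of_le (by linarith)]; simp
    · rw [smoothStep_of_ge (by linarith), smoothStep_of_ge (by linarith)]; simp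
  obtain ⟨C, hC, H⟩ := lintegral_endpoint_sum_pow_le hm hS hS1 hS0 ψ hψ0
  refine ⟨C, hC, fun ι _ e l hl hdisj f hf => ?_⟩
  obtain ⟨d, hd, hdl⟩ : ∃ d : ℝ, 0 < d ∧ ∀ J, d ≤ l J := by
    rcases isEmpty_or_nonempty ι with hι | hι
    · exact ⟨1, one_pos, fun J => hι.elim J⟩
    · obtain ⟨j, hj⟩ := Finite.exists_min l
      exact ⟨l j, hl j, hj⟩
  have hN : ∀ R : ℕ, ∀ J, ∃ n : ℕ, 2 ^ n * (d / 2 ^ R) ≤ l J ∧ l J < 2 ^ (n + 1) * (d / 2 ^ R) := by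
    intro R J
    have hpos : 0 < d / 2 ^ R := by positivity
    have h1 : 1 ≤ l J / (d / 2 ^ R) := by
      rw [le_div_iff₀ hpos, one_mul]
      exact (div_le_self hd.le (one_le_pow₀ (by norm_num))).trans (hdl J)
    obtain ⟨n, hn1, hn2⟩ := exists_nat_pow_near h1 one_lt_two
    rw [le_div_iff₀ hpos] at hn1
    rw [div_lt_iff₀ hpos] at hn2
    exact ⟨n, hn1, hn2⟩
  choose N hN using hN
  have hNR : ∀ R J, R ≤ N R J := fun R J => by
    have h := (hdl J).trans_lt (hN R J).2
    have h2 : (2:ℝ) ^ R < 2 ^ (N R J + 1) := by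
      rw [mul_div_assoc', lt_div_iff₀ (by positivity)] at h
      nlinarith
    have := (pow_lt_pow_iff_right₀ (one_lt_two (α := ℝ))).1 h2
    omega
  set u : ℕ → ι → ℝ → ℂ := fun R J ξ =>
    (∑ t ∈ Finset.range (N R J + 1), ψ (2 ^ t * ((ξ - e J) / l J))) * 𝓕 f ξ with hu
  have hu' : ∀ R J ξ, u R J ξ = ((smoothStep (2 ^ (N R J + 1) * (σ * ((ξ - e J) / l J))) -
      smoothStep (σ * ((ξ - e J) / l J)) : ℝ) : ℂ) * 𝓕 f ξ := fun R J ξ => by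
    rw [← sum_smoothStep, hu]
    simp only [hψ, ofReal_sum]
    congr 1
    refine Finset.sum_congr rfl fun t _ => ?_
    rw [mul_left_comm σ]
  have hFm := (continuous_fourier_of_integrable hf.integrable).measurable
  have hst := contDiff_smoothStep.continuous.measurable
  have hum : ∀ R J, Measurable (u R J) := fun R J => by
    rw [funext (hu' R J)]
    refine (measurable_ofReal.comp ((hst.comp (by fun_prop)).sub (hst.comp (by fun_prop)))).mul hFm
  have hub : ∀ R J ξ, ‖u R J ξ‖ ≤ (Icc (e J - l J) (e J + l J)).indicator (fun ξ => ‖𝓕 f ξ‖) ξ := by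
    intro R J ξ
    by_cases hξ : ξ ∈ Icc (e J - l J) (e J + l J)
    · rw [indicator_of_mem hξ, hu', norm_mul, norm_real]
      exact mul_le_of_le_one_left (norm_nonneg _) (abs_smoothStep_sub_le _ _)
    · rw [indicator_of_notMem hξ, hu', smoothStep_sub_eq_zero]
      · simp
      · rintro ⟨h1, h2⟩
        have h3 := habs ((ξ - e J) / l J)
        rw [abs_of_nonneg h1, abs_div, abs_of_pos (hl J)] at h3
        rw [h3, div_le_one (hl J), abs_le] at h2
        exact hξ ⟨by linarith, by linarith⟩
  have hbi : ∀ J, Integrable ((Icc (e J - l J) (e J + l J)).indicator (fun ξ => ‖𝓕 f ξ‖)) := fun J =>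
    (continuous_fourier_of_integrable hf.integrable).norm.integrableOn_Icc.integrable_indicator
      measurableSet_Icc
  have hlim : ∀ J x, Tendsto (fun R => 𝓕⁻ (u R J) x) atTop
      (𝓝 (𝓕⁻ (fun ξ => (sharpEnd (σ * ((ξ - e J) / l J)) : ℂ) * 𝓕 f ξ) x)) := fun J x => by
    refine tendsto_fourierInv (fun R => hum R J) (hbi J) (fun R => hub R J) (fun ξ => ?_) x
    simp only [hu']
    refine Tendsto.mul_const _ ((continuous_ofReal.tendsto _).comp
      (tendsto_smoothStep_sub (σ * ((ξ - e J) / l J)) (N := fun R => N R J + 1) ?_))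
    exact tendsto_atTop_mono (fun R => (hNR R J).trans (Nat.le_succ _)) tendsto_id
  refine lintegral_le_of_tendsto (F := fun R x => (∑ J, ‖𝓕⁻ (u R J) x‖ₑ ^ 2) ^ m) (fun R => ?_)
    (fun x => ?_) fun R => H ι e l hl hdisj _ (by positivity) (N R) (hN R) f hf
  · refine (Finset.measurable_fun_sum _ fun J _ => ?_).pow_const m
    exact (continuous_fourierInv_of_integrable ((hbi J).mono' (hum R J).aestronglyMeasurable
      (.of_forall (hub R J)))).measurable.enorm.pow_const 2
  · refine ENNReal.Tendsto.pow (tendsto_finsetSum _ fun J _ => ENNReal.Tendsto.pow (hlim J x).enorm)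

lemma integrable_sharpEnd_mul {f : ℝ → ℂ} (hf : Integrable f) (a : ℝ) {l : ℝ} (hl : 0 < l) :
    Integrable fun ξ => (sharpEnd ((ξ - a) / l) : ℂ) * 𝓕 f ξ := by
  have hFc := continuous_fourier_of_integrable hf
  refine (hFc.norm.integrableOn_Icc.integrable_indicator
    (measurableSet_Icc (a := a) (b := a + l))).mono' ?_ (.of_forall fun ξ => ?_)
  · exact ((measurable_ofReal.comp (measurable_sharpEnd.comp (by fun_prop))).mul
      hFc.measurable).aestronglyMeasurable
  · by_cases hξ : ξ ∈ Icc a (a + l)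
    · rw [indicator_of_mem hξ, norm_mul, norm_real]
      refine mul_le_of_le_one_left (norm_nonneg _) ?_
      rw [Real.norm_eq_abs, abs_le, sharpEnd]
      have h1 := Real.smoothTransition.nonneg (3 * ((ξ - a) / l) - 1)
      have h2 := Real.smoothTransition.le_one (3 * ((ξ - a) / l) - 1)
      unfold smoothStep
      split_ifs <;> constructor <;> linarith
    · rw [indicator_of_notMem hξ, sharpEnd]
      rcases lt_or_ge ξ a with h | h
      · have h0 : (ξ - a) / l < 0 := div_neg_of_neg_of_pos (by linarith) hl
        rw [if_neg h0.not_gt, smoothStep_of_le (by linarith)]; simp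
      · have h1 : a + l < ξ := by by_contra hc; exact hξ ⟨h, not_lt.1 hc⟩
        have h2 : 1 ≤ (ξ - a) / l := by rw [le_div_iff₀ hl]; linarith
        rw [if_pos (by linarith), smoothStep_of_ge (by linarith)]; simp

lemma add_pow_le_two_pow_mul (a b : ℝ≥0∞) {m : ℕ} (hm : m ≠ 0) :
    (a + b) ^ m ≤ 2 ^ m * (a ^ m + b ^ m) := by
  simpa using sum_pow_le_card_pow_mul (Finset.univ : Finset (Fin 2)) ![a, b] hm

/-- Rubio de Francia's inequality for finitely many disjoint intervals. -/
lemma rubio_de_francia {m : ℕ} (hm : 2 ≤ m) :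
    ∃ C : ℝ≥0∞, C ≠ ∞ ∧ ∀ (ι : Type) [Fintype ι] (a b : ι → ℝ), (∀ J, a J < b J) →
    (∀ ξ J J', ξ ∈ Ioo (a J) (b J) → ξ ∈ Ioo (a J') (b J') → J = J') →
    ∀ f : ℝ → ℂ, Nice f →
    ∫⁻ x, (∑ J, ‖𝓕⁻ ((Ioo (a J) (b J)).indicator (𝓕 f)) x‖ₑ ^ 2) ^ m ≤
      C * ∫⁻ x, (‖f x‖ₑ ^ 2) ^ m := by
  obtain ⟨C₁, hC₁, H₁⟩ := lintegral_sharpEnd_sum_pow_le hm 1 (.inl rfl)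
  obtain ⟨C₂, hC₂, H₂⟩ := lintegral_sharpEnd_sum_pow_le hm (-1) (.inr rfl)
  refine ⟨4 ^ m * (C₁ + C₂), by finiteness, fun ι _ a b hab hdisj f hf => ?_⟩
  set y : ι → ℝ → ℝ := fun J ξ => (ξ - a J) / (b J - a J) with hy
  have hl : ∀ J, 0 < b J - a J := fun J => by linarith [hab J]
  have hmem : ∀ J ξ, ξ ∈ Ioo (a J) (b J) ↔ 0 < y J ξ ∧ y J ξ < 1 := fun J ξ => by
    simp only [hy, div_lt_one (hl J), div_pos_iff_of_pos_right (hl J), mem_Ioo]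
    constructor <;> rintro ⟨h1, h2⟩ <;> constructor <;> linarith
  have hy' : ∀ J ξ, -1 * ((ξ - b J) / (b J - a J)) = 1 - y J ξ := fun J ξ => by
    have := (hl J).ne'
    simp only [hy]; field_simp; ring
  set A : ι → ℝ → ℂ := fun J => 𝓕⁻ fun ξ => (sharpEnd (1 * ((ξ - a J) / (b J - a J))) : ℂ) * 𝓕 f ξ
    with hA
  set B : ι → ℝ → ℂ := fun J => 𝓕⁻ fun ξ => (sharpEnd (-1 * ((ξ - b J) / (b J - a J))) : ℂ) * 𝓕 f ξ
    with hB
  have hAi : ∀ J, Integrable fun ξ => (sharpEnd (1 * ((ξ - a J) / (b J - a J))) : ℂ) * 𝓕 f ξ :=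
    fun J => by simpa only [one_mul] using integrable_sharpEnd_mul hf.integrable (a J) (hl J)
  have hIi : ∀ J, Integrable ((Ioo (a J) (b J)).indicator (𝓕 f)) := fun J =>
    ((continuous_fourier_of_integrable hf.integrable).integrableOn_Icc.mono_set
      Ioo_subset_Icc_self).integrable_indicator measurableSet_Ioo
  have hsplit : ∀ J ξ, (Ioo (a J) (b J)).indicator (𝓕 f) ξ =
      (sharpEnd (1 * ((ξ - a J) / (b J - a J))) : ℂ) * 𝓕 f ξ +
      (sharpEnd (-1 * ((ξ - b J) / (b J - a J))) : ℂ) * 𝓕 f ξ := fun J ξ => by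
    rw [← add_mul, ← ofReal_add, hy', one_mul, sharpEnd_add_sharpEnd, indicator_apply]
    simp only [hmem]
    split_ifs <;> simp
  have hBi : ∀ J, Integrable fun ξ => (sharpEnd (-1 * ((ξ - b J) / (b J - a J))) : ℂ) * 𝓕 f ξ :=
    fun J => ((hIi J).sub (hAi J)).congr (.of_forall fun ξ => by
      simp only [Pi.sub_apply]; rw [hsplit]; ring)
  have hsplit' : ∀ J x, 𝓕⁻ ((Ioo (a J) (b J)).indicator (𝓕 f)) x = A J x - -B J x := fun J x => by
    rw [fourierInv_congr (hsplit J), sub_neg_eq_add]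
    simp only [hA, hB, fourierInv_eq_ex, mul_add]
    exact integral_add (integrable_ex_mul (hAi J) (by fun_prop))
      (integrable_ex_mul (hBi J) (by fun_prop))
  have hAm : ∀ J, Measurable (A J) := fun J =>
    (continuous_fourierInv_of_integrable (hAi J)).measurable
  have hm0 : m ≠ 0 := by omega
  calc _ ≤ ∫⁻ x, 4 ^ m * ((∑ J, ‖A J x‖ₑ ^ 2) ^ m + (∑ J, ‖B J x‖ₑ ^ 2) ^ m) := by
        refine lintegral_mono fun x => ?_
        calc (∑ J, ‖𝓕⁻ ((Ioo (a J) (b J)).indicator (𝓕 f)) x‖ₑ ^ 2) ^ m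
            ≤ (∑ J, 2 * (‖A J x‖ₑ ^ 2 + ‖B J x‖ₑ ^ 2)) ^ m := by
              refine pow_le_pow_left' (Finset.sum_le_sum fun J _ => ?_) m
              rw [hsplit', ← enorm_neg (B J x)]
              exact enorm_sub_sq_le _ _
          _ = 2 ^ m * ((∑ J, ‖A J x‖ₑ ^ 2) + ∑ J, ‖B J x‖ₑ ^ 2) ^ m := by
              rw [← Finset.mul_sum, Finset.sum_add_distrib, mul_pow]
          _ ≤ 2 ^ m * (2 ^ m * ((∑ J, ‖A J x‖ₑ ^ 2) ^ m + (∑ J, ‖B J x‖ₑ ^ 2) ^ m)) :=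
              mul_le_mul_right (add_pow_le_two_pow_mul _ _ hm0) _
          _ = _ := by rw [← mul_assoc, ← mul_pow]; norm_num
    _ = 4 ^ m * ((∫⁻ x, (∑ J, ‖A J x‖ₑ ^ 2) ^ m) + ∫⁻ x, (∑ J, ‖B J x‖ₑ ^ 2) ^ m) := by
        rw [lintegral_const_mul' _ _ (by finiteness), lintegral_add_left]
        exact (Finset.measurable_fun_sum _ fun J _ => (hAm J).enorm.pow_const 2).pow_const m
    _ ≤ 4 ^ m * (C₁ * (∫⁻ x, (‖f x‖ₑ ^ 2) ^ m) + C₂ * ∫⁻ x, (‖f x‖ₑ ^ 2) ^ m) := by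
        refine mul_le_mul_right (add_le_add ?_ ?_) _
        · refine H₁ ι a (fun J => b J - a J) hl (fun ξ J J' h h' => ?_) f hf
          rw [one_mul] at h h'
          exact hdisj ξ J J' ((hmem _ _).2 h) ((hmem _ _).2 h')
        · refine H₂ ι b (fun J => b J - a J) hl (fun ξ J J' h h' => ?_) f hf
          rw [hy'] at h h'
          exact hdisj ξ J J' ((hmem _ _).2 ⟨by linarith [h.2], by linarith [h.1]⟩)
            ((hmem _ _).2 ⟨by linarith [h'.2], by linarith [h'.1]⟩)
    _ = _ := by ring

end SharpSquareFunction

section StepMultipliers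
open Set FourierTransform ComplexConjugate Filter Topology

lemma nice_indicator_fourier {f : ℝ → ℂ} (hf : Nice f) (a b : ℝ) :
    Nice ((Ioo a b).indicator (𝓕 f)) := by
  have hFc := continuous_fourier_of_integrable hf.integrable
  refine ⟨hFc.measurable.indicator measurableSet_Ioo,
    (hFc.integrableOn_Icc.mono_set Ioo_subset_Icc_self).integrable_indicator measurableSet_Ioo,
    ∫ v, ‖f v‖, fun x => (norm_indicator_le_norm_self _ _).trans (norm_fourier_le f x)⟩

lemma fourierInv_const_mul (c : ℂ) (g : ℝ → ℂ) (x : ℝ) :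
    𝓕⁻ (fun ξ => c * g ξ) x = c * 𝓕⁻ g x := by
  simp only [fourierInv_eq_ex, mul_left_comm _ c]
  exact integral_const_mul _ _

/-- A step multiplier with at most `N` steps in each dyadic annulus. -/
lemma lintegral_step_multiplier_pow_le {m : ℕ} (hm : 2 ≤ m) :
    ∃ C : ℝ≥0∞, C ≠ ∞ ∧ ∀ (ι : Type) [Fintype ι] (a b : ι → ℝ), (∀ J, a J < b J) →
    (∀ ξ J J', ξ ∈ Ioo (a J) (b J) → ξ ∈ Ioo (a J') (b J') → J = J') →
    ∀ (c : ℝ), 0 < c → ∀ (k : ι → ℕ) (N : ℕ),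
    (∀ J, ∀ ξ ∈ Ioo (a J) (b J), c * 2 ^ k J ≤ |ξ| ∧ |ξ| ≤ 2 * (c * 2 ^ k J)) →
    (∀ i, (Finset.univ.filter fun J => k J = i).card ≤ N) →
    ∀ z : ι → ℂ, (∀ J, ‖z J‖ ≤ 1) → ∀ f : ℝ → ℂ, Nice f →
    ∫⁻ x, (‖𝓕⁻ (fun ξ => ∑ J, z J * (Ioo (a J) (b J)).indicator (𝓕 f) ξ) x‖ₑ ^ 2) ^ m ≤
      C * N ^ m * ∫⁻ x, (‖f x‖ₑ ^ 2) ^ m := by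
  obtain ⟨C₁, hC₁, H₁⟩ := lintegral_dyadic_sum_pow_le hm (D := 2) (by norm_num)
  obtain ⟨C₂, hC₂, H₂⟩ := rubio_de_francia hm
  refine ⟨C₁ * C₂, by finiteness, fun ι _ a b hab hdisj c hc k N hk hN z hz f hf => ?_⟩
  classical
  set n := Finset.univ.sup k + 1 with hn
  have hkn : ∀ J, k J < n := fun J => by
    have : k J ≤ Finset.univ.sup k := Finset.le_sup (f := k) (Finset.mem_univ J)
    omega
  have hnice : ∀ J, Nice fun ξ => z J * (Ioo (a J) (b J)).indicator (𝓕 f) ξ := fun J =>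
    (nice_indicator_fourier hf (a J) (b J)).mul_bdd measurable_const fun _ => hz J
  set g : Unit → ℕ → ℝ → ℂ := fun _ i ξ => ∑ J ∈ Finset.univ.filter (fun J => k J = i),
    z J * (Ioo (a J) (b J)).indicator (𝓕 f) ξ with hg
  have hsupp : ∀ J i ξ, g J i ξ ≠ 0 → c * 2 ^ i ≤ |ξ - 0| ∧ |ξ - 0| ≤ 2 * (c * 2 ^ i) := by
    intro _ i ξ h
    obtain ⟨J, hJ, hne⟩ := Finset.exists_ne_zero_of_sum_ne_zero h
    rw [sub_zero, ← (Finset.mem_filter.1 hJ).2]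
    refine hk J ξ ?_
    by_contra hc
    exact hne (by rw [indicator_of_notMem hc, mul_zero])
  have hsum : ∀ ξ, ∑ J, z J * (Ioo (a J) (b J)).indicator (𝓕 f) ξ =
      ∑ i ∈ Finset.range n, g () i ξ := fun ξ =>
    (Finset.sum_fiberwise_of_maps_to (fun J _ => Finset.mem_range.2 (hkn J)) _).symm
  have hpt : ∀ x, ∑ i ∈ Finset.range n, ‖𝓕⁻ (g () i) x‖ₑ ^ 2 ≤
      N * ∑ J, ‖𝓕⁻ ((Ioo (a J) (b J)).indicator (𝓕 f)) x‖ₑ ^ 2 := fun x => by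
    rw [← Finset.sum_fiberwise_of_maps_to (fun J _ => Finset.mem_range.2 (hkn J))
      (fun J => ‖𝓕⁻ ((Ioo (a J) (b J)).indicator (𝓕 f)) x‖ₑ ^ 2), Finset.mul_sum]
    refine Finset.sum_le_sum fun i _ => ?_
    simp only [hg]
    rw [fourierInv_sum _ fun J _ => (hnice J).integrable]
    refine (enorm_sum_sq_le _ _).trans (mul_le_mul' (by exact_mod_cast hN i)
      (Finset.sum_le_sum fun J _ => pow_le_pow_left' ?_ 2))
    rw [fourierInv_const_mul, enorm_mul]
    refine mul_le_of_le_one_left zero_le ?_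
    rw [← ofReal_norm]
    exact ENNReal.ofReal_le_one.2 (hz J)
  have h1 := H₁ Unit Finset.univ (fun _ => 0) c hc g (fun _ i => Nice.sum fun J _ => hnice J) hsupp n
  simp only [Finset.univ_unique, Finset.sum_singleton] at h1
  calc _ = ∫⁻ x, (‖𝓕⁻ (fun ξ => ∑ i ∈ Finset.range n, g () i ξ) x‖ₑ ^ 2) ^ m := by
        simp only [hsum]
    _ ≤ C₁ * ∫⁻ x, (∑ i ∈ Finset.range n, ‖𝓕⁻ (g () i) x‖ₑ ^ 2) ^ m := h1
    _ ≤ C₁ * ∫⁻ x, (N:ℝ≥0∞) ^ m *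
          (∑ J, ‖𝓕⁻ ((Ioo (a J) (b J)).indicator (𝓕 f)) x‖ₑ ^ 2) ^ m := by
        refine mul_le_mul_right (lintegral_mono fun x => ?_) _
        dsimp only
        rw [← mul_pow]
        exact pow_le_pow_left' (hpt x) m
    _ ≤ C₁ * (N ^ m * (C₂ * ∫⁻ x, (‖f x‖ₑ ^ 2) ^ m)) := by
        rw [lintegral_const_mul' _ _ (by finiteness)]
        exact mul_le_mul_right (mul_le_mul_right (H₂ ι a b hab hdisj f hf) _) _
    _ = _ := by ring

end StepMultipliers

section Interpolation
open Set FourierTransform ComplexConjugate Filter Topology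

/-- The Fourier multiplier operator with symbol `u`. -/
noncomputable def mulOp (u f : ℝ → ℂ) : ℝ → ℂ := 𝓕⁻ fun ξ => u ξ * 𝓕 f ξ

lemma Nice.symbol {u f : ℝ → ℂ} (hu : Nice u) (hf : Nice f) : Nice fun ξ => u ξ * 𝓕 f ξ :=
  hu.bdd_mul_fourier hf.integrable

lemma continuous_mulOp {u f : ℝ → ℂ} (hu : Nice u) (hf : Nice f) : Continuous (mulOp u f) :=
  continuous_fourierInv_of_integrable (hu.symbol hf).integrable

lemma mulOp_add {u f g : ℝ → ℂ} (hu : Nice u) (hf : Nice f) (hg : Nice g) (x : ℝ) :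
    mulOp u (fun y => f y + g y) x = mulOp u f x + mulOp u g x := by
  have hF : ∀ ξ, 𝓕 (fun y => f y + g y) ξ = 𝓕 f ξ + 𝓕 g ξ := fun ξ => by
    simp only [fourier_eq_ex, mul_add]
    exact integral_add (integrable_ex_mul hf.integrable (by fun_prop))
      (integrable_ex_mul hg.integrable (by fun_prop))
  simp only [mulOp, hF, fourierInv_eq_ex, mul_add]
  exact integral_add (integrable_ex_mul (hu.symbol hf).integrable (by fun_prop))
      (integrable_ex_mul (hu.symbol hg).integrable (by fun_prop))

lemma lintegral_enorm_mulOp_sq_le {u f : ℝ → ℂ} (hu : Nice u) (hu1 : ∀ ξ, ‖u ξ‖ ≤ 1) (hf : Nice f) :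
    ∫⁻ x, ‖mulOp u f x‖ₑ ^ 2 ≤ ∫⁻ x, ‖f x‖ₑ ^ 2 := by
  rw [mulOp, lintegral_enorm_fourierInv_sq (hu.symbol hf).integrable (hu.symbol hf).memLp,
    ← lintegral_enorm_fourier_sq hf.integrable hf.memLp]
  refine lintegral_mono fun ξ => pow_le_pow_left' ?_ 2
  rw [enorm_mul]
  refine mul_le_of_le_one_left zero_le ?_
  rw [← ofReal_norm]
  exact ENNReal.ofReal_le_one.2 (hu1 ξ)

/-- The kernel obtained from the two endpoint weak-type bounds. -/
noncomputable def interpKernel (m : ℕ) (A γ a t : ℝ) : ℝ :=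
  4 / t ^ 2 * (if γ * t < a then a ^ 2 else 0) +
    A * 4 ^ m / t ^ (2 * m) * (if γ * t < a then 0 else a ^ (2 * m))

lemma lintegral_interpKernel_le {p : ℝ} {m : ℕ} (hp : 2 < p) (hpm : p < 2 * m) {A : ℝ} (hA : 0 < A)
    {a : ℝ} (ha : 0 ≤ a) :
    ∫⁻ t in Ioi (0:ℝ), ENNReal.ofReal
      (t ^ (p - 1) * interpKernel m A (A ^ (-(1 / (2 * m - 2 : ℝ)))) a t) ≤
    ENNReal.ofReal ((4 / (p - 2) + 4 ^ m / (2 * m - p)) * A ^ ((p - 2) / (2 * m - 2 : ℝ)) * a ^ p) := by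
  set γ := A ^ (-(1 / (2 * m - 2 : ℝ))) with hγ
  have hγ0 : 0 < γ := Real.rpow_pos_of_pos hA _
  rcases ha.eq_or_lt with rfl | ha
  · rw [setLIntegral_congr_fun (g := fun _ => 0) measurableSet_Ioi]
    · simp
    · intro t ht
      have ht' : ¬ γ * t < 0 := not_lt.2 (mul_pos hγ0 ht).le
      have hm : m ≠ 0 := by rintro rfl; norm_num at hpm; linarith
      simp [interpKernel, ht', hm]
  set s := a / γ with hs
  have hs0 : 0 < s := div_pos ha hγ0
  have hlt : ∀ t, γ * t < a ↔ t < s := fun t => by rw [hs, lt_div_iff₀ hγ0, mul_comm]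
  have h1 : ∫⁻ t in Ioo 0 s, ENNReal.ofReal (t ^ (p - 1) * interpKernel m A γ a t) =
      ENNReal.ofReal (4 * a ^ 2 * (s ^ (p - 2) / (p - 2))) := by
    have hInt : IntervalIntegrable (fun t : ℝ => t ^ (p - 3)) volume 0 s :=
      intervalIntegral.intervalIntegrable_rpow' (by linarith)
    have hInt' := ((intervalIntegrable_iff_integrableOn_Ioc_of_le hs0.le).1 hInt).const_mul (4 * a ^ 2)
    rw [setLIntegral_congr_fun (g := fun t => ENNReal.ofReal (4 * a ^ 2 * t ^ (p - 3))) measurableSet_Ioo,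
      restrict_Ioo_eq_restrict_Ioc, ← ofReal_integral_eq_lintegral_ofReal hInt',
      integral_const_mul, ← intervalIntegral.integral_of_le hs0.le, integral_rpow (Or.inl (by linarith)),
      Real.zero_rpow (by linarith), show p - 3 + 1 = p - 2 by ring, sub_zero]
    · exact (ae_restrict_mem measurableSet_Ioc).mono fun t ht => by have := ht.1; positivity
    · intro t ht
      have ht0 : 0 < t := ht.1
      simp only [interpKernel, hlt, if_pos ht.2, mul_zero, add_zero]
      congr 1
      rw [show p - 3 = p - 1 - (2:ℕ) by push_cast; ring, Real.rpow_sub_natCast ht0.ne']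
      ring
  have h2 : ∫⁻ t in Ici s, ENNReal.ofReal (t ^ (p - 1) * interpKernel m A γ a t) =
      ENNReal.ofReal (A * 4 ^ m * a ^ (2 * m) * (s ^ (p - 2 * m) / (2 * m - p))) := by
    have hInt := (integrableOn_Ioi_rpow_of_lt (a := p - 1 - 2 * m) (by linarith) hs0).const_mul
      (A * 4 ^ m * a ^ (2 * m))
    rw [setLIntegral_congr_fun (g := fun t => ENNReal.ofReal (A * 4 ^ m * a ^ (2 * m) *
        t ^ (p - 1 - 2 * m))) measurableSet_Ici, ← restrict_Ioi_eq_restrict_Ici,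
      ← ofReal_integral_eq_lintegral_ofReal hInt, integral_const_mul,
      integral_Ioi_rpow_of_lt (by linarith) hs0, show p - 1 - 2 * m + 1 = -(2 * m - p) by ring, neg_div_neg_eq]
    · rw [neg_sub]
    · exact (ae_restrict_mem measurableSet_Ioi).mono fun t ht => by
        have : 0 < t := hs0.trans ht
        positivity
    · intro t ht
      have ht0 : 0 < t := hs0.trans_le ht
      simp only [interpKernel, hlt, if_neg (not_lt.2 (mem_Ici.1 ht)), mul_zero, zero_add]
      congr 1
      rw [show p - 1 - 2 * m = p - 1 - ((2 * m : ℕ):ℝ) by push_cast; ring, Real.rpow_sub_natCast ht0.ne']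
      ring
  have hun : Ioi (0:ℝ) = Ioo 0 s ∪ Ici s := (Ioo_union_Ici_eq_Ioi hs0).symm
  have hd : Disjoint (Ioo 0 s) (Ici s) := disjoint_left.2 fun t h h' => h.2.not_ge h'
  rw [hun, lintegral_union measurableSet_Ici hd, h1, h2, ← ENNReal.ofReal_add]
  · refine le_of_eq (congrArg _ ?_)
    have hm2 : (2 * m - 2 : ℝ) ≠ 0 := by linarith
    have e1 : s ^ (p - 2) = a ^ (p - 2) * A ^ ((p - 2) / (2 * m - 2 : ℝ)) := by
      rw [hs, Real.div_rpow ha.le hγ0.le, hγ, ← Real.rpow_mul hA.le, div_eq_mul_inv,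
        ← Real.rpow_neg hA.le]
      congr 2; field_simp
    have e2 : A * s ^ (p - 2 * m) = a ^ (p - 2 * m) * A ^ ((p - 2) / (2 * m - 2 : ℝ)) := by
      rw [hs, Real.div_rpow ha.le hγ0.le, hγ, ← Real.rpow_mul hA.le, div_eq_mul_inv,
        ← Real.rpow_neg hA.le, mul_left_comm]
      congr 1
      nth_rewrite 1 [← Real.rpow_one A]
      rw [← Real.rpow_add hA]
      congr 1
      have hmm : 1 / (2 * m - 2 : ℝ) * (2 * m - 2) = 1 := one_div_mul_cancel hm2
      rw [eq_div_iff hm2]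
      linear_combination (p - 2 * m) * hmm
    have e3 : a ^ 2 * a ^ (p - 2) = a ^ p := by
      rw [← Real.rpow_natCast, ← Real.rpow_add ha]; congr 1; push_cast; ring
    have e4 : a ^ (2 * m) * a ^ (p - 2 * m) = a ^ p := by
      rw [← Real.rpow_natCast, ← Real.rpow_add ha]; congr 1; push_cast; ring
    calc _ = 4 / (p - 2) * (a ^ 2 * s ^ (p - 2)) +
          4 ^ m / (2 * m - p) * (a ^ (2 * m) * (A * s ^ (p - 2 * m))) := by ring
      _ = _ := by rw [e1, e2, ← mul_assoc (a ^ 2), ← mul_assoc (a ^ (2 * m)), e3, e4]; ring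
  · have : 0 < p - 2 := by linarith
    positivity
  · have : 0 < 2 * m - p := by linarith
    positivity

lemma volume_lt_mulOp_le {m : ℕ} (hm : m ≠ 0) {u : ℝ → ℂ} (hu : Nice u) (hu1 : ∀ ξ, ‖u ξ‖ ≤ 1)
    {A : ℝ} (hA : 0 < A)
    (H : ∀ f : ℝ → ℂ, Nice f → ∫⁻ x, (‖mulOp u f x‖ₑ ^ 2) ^ m ≤
      ENNReal.ofReal A * ∫⁻ x, (‖f x‖ₑ ^ 2) ^ m) {f : ℝ → ℂ} (hf : Nice f) (γ : ℝ) {t : ℝ} (ht : 0 < t) :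
    volume {x | t < ‖mulOp u f x‖} ≤ ∫⁻ x, ENNReal.ofReal (interpKernel m A γ ‖f x‖ t) := by
  have hmS : MeasurableSet {x | γ * t < ‖f x‖} := measurableSet_lt measurable_const hf.measurable.norm
  set f₀ : ℝ → ℂ := {x | γ * t < ‖f x‖}.indicator f with hf₀
  set f₁ : ℝ → ℂ := {x | γ * t < ‖f x‖}ᶜ.indicator f with hf₁
  have hind : ∀ S : Set ℝ, MeasurableSet S → Nice (S.indicator f) := fun S hS => by
    obtain ⟨B, hB⟩ := hf.bdd
    exact ⟨hf.measurable.indicator hS, hf.integrable.indicator hS, B,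
      fun x => (norm_indicator_le_norm_self _ _).trans (hB x)⟩
  have hn₀ : Nice f₀ := hind _ hmS
  have hn₁ : Nice f₁ := hind _ hmS.compl
  have hadd : ∀ x, mulOp u f x = mulOp u f₀ x + mulOp u f₁ x := fun x => by
    rw [← mulOp_add hu hn₀ hn₁]
    congr 1; ext y
    exact (congrFun (indicator_self_add_compl _ f) y).symm
  have hcheb : ∀ (g : ℝ → ℂ), Nice g → ∀ k : ℕ, volume {x | t / 2 ≤ ‖mulOp u g x‖} ≤
      ENNReal.ofReal (4 ^ k / t ^ (2 * k)) * ∫⁻ x, (‖mulOp u g x‖ₑ ^ 2) ^ k := fun g hg k => by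
    have h1 := mul_meas_ge_le_lintegral₀ (μ := volume)
      (((continuous_mulOp hu hg).measurable.enorm.pow_const 2).pow_const k).aemeasurable
      (ENNReal.ofReal (t ^ (2 * k) / 4 ^ k))
    calc volume {x | t / 2 ≤ ‖mulOp u g x‖}
        ≤ volume {x | ENNReal.ofReal (t ^ (2 * k) / 4 ^ k) ≤ (‖mulOp u g x‖ₑ ^ 2) ^ k} := by
          refine measure_mono fun x hx => ?_
          rw [mem_ofPred_eq] at hx ⊢
          rw [enorm_sq_eq, ← ENNReal.ofReal_pow (by positivity)]
          refine ENNReal.ofReal_le_ofReal ?_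
          rw [pow_mul, ← div_pow]
          refine pow_le_pow_left₀ (by positivity) ?_ k
          nlinarith
      _ = ENNReal.ofReal (4 ^ k / t ^ (2 * k)) * (ENNReal.ofReal (t ^ (2 * k) / 4 ^ k) *
          volume {x | ENNReal.ofReal (t ^ (2 * k) / 4 ^ k) ≤ (‖mulOp u g x‖ₑ ^ 2) ^ k}) := by
          rw [← mul_assoc, ← ENNReal.ofReal_mul (by positivity), div_mul_div_cancel₀ (by positivity),
            div_self (by positivity), ENNReal.ofReal_one, one_mul]
      _ ≤ _ := mul_le_mul_right h1 _
  have e₀ : ∀ x, ENNReal.ofReal (4 / t ^ 2) * ‖f₀ x‖ₑ ^ 2 = ENNReal.ofReal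
      (4 / t ^ 2 * (if γ * t < ‖f x‖ then ‖f x‖ ^ 2 else 0)) := fun x => by
    rw [enorm_sq_eq, ← ENNReal.ofReal_mul (by positivity)]
    by_cases hx : γ * t < ‖f x‖ <;> simp [hf₀, hx]
  have e₁ : ∀ x, ENNReal.ofReal (A * 4 ^ m / t ^ (2 * m)) * (‖f₁ x‖ₑ ^ 2) ^ m = ENNReal.ofReal
      (A * 4 ^ m / t ^ (2 * m) * (if γ * t < ‖f x‖ then 0 else ‖f x‖ ^ (2 * m))) := fun x => by
    rw [enorm_sq_eq, ← ENNReal.ofReal_pow (by positivity), ← ENNReal.ofReal_mul (by positivity),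
      ← pow_mul]
    by_cases hx : γ * t < ‖f x‖ <;> simp [hf₁, hx, hm]
  calc volume {x | t < ‖mulOp u f x‖}
      ≤ volume ({x | t / 2 ≤ ‖mulOp u f₀ x‖} ∪ {x | t / 2 ≤ ‖mulOp u f₁ x‖}) := by
        refine measure_mono fun x hx => ?_
        rw [mem_ofPred_eq, hadd] at hx
        have h2 := hx.trans_le (norm_add_le _ _)
        by_contra hc
        simp only [mem_union, mem_ofPred_eq, not_or, not_le] at hc
        linarith [hc.1, hc.2]
    _ ≤ ENNReal.ofReal (4 / t ^ 2) * (∫⁻ x, ‖f₀ x‖ₑ ^ 2) +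
        ENNReal.ofReal (A * 4 ^ m / t ^ (2 * m)) * ∫⁻ x, (‖f₁ x‖ₑ ^ 2) ^ m := by
        refine (measure_union_le _ _).trans (add_le_add ?_ ?_)
        · have := hcheb f₀ hn₀ 1
          simp only [pow_one, mul_one] at this
          exact this.trans (mul_le_mul_right (lintegral_enorm_mulOp_sq_le hu hu1 hn₀) _)
        · refine ((hcheb f₁ hn₁ m).trans (mul_le_mul_right (H f₁ hn₁) _)).trans (le_of_eq ?_)
          rw [← mul_assoc, ← ENNReal.ofReal_mul (by positivity)]
          congr 2; ring
    _ = _ := by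
        rw [← lintegral_const_mul' _ _ (by finiteness), ← lintegral_const_mul' _ _ (by finiteness),
          ← lintegral_add_left ((hn₀.measurable.enorm.pow_const 2).const_mul _)]
        refine lintegral_congr fun x => ?_
        rw [e₀, e₁, interpKernel, ENNReal.ofReal_add]
        · split_ifs <;> positivity
        · split_ifs <;> positivity

/-- Interpolation between the `L²` bound and an `L^{2m}` bound. -/
lemma lintegral_mulOp_rpow_le {p : ℝ} {m : ℕ} (hp : 2 < p) (hpm : p < 2 * m) {u : ℝ → ℂ} (hu : Nice u)
    (hu1 : ∀ ξ, ‖u ξ‖ ≤ 1) {A : ℝ} (hA : 0 < A)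
    (H : ∀ f : ℝ → ℂ, Nice f → ∫⁻ x, (‖mulOp u f x‖ₑ ^ 2) ^ m ≤
      ENNReal.ofReal A * ∫⁻ x, (‖f x‖ₑ ^ 2) ^ m) {f : ℝ → ℂ} (hf : Nice f) :
    ∫⁻ x, ‖mulOp u f x‖ₑ ^ p ≤ ENNReal.ofReal (p * ((4 / (p - 2) + 4 ^ m / (2 * m - p)) *
      A ^ ((p - 2) / (2 * m - 2 : ℝ)))) * ∫⁻ x, ‖f x‖ₑ ^ p := by
  have hm : m ≠ 0 := by rintro rfl; norm_num at hpm; linarith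
  have hp0 : 0 < p := by linarith
  have hT := continuous_mulOp hu hf
  set γ := A ^ (-(1 / (2 * m - 2 : ℝ))) with hγ
  have hofReal : ∀ z : ℂ, ‖z‖ₑ ^ p = ENNReal.ofReal (‖z‖ ^ p) := fun z => by
    rw [← ofReal_norm, ENNReal.ofReal_rpow_of_nonneg (norm_nonneg _) hp0.le]
  have hpm' : 0 < 2 * m - p := by linarith
  have hp2 : 0 < p - 2 := by linarith
  set K := (4 / (p - 2) + 4 ^ m / (2 * m - p)) * A ^ ((p - 2) / (2 * m - 2 : ℝ)) with hK
  have hK0 : 0 ≤ K := by positivity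
  have hmeas : Measurable fun z : ℝ × ℝ =>
      ENNReal.ofReal (z.1 ^ (p - 1) * interpKernel m A γ ‖f z.2‖ z.1) := by
    have hS : MeasurableSet {z : ℝ × ℝ | γ * z.1 < ‖f z.2‖} :=
      measurableSet_lt (by fun_prop) (hf.measurable.norm.comp measurable_snd)
    have hfm : Measurable fun z : ℝ × ℝ => ‖f z.2‖ := hf.measurable.norm.comp measurable_snd
    unfold interpKernel
    refine ENNReal.measurable_ofReal.comp ((measurable_fst.pow_const _).mul (Measurable.add ?_ ?_))
    · exact (measurable_const.div (measurable_fst.pow_const _)).mul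
        (Measurable.ite hS (hfm.pow_const _) measurable_const)
    · exact (measurable_const.div (measurable_fst.pow_const _)).mul
        (Measurable.ite hS measurable_const (hfm.pow_const _))
  calc ∫⁻ x, ‖mulOp u f x‖ₑ ^ p
      = ENNReal.ofReal p * ∫⁻ t in Ioi (0:ℝ), volume {x | t < ‖mulOp u f x‖} *
          ENNReal.ofReal (t ^ (p - 1)) := by
        rw [← lintegral_rpow_eq_lintegral_meas_lt_mul _ (.of_forall fun x => norm_nonneg _)
          hT.measurable.norm.aemeasurable hp0]
        exact lintegral_congr fun x => hofReal _
    _ ≤ ENNReal.ofReal p * ∫⁻ t in Ioi (0:ℝ), ∫⁻ x, ENNReal.ofReal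
          (t ^ (p - 1) * interpKernel m A γ ‖f x‖ t) := by
        refine mul_le_mul_right (setLIntegral_mono' measurableSet_Ioi fun t ht => ?_) _
        have ht0 : 0 < t := ht
        refine (mul_le_mul_left (volume_lt_mulOp_le hm hu hu1 hA H hf γ ht0) _).trans (le_of_eq ?_)
        rw [mul_comm, ← lintegral_const_mul' _ _ (by finiteness)]
        exact lintegral_congr fun x => (ENNReal.ofReal_mul (by positivity)).symm
    _ = ENNReal.ofReal p * ∫⁻ x, ∫⁻ t in Ioi (0:ℝ), ENNReal.ofReal
          (t ^ (p - 1) * interpKernel m A γ ‖f x‖ t) := by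
        rw [lintegral_lintegral_swap hmeas.aemeasurable]
    _ ≤ ENNReal.ofReal p * ∫⁻ x, ENNReal.ofReal K * ‖f x‖ₑ ^ p := by
        refine mul_le_mul_right (lintegral_mono fun x => ?_) _
        dsimp only
        rw [hofReal, ← ENNReal.ofReal_mul hK0]
        exact lintegral_interpKernel_le hp hpm hA (norm_nonneg _)
    _ = _ := by
        rw [lintegral_const_mul' _ _ (by finiteness), ← mul_assoc, ← ENNReal.ofReal_mul hp0.le]

end Interpolation

section Variation
open Set FourierTransform ComplexConjugate Filter Topology

/-- A function of bounded `q`-variation is controlled by a monotone function. -/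
lemma exists_variation_function {m : ℝ → ℂ} {lo hi q M : ℝ}
    (hM : 0 ≤ M) (hvar : ∀ (K : ℕ) (ξ : ℕ → ℝ), ξ 0 = lo → ξ (K + 1) = hi →
      (∀ i ≤ K, ξ i < ξ (i + 1)) → ∑ i ∈ Finset.range (K + 1), ‖m (ξ (i + 1)) - m (ξ i)‖ ^ q ≤ M) :
    ∃ V : ℝ → ℝ, (∀ t ∈ Ico lo hi, V t ∈ Icc 0 M) ∧
      ∀ s t, lo ≤ s → s < t → t < hi → ‖m t - m s‖ ^ q ≤ V t - V s := by
  set S : ℝ → Set ℝ := fun t => {r | ∃ (K : ℕ) (ξ : ℕ → ℝ), ξ 0 = lo ∧ ξ (K + 1) = t ∧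
    (∀ i ≤ K, ξ i < ξ (i + 1)) ∧ r = ∑ i ∈ Finset.range (K + 1), ‖m (ξ (i + 1)) - m (ξ i)‖ ^ q} with hS
  have hext : ∀ s t, s < t → ∀ r ∈ S s, r + ‖m t - m s‖ ^ q ∈ S t := by
    rintro s t hst r ⟨K, ξ, h0, hK, hlt, rfl⟩
    refine ⟨K + 1, fun i => if i ≤ K + 1 then ξ i else t, by simpa using h0, by simp, ?_, ?_⟩
    · intro i hi
      rcases Nat.lt_or_ge i (K + 1) with h | h
      · simp only [if_pos hi, if_pos (show i + 1 ≤ K + 1 by omega)]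
        exact hlt i (by omega)
      · obtain rfl : i = K + 1 := by omega
        simpa [hK] using hst
    · rw [Finset.sum_range_succ _ (K + 1)]
      congr 1
      · refine Finset.sum_congr rfl fun i hi => ?_
        have := Finset.mem_range.1 hi
        simp only [if_pos (show i ≤ K + 1 by omega), if_pos (show i + 1 ≤ K + 1 by omega)]
      · simp [hK]
  have hle : ∀ t < hi, ∀ r ∈ S t, r ≤ M := by
    intro t ht r hr
    obtain ⟨K, ξ, h0, hK, hlt, he⟩ := hext t hi ht r hr
    have h1 := hvar K ξ h0 hK hlt
    have h2 : 0 ≤ ‖m hi - m t‖ ^ q := by positivity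
    linarith
  have hnn : ∀ t, ∀ r ∈ S t, 0 ≤ r := by
    rintro t r ⟨K, ξ, -, -, -, rfl⟩
    exact Finset.sum_nonneg fun i _ => by positivity
  have hbdd : ∀ t < hi, BddAbove (S t) := fun t ht => ⟨M, fun r hr => hle t ht r hr⟩
  refine ⟨fun t => sSup (S t), fun t ht => ⟨Real.sSup_nonneg (hnn t), Real.sSup_le (hle t ht.2) hM⟩,
    fun s t hs hst ht => ?_⟩
  dsimp only
  rw [le_sub_iff_add_le, add_comm]
  rcases hs.eq_or_lt with rfl | hs
  · have hempty : S lo = ∅ := by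
      refine eq_empty_of_forall_notMem ?_
      rintro r ⟨K, ξ, h0, hK, hlt, -⟩
      have : ∀ i ≤ K, lo < ξ (i + 1) := by
        intro i
        induction i with
        | zero => intro h; simpa [h0] using hlt 0 h
        | succ i ih => intro h; exact (ih (by omega)).trans (hlt (i + 1) h)
      exact absurd hK (this K le_rfl).ne'
    rw [hempty, Real.sSup_empty, zero_add]
    refine le_csSup (hbdd t ht) ⟨0, fun i => if i = 0 then lo else t, by simp, by simp, ?_, by simp⟩
    intro i hi
    obtain rfl : i = 0 := by omega
    simpa using hst
  · have hne : (S s).Nonempty := by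
      refine ⟨_, 0, fun i => if i = 0 then lo else s, by simp, by simp, ?_, rfl⟩
      intro i hi
      obtain rfl : i = 0 := by omega
      simpa using hs
    rw [← le_sub_iff_add_le]
    refine csSup_le hne fun r hr => ?_
    rw [le_sub_iff_add_le]
    exact le_csSup (hbdd t ht) (hext s t hst r hr)

/-- Normalised form: level sets of a monotone function control the oscillation of `m`. -/
lemma exists_oscillation_function {m : ℝ → ℂ} {lo hi q B : ℝ} (hq : 0 < q)
    (hB : 0 < B) (hvar : ∀ (K : ℕ) (ξ : ℕ → ℝ), ξ 0 = lo → ξ (K + 1) = hi →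
      (∀ i ≤ K, ξ i < ξ (i + 1)) →
      ∑ i ∈ Finset.range (K + 1), ‖m (ξ (i + 1)) - m (ξ i)‖ ^ q ≤ B ^ q) :
    ∃ W : ℝ → ℝ, (∀ t ∈ Ico lo hi, W t ∈ Icc 0 1) ∧ MonotoneOn W (Ico lo hi) ∧
      ∀ (j : ℕ), ∀ s ∈ Ico lo hi, ∀ t ∈ Ico lo hi, ⌊2 ^ j * W s⌋₊ = ⌊2 ^ j * W t⌋₊ →
        ‖m t - m s‖ ≤ B * ((2:ℝ) ^ (-(1 / q))) ^ j := by
  have hBq : 0 < B ^ q := by positivity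
  obtain ⟨V, hV, hmV⟩ := exists_variation_function hBq.le hvar
  have hmono : MonotoneOn (fun t => V t / B ^ q) (Ico lo hi) := by
    intro s hs t ht hst
    rcases hst.eq_or_lt with rfl | hlt
    · exact le_rfl
    · have h1 := hmV s t hs.1 hlt ht.2
      have h2 : 0 ≤ ‖m t - m s‖ ^ q := by positivity
      exact div_le_div_of_nonneg_right (by linarith) hBq.le
  have key : ∀ (j : ℕ), ∀ s ∈ Ico lo hi, ∀ t ∈ Ico lo hi, s < t →
      ⌊2 ^ j * (V s / B ^ q)⌋₊ = ⌊2 ^ j * (V t / B ^ q)⌋₊ →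
      ‖m t - m s‖ ≤ B * ((2:ℝ) ^ (-(1 / q))) ^ j := by
    intro j s hs t ht hst he
    have h1 := hmV s t hs.1 hst ht.2
    have h2 : 2 ^ j * (V t / B ^ q) < 2 ^ j * (V s / B ^ q) + 1 := by
      have h3 := Nat.lt_floor_add_one (2 ^ j * (V t / B ^ q))
      have h4 := Nat.floor_le (show 0 ≤ 2 ^ j * (V s / B ^ q) by
        have := (hV s hs).1; positivity)
      rw [← he] at h3
      linarith
    have h5 : V t - V s ≤ B ^ q * (2 ^ j)⁻¹ := by
      have h6 : 2 ^ j * ((V t - V s) / B ^ q) < 1 := by rw [sub_div, mul_sub]; linarith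
      rw [mul_div_assoc', div_lt_one hBq] at h6
      rw [← div_eq_mul_inv, le_div_iff₀ (by positivity)]
      linarith
    have h7 : ‖m t - m s‖ ^ q ≤ (B * ((2:ℝ) ^ (-(1 / q))) ^ j) ^ q := by
      rw [Real.mul_rpow hB.le (by positivity), ← Real.rpow_natCast, ← Real.rpow_mul (by positivity),
        ← Real.rpow_mul (by positivity)]
      refine (h1.trans h5).trans (le_of_eq ?_)
      rw [show -(1 / q) * (j * q) = -(j:ℝ) by field_simp, Real.rpow_neg (by norm_num), Real.rpow_natCast]
    exact (Real.rpow_le_rpow_iff (norm_nonneg _) (by positivity) hq).1 h7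
  refine ⟨fun t => V t / B ^ q, fun t ht => ⟨div_nonneg (hV t ht).1 hBq.le,
    (div_le_one hBq).2 (hV t ht).2⟩, hmono, fun j s hs t ht he => ?_⟩
  rcases lt_trichotomy s t with h | rfl | h
  · exact key j s hs t ht h he
  · simp only [sub_self, norm_zero]; positivity
  · rw [norm_sub_rev]; exact key j t ht s hs h he.symm

end Variation

section StepMultiplier
open Set FourierTransform ComplexConjugate Filter Topology

lemma nice_indicator_const {E : Set ℝ} (hE : MeasurableSet E) {R : ℝ} (hR : ∀ ξ ∈ E, |ξ| ≤ R) (z : ℂ) :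
    Nice (E.indicator fun _ => z) := by
  refine ⟨measurable_const.indicator hE, ?_, ‖z‖, fun x => norm_indicator_le_norm_self _ _⟩
  rw [integrable_indicator_iff hE]
  refine integrableOn_const (ne_top_of_le_ne_top ?_ (measure_mono
    (show E ⊆ Icc (-R) R from fun ξ hξ => abs_le.1 (hR ξ hξ))))
  exact measure_Icc_lt_top.ne

lemma Set.OrdConnected.mem_iff_mem_Ioo {E : Set ℝ} (hE : E.OrdConnected) {R : ℝ} (hR : ∀ ξ ∈ E, |ξ| ≤ R)
    {ξ : ℝ} (h1 : ξ ≠ sInf E) (h2 : ξ ≠ sSup E) : ξ ∈ E ↔ ξ ∈ Ioo (sInf E) (sSup E) := by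
  have hb : BddBelow E := ⟨-R, fun ξ hξ => (abs_le.1 (hR ξ hξ)).1⟩
  have ha : BddAbove E := ⟨R, fun ξ hξ => (abs_le.1 (hR ξ hξ)).2⟩
  rcases E.eq_empty_or_nonempty with rfl | hne
  · simp
  · constructor
    · intro h
      have := subset_Icc_csInf_csSup hb ha h
      exact ⟨lt_of_le_of_ne this.1 h1.symm, lt_of_le_of_ne this.2 h2⟩
    · exact fun h => IsConnected.Ioo_csInf_csSup_subset ⟨hne, hE.isPreconnected⟩ hb ha h

/-- `L^p` bound for multipliers that are constant on at most `N` intervals in each dyadic shell. -/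
lemma lintegral_step_multiplier_rpow_le {p : ℝ} {m : ℕ} (hp : 2 < p) (hm : 2 ≤ m) (hpm : p < 2 * m) :
    ∃ C : ℝ, 0 < C ∧ ∀ (ι : Type) [Fintype ι] (E : ι → Set ℝ), (∀ P, (E P).OrdConnected) →
    (∀ ξ P P', ξ ∈ E P → ξ ∈ E P' → P = P') → ∀ c : ℝ, 0 < c → ∀ (k : ι → ℕ) (N : ℕ), 1 ≤ N →
    (∀ P, ∀ ξ ∈ E P, c * 2 ^ k P ≤ |ξ| ∧ |ξ| ≤ 2 * (c * 2 ^ k P)) →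
    (∀ i, (Finset.univ.filter fun P => k P = i).card ≤ N) →
    ∀ z : ι → ℂ, (∀ P, ‖z P‖ ≤ 1) → ∀ f : ℝ → ℂ, Nice f →
    ∫⁻ x, ‖mulOp (fun ξ => ∑ P, (E P).indicator (fun _ => z P) ξ) f x‖ₑ ^ p ≤
      ENNReal.ofReal (C * (N:ℝ) ^ (m * ((p - 2) / (2 * m - 2 : ℝ)))) * ∫⁻ x, ‖f x‖ₑ ^ p := by
  obtain ⟨C₀, hC₀, hstep⟩ := lintegral_step_multiplier_pow_le hm
  set γ : ℝ := (p - 2) / (2 * m - 2 : ℝ) with hγ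
  set A₀ : ℝ := C₀.toReal + 1 with hA₀
  have hA₀pos : 0 < A₀ := by positivity
  have hC₀A : C₀ ≤ ENNReal.ofReal A₀ := by
    rw [← ENNReal.ofReal_toReal hC₀]
    exact ENNReal.ofReal_le_ofReal (by simp [hA₀])
  have hK : 0 < p * (4 / (p - 2) + 4 ^ m / (2 * m - p)) := by
    have h1 : 0 < p - 2 := by linarith
    have h2 : 0 < 2 * (m:ℝ) - p := by linarith
    positivity
  refine ⟨p * (4 / (p - 2) + 4 ^ m / (2 * m - p)) * A₀ ^ γ, by positivity, ?_⟩
  intro ι _ E hE hdisj c hc k N hN hshell hcard z hz f hf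
  classical
  have hR : ∀ P, ∀ ξ ∈ E P, |ξ| ≤ 2 * (c * 2 ^ k P) := fun P ξ hξ => (hshell P ξ hξ).2
  have hw : Nice fun ξ => ∑ P, (E P).indicator (fun _ => z P) ξ :=
    Nice.sum fun P _ => nice_indicator_const (hE P).measurableSet (hR P) (z P)
  have hw1 : ∀ ξ, ‖∑ P, (E P).indicator (fun _ => z P) ξ‖ ≤ 1 := by
    intro ξ
    by_cases h : ∃ P, ξ ∈ E P
    · obtain ⟨P, hP⟩ := h
      rw [Finset.sum_eq_single P, indicator_of_mem hP]
      · exact hz P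
      · exact fun P' _ hne => indicator_of_notMem (fun h' => hne (hdisj ξ _ _ h' hP)) _
      · simp
    · push Not at h
      rw [Finset.sum_eq_zero fun P _ => indicator_of_notMem (h P) _]
      simp
  have hsub : ∀ P, Ioo (sInf (E P)) (sSup (E P)) ⊆ E P := by
    intro P ξ hξ
    exact ((hE P).mem_iff_mem_Ioo (hR P) hξ.1.ne' hξ.2.ne).2 hξ
  have hNpos : (0:ℝ) < N := by exact_mod_cast hN
  have H : ∀ f : ℝ → ℂ, Nice f → ∫⁻ x, (‖mulOp (fun ξ => ∑ P, (E P).indicator (fun _ => z P) ξ) f x‖ₑ ^ 2) ^ m ≤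
      ENNReal.ofReal (A₀ * N ^ m) * ∫⁻ x, (‖f x‖ₑ ^ 2) ^ m := by
    intro f hf
    have h1 := hstep {P : ι // sInf (E P) < sSup (E P)} (fun J => sInf (E J)) (fun J => sSup (E J))
      (fun J => J.2) (fun ξ J J' h h' => Subtype.ext (hdisj ξ _ _ (hsub _ h) (hsub _ h'))) c hc
      (fun J => k J) N (fun J ξ hξ => hshell J ξ (hsub _ hξ))
      (fun i => (Finset.card_le_card_of_injOn Subtype.val (by intro J hJ; simpa using hJ)
        Subtype.val_injective.injOn).trans (hcard i)) (fun J => z J) (fun J => hz J) f hf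
    have hae : (fun ξ => (∑ P, (E P).indicator (fun _ => z P) ξ) * 𝓕 f ξ) =ᵐ[volume] fun ξ =>
        ∑ J : {P : ι // sInf (E P) < sSup (E P)}, z J * (Ioo (sInf (E J)) (sSup (E J))).indicator (𝓕 f) ξ := by
      have hfin : ((⋃ P, {sInf (E P), sSup (E P)} : Set ℝ)).Finite :=
        finite_iUnion fun P => by simp
      filter_upwards [hfin.countable.ae_notMem volume] with ξ hξ
      simp only [mem_iUnion, mem_insert_iff, mem_singleton_iff, not_exists, not_or] at hξ
      have hterm : ∀ P, (E P).indicator (fun _ => z P) ξ * 𝓕 f ξ =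
          z P * (Ioo (sInf (E P)) (sSup (E P))).indicator (𝓕 f) ξ := by
        intro P
        have := (hE P).mem_iff_mem_Ioo (hR P) (hξ P).1 (hξ P).2
        by_cases h : ξ ∈ E P
        · rw [indicator_of_mem h, indicator_of_mem (this.1 h)]
        · rw [indicator_of_notMem h, indicator_of_notMem (fun h' => h (this.2 h')), zero_mul, mul_zero]
      rw [Finset.sum_mul, Finset.sum_congr rfl fun P _ => hterm P,
        ← Finset.sum_subtype (Finset.univ.filter fun P => sInf (E P) < sSup (E P)) (by simp)
          (fun P => z P * (Ioo (sInf (E P)) (sSup (E P))).indicator (𝓕 f) ξ)]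
      refine (Finset.sum_filter_of_ne fun P _ hne => ?_).symm
      by_contra hlt
      exact hne (by rw [Ioo_eq_empty hlt]; simp)
    have h2 : ∀ x, mulOp (fun ξ => ∑ P, (E P).indicator (fun _ => z P) ξ) f x =
        𝓕⁻ (fun ξ => ∑ J : {P : ι // sInf (E P) < sSup (E P)},
          z J * (Ioo (sInf (E J)) (sSup (E J))).indicator (𝓕 f) ξ) x := by
      intro x
      simp only [mulOp, fourierInv_eq_ex]
      refine integral_congr_ae ?_
      filter_upwards [hae] with ξ hξ
      rw [hξ]
    simp only [h2]
    refine h1.trans (mul_le_mul_left ?_ _)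
    rw [ENNReal.ofReal_mul hA₀pos.le, ENNReal.ofReal_pow hNpos.le, ENNReal.ofReal_natCast]
    exact mul_le_mul_left hC₀A _
  have h3 := lintegral_mulOp_rpow_le hp hpm hw hw1 (A := A₀ * N ^ m) (by positivity) H hf
  refine h3.trans (le_of_eq ?_)
  congr 2
  rw [← hγ, Real.mul_rpow hA₀pos.le (by positivity), ← Real.rpow_natCast (N:ℝ) m, ← Real.rpow_mul hNpos.le]
  ring

end StepMultiplier

section ShellMultiplier
open Set FourierTransform ComplexConjugate Filter Topology

lemma mulOp_const_mul (c : ℂ) (u f : ℝ → ℂ) (x : ℝ) :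
    mulOp (fun ξ => c * u ξ) f x = c * mulOp u f x := by
  simp only [mulOp, mul_assoc, fourierInv_const_mul]

lemma eLpNorm_mulOp_const_mul (c : ℂ) (u f : ℝ → ℂ) (p : ℝ≥0∞) :
    eLpNorm (mulOp (fun ξ => c * u ξ) f) p volume = ‖c‖ₑ * eLpNorm (mulOp u f) p volume := by
  rw [funext (mulOp_const_mul c u f), ← eLpNorm_const_smul]
  rfl

lemma eLpNorm_le_of_lintegral_rpow_le {p : ℝ} (hp : 0 < p) {g f : ℝ → ℂ} {K : ℝ} (hK : 0 ≤ K)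
    (h : ∫⁻ x, ‖g x‖ₑ ^ p ≤ ENNReal.ofReal K * ∫⁻ x, ‖f x‖ₑ ^ p) :
    eLpNorm g (ENNReal.ofReal p) volume ≤
      ENNReal.ofReal (K ^ (1 / p)) * eLpNorm f (ENNReal.ofReal p) volume := by
  have h0 : ENNReal.ofReal p ≠ 0 := by simpa using hp
  rw [eLpNorm_eq_lintegral_rpow_enorm_toReal h0 ENNReal.ofReal_ne_top,
    eLpNorm_eq_lintegral_rpow_enorm_toReal h0 ENNReal.ofReal_ne_top, ENNReal.toReal_ofReal hp.le,
    ← ENNReal.ofReal_rpow_of_nonneg hK (by positivity),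
    ← ENNReal.mul_rpow_of_nonneg _ _ (show 0 ≤ 1 / p by positivity)]
  exact ENNReal.rpow_le_rpow h (by positivity)

lemma eLpNorm_le_of_tendsto {F : ℕ → ℝ → ℂ} {G : ℝ → ℂ} {p K : ℝ≥0∞} (hF : ∀ n, Measurable (F n))
    (hFG : ∀ x, Tendsto (fun n => F n x) atTop (𝓝 (G x))) (hK : ∀ n, eLpNorm (F n) p volume ≤ K) :
    eLpNorm G p volume ≤ K := by
  refine (Lp.eLpNorm_lim_le_liminf_eLpNorm (fun n => (hF n).aestronglyMeasurable) G
    (.of_forall hFG)).trans ?_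
  refine (liminf_le_liminf (.of_forall hK)).trans ?_
  simp

/-- `L^p` bound for step multipliers, with a growth exponent smaller than `1 / q`. -/
lemma eLpNorm_step_multiplier_le {p q : ℝ} (hp : 2 < p) (hpq : 1 / 2 - 1 / p < 1 / q) :
    ∃ θ C : ℝ, 0 ≤ θ ∧ θ < 1 / q ∧ 0 < C ∧ ∀ (ι : Type) [Fintype ι] (E : ι → Set ℝ),
    (∀ P, (E P).OrdConnected) → (∀ ξ P P', ξ ∈ E P → ξ ∈ E P' → P = P') →
    ∀ c : ℝ, 0 < c → ∀ (k : ι → ℕ) (N : ℕ), 1 ≤ N →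
    (∀ P, ∀ ξ ∈ E P, c * 2 ^ k P ≤ |ξ| ∧ |ξ| ≤ 2 * (c * 2 ^ k P)) →
    (∀ i, (Finset.univ.filter fun P => k P = i).card ≤ N) →
    ∀ D : ℝ, 0 < D → ∀ z : ι → ℂ, (∀ P, ‖z P‖ ≤ D) → ∀ f : ℝ → ℂ, Nice f →
    eLpNorm (mulOp (fun ξ => ∑ P, (E P).indicator (fun _ => z P) ξ) f) (ENNReal.ofReal p) volume ≤
      ENNReal.ofReal (C * D * (N:ℝ) ^ θ) * eLpNorm f (ENNReal.ofReal p) volume := by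
  set a : ℝ := 1 / 2 - 1 / p with ha
  have hp0 : 0 < p := by linarith
  have ha0 : 0 < a := by
    rw [ha, sub_pos]
    exact one_div_lt_one_div_of_lt (by norm_num) hp
  obtain ⟨m, hmlt⟩ := exists_nat_gt (max (1 / q / (1 / q - a)) p)
  have hm1 : 1 / q < m * (1 / q - a) := (div_lt_iff₀ (by linarith)).1 ((le_max_left _ _).trans_lt hmlt)
  have hmp : p < m := (le_max_right _ _).trans_lt hmlt
  have hm2' : (2:ℝ) < m := by linarith
  have hm2 : 2 ≤ m := by exact_mod_cast hm2'.le
  obtain ⟨C, hC, hstep⟩ := lintegral_step_multiplier_rpow_le hp hm2 (by linarith)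
  set e : ℝ := m * ((p - 2) / (2 * m - 2 : ℝ)) with he
  have hmpos : 0 < (m:ℝ) - 1 := by linarith
  have heq : e * (1 / p) = m * a / (m - 1) := by
    rw [he, ha]
    have : (2 * (m:ℝ) - 2) ≠ 0 := by linarith
    field_simp
  refine ⟨e * (1 / p), C ^ (1 / p), ?_, ?_, by positivity, ?_⟩
  · rw [heq]; positivity
  · rw [heq, div_lt_iff₀ hmpos]; linarith
  intro ι _ E hE hdisj c hc k N hN hshell hcard D hD z hz f hf
  have h1 := hstep ι E hE hdisj c hc k N hN hshell hcard (fun P => (D:ℂ)⁻¹ * z P)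
    (fun P => by
      rw [norm_mul, norm_inv, Complex.norm_real, Real.norm_of_nonneg hD.le, inv_mul_le_iff₀ hD, mul_one]
      exact hz P) f hf
  have hsc : (fun ξ => ∑ P, (E P).indicator (fun _ => z P) ξ) =
      fun ξ => (D:ℂ) * ∑ P, (E P).indicator (fun _ => (D:ℂ)⁻¹ * z P) ξ := by
    have hD' : (D:ℂ) ≠ 0 := by exact_mod_cast hD.ne'
    funext ξ
    rw [Finset.mul_sum]
    refine Finset.sum_congr rfl fun P _ => ?_
    by_cases h : ξ ∈ E P
    · simp only [indicator_of_mem h]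
      rw [mul_inv_cancel_left₀ hD']
    · simp only [indicator_of_notMem h, mul_zero]
  have hN0 : (0:ℝ) ≤ N := by positivity
  rw [hsc, eLpNorm_mulOp_const_mul]
  refine (mul_le_mul_right (eLpNorm_le_of_lintegral_rpow_le hp0 (by positivity) h1) _).trans
    (le_of_eq ?_)
  rw [← mul_assoc, ← ofReal_norm, Complex.norm_real, Real.norm_of_nonneg hD.le,
    ← ENNReal.ofReal_mul hD.le, Real.mul_rpow hC.le (by positivity), ← Real.rpow_mul hN0]
  congr 2
  ring

section Levels
variable {κ : Type} {lo hi : κ → ℝ} {F : κ → ℝ → ℕ} {n : ℕ}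

/-- The level sets of a family of integer valued functions on intervals. -/
def levelSet (lo hi : κ → ℝ) (F : κ → ℝ → ℕ) (n : ℕ) (P : κ × Fin n) : Set ℝ :=
  {ξ | ξ ∈ Ico (lo P.1) (hi P.1) ∧ F P.1 ξ = P.2}

lemma levelSet_disjoint (hdisj : ∀ ξ a a', ξ ∈ Ico (lo a) (hi a) → ξ ∈ Ico (lo a') (hi a') → a = a')
    (ξ : ℝ) (P P' : κ × Fin n) (h : ξ ∈ levelSet lo hi F n P) (h' : ξ ∈ levelSet lo hi F n P') :
    P = P' := by
  obtain ⟨a, i⟩ := P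
  obtain ⟨a', i'⟩ := P'
  obtain rfl := hdisj ξ a a' h.1 h'.1
  have : (i:ℕ) = i' := h.2.symm.trans h'.2
  rw [Fin.ext this]

lemma levelSet_ordConnected (hF : ∀ a, MonotoneOn (F a) (Ico (lo a) (hi a))) (P : κ × Fin n) :
    (levelSet lo hi F n P).OrdConnected := by
  refine ⟨fun s hs t ht x hx => ?_⟩
  have hxI : x ∈ Ico (lo P.1) (hi P.1) := ⟨hs.1.1.trans hx.1, hx.2.trans_lt ht.1.2⟩
  refine ⟨hxI, le_antisymm ?_ ?_⟩
  · exact (hF _ hxI ht.1 hx.2).trans ht.2.le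
  · exact hs.2.ge.trans (hF _ hs.1 hxI hx.1)

lemma sum_levelSet_indicator_of_mem [Fintype κ]
    (hdisj : ∀ ξ a a', ξ ∈ Ico (lo a) (hi a) → ξ ∈ Ico (lo a') (hi a') → a = a')
    (g : κ → ℕ → ℂ) {ξ : ℝ} {a : κ} (hξ : ξ ∈ Ico (lo a) (hi a)) (hn : F a ξ < n) :
    ∑ P : κ × Fin n, (levelSet lo hi F n P).indicator (fun _ => g P.1 P.2) ξ = g a (F a ξ) := by
  have hmem : ξ ∈ levelSet lo hi F n (a, ⟨F a ξ, hn⟩) := ⟨hξ, rfl⟩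
  rw [Finset.sum_eq_single (a, ⟨F a ξ, hn⟩), indicator_of_mem hmem]
  · exact fun P' _ hne => indicator_of_notMem (fun h' => hne (levelSet_disjoint hdisj ξ _ _ h' hmem)) _
  · simp

lemma sum_levelSet_indicator_of_notMem [Fintype κ] (g : κ × Fin n → ℂ) {ξ : ℝ}
    (hξ : ∀ a, ξ ∉ Ico (lo a) (hi a)) :
    ∑ P : κ × Fin n, (levelSet lo hi F n P).indicator (fun _ => g P) ξ = 0 :=
  Finset.sum_eq_zero fun P _ => indicator_of_notMem (fun h => hξ P.1 h.1) _

lemma card_level_fiber_le [Fintype κ] {k : κ → ℕ} {M : ℕ} (hk : ∀ i, (Finset.univ.filter fun a => k a = i).card ≤ M)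
    (i : ℕ) : (Finset.univ.filter fun P : κ × Fin n => k P.1 = i).card ≤ M * n := by
  have : (Finset.univ.filter fun P : κ × Fin n => k P.1 = i) =
      (Finset.univ.filter fun a => k a = i) ×ˢ Finset.univ := by
    ext P; simp
  rw [this, Finset.card_product, Finset.card_univ, Fintype.card_fin]
  exact Nat.mul_le_mul_right _ (hk i)

end Levels
end ShellMultiplier

section ShellMultiplier
open Set FourierTransform ComplexConjugate Filter Topology

/-- Representatives of `m` on the level sets of an oscillation function. -/
lemma exists_level_values {m : ℝ → ℂ} {I : Set ℝ} {F : ℝ → ℕ} {B D : ℝ} (hB : ∀ ξ, ‖m ξ‖ ≤ B)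
    (h : ∀ s ∈ I, ∀ t ∈ I, F s = F t → ‖m t - m s‖ ≤ D) :
    ∃ z : ℕ → ℂ, (∀ i, ‖z i‖ ≤ B) ∧ ∀ ξ ∈ I, ‖m ξ - z (F ξ)‖ ≤ D := by
  classical
  have hex : ∀ i, ∃ z : ℂ, ‖z‖ ≤ B ∧ ∀ ξ ∈ I, F ξ = i → ‖m ξ - z‖ ≤ D := by
    intro i
    by_cases hi : ∃ s ∈ I, F s = i
    · obtain ⟨s, hs, rfl⟩ := hi
      exact ⟨m s, hB s, fun ξ hξ he => h s hs ξ hξ he.symm⟩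
    · exact ⟨m 0, hB 0, fun ξ hξ he => absurd ⟨ξ, hξ, he⟩ hi⟩
  choose z hz hz' using hex
  exact ⟨z, hz, fun ξ hξ => hz' _ ξ hξ rfl⟩

lemma mulOp_add_symbol {u v f : ℝ → ℂ} (hu : Nice u) (hv : Nice v) (hf : Nice f) (x : ℝ) :
    mulOp (fun ξ => u ξ + v ξ) f x = mulOp u f x + mulOp v f x := by
  simp only [mulOp, fourierInv_eq_ex, add_mul, mul_add]
  exact integral_add (integrable_ex_mul (hu.symbol hf).integrable (by fun_prop))
    (integrable_ex_mul (hv.symbol hf).integrable (by fun_prop))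

/-- Multipliers of bounded `q`-variation supported on finitely many dyadic shells. -/
lemma eLpNorm_shell_multiplier_le {p q : ℝ} (hp : 2 < p) (hq : 0 < q) (hpq : 1 / 2 - 1 / p < 1 / q) :
    ∃ C : ℝ, 0 < C ∧ ∀ (κ : Type) [Fintype κ] (lo hi : κ → ℝ),
    (∀ ξ a a', ξ ∈ Ico (lo a) (hi a) → ξ ∈ Ico (lo a') (hi a') → a = a') →
    ∀ c : ℝ, 0 < c → ∀ k : κ → ℕ,
    (∀ a, ∀ ξ ∈ Ico (lo a) (hi a), c * 2 ^ k a ≤ |ξ| ∧ |ξ| ≤ 2 * (c * 2 ^ k a)) →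
    (∀ i, (Finset.univ.filter fun a => k a = i).card ≤ 2) →
    ∀ m : ℝ → ℂ, ∀ B : ℝ, 0 < B → (∀ ξ, ‖m ξ‖ ≤ B) →
    (∀ (a : κ) (K : ℕ) (ξ : ℕ → ℝ), ξ 0 = lo a → ξ (K + 1) = hi a →
      (∀ i ≤ K, ξ i < ξ (i + 1)) →
      ∑ i ∈ Finset.range (K + 1), ‖m (ξ (i + 1)) - m (ξ i)‖ ^ q ≤ B ^ q) →
    ∀ f : ℝ → ℂ, Nice f →
    eLpNorm (mulOp ((⋃ a, Ico (lo a) (hi a)).indicator m) f) (ENNReal.ofReal p) volume ≤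
      ENNReal.ofReal (C * B) * eLpNorm f (ENNReal.ofReal p) volume := by
  obtain ⟨θ, C, hθ0, hθ, hC, hstep⟩ := eLpNorm_step_multiplier_le hp hpq
  set r : ℝ := (2:ℝ) ^ (-(1 / q)) with hr
  have hr0 : 0 < r := by positivity
  set τ : ℝ := r * 2 ^ θ with hτ
  have hτ0 : 0 < τ := by positivity
  have hτ1 : τ < 1 := by
    rw [hτ, hr, ← Real.rpow_add (by norm_num)]
    exact Real.rpow_lt_one_of_one_lt_of_neg (by norm_num) (by linarith)
  refine ⟨C * 8 ^ θ + ∑' j, 2 * C * 8 ^ θ * τ ^ j, ?_, ?_⟩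
  · have : 0 ≤ ∑' j, 2 * C * 8 ^ θ * τ ^ j := tsum_nonneg fun j => by positivity
    positivity
  intro κ _ lo hi hdisj c hc k hshell hcard m B hB hmB hvar f hf
  choose W hW01 hWmono hWosc using fun a => exists_oscillation_function hq hB (hvar a)
  set F : ℕ → κ → ℝ → ℕ := fun j a ξ => ⌊2 ^ j * W a ξ⌋₊ with hF
  have hFmono : ∀ j a, MonotoneOn (F j a) (Ico (lo a) (hi a)) := fun j a s hs t ht hst =>
    Nat.floor_le_floor (mul_le_mul_of_nonneg_left (hWmono a hs ht hst) (by positivity))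
  have hFlt : ∀ j a, ∀ ξ ∈ Ico (lo a) (hi a), F j a ξ < 2 ^ j + 1 := by
    intro j a ξ hξ
    rw [Nat.lt_succ_iff]
    refine Nat.floor_le_of_le ?_
    push_cast
    exact mul_le_of_le_one_right (by positivity) (hW01 a ξ hξ).2
  have hFhalf : ∀ j a ξ, F (j + 1) a ξ / 2 = F j a ξ := by
    intro j a ξ
    rw [hF]
    dsimp only
    rw [← Nat.floor_div_ofNat]
    congr 1
    rw [pow_succ]
    ring
  choose z hzB hz using fun j a => exists_level_values (I := Ico (lo a) (hi a)) (F := F j a) hmB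
    (fun s hs t ht he => hWosc a j s hs t ht he)
  have hshell' : ∀ j (P : κ × Fin (2 ^ j + 1)), ∀ ξ ∈ levelSet lo hi (F j) _ P,
      c * 2 ^ k P.1 ≤ |ξ| ∧ |ξ| ≤ 2 * (c * 2 ^ k P.1) := fun j P ξ hξ => hshell _ ξ hξ.1
  have hlevel : ∀ j, ∀ D : ℝ, 0 < D → ∀ y : κ × Fin (2 ^ j + 1) → ℂ, (∀ P, ‖y P‖ ≤ D) →
      eLpNorm (mulOp (fun ξ => ∑ P, (levelSet lo hi (F j) _ P).indicator (fun _ => y P) ξ) f)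
        (ENNReal.ofReal p) volume ≤
      ENNReal.ofReal (C * D * ((2:ℝ) ^ θ) ^ j * 4 ^ θ) * eLpNorm f (ENNReal.ofReal p) volume := by
    intro j D hD y hy
    refine (hstep _ _ (levelSet_ordConnected (hFmono j)) (levelSet_disjoint hdisj) c hc
      (fun P => k P.1) (2 ^ j * 4) (by have := Nat.one_le_two_pow (n := j); omega) (hshell' j) (fun i => (card_level_fiber_le hcard i).trans ?_)
      D hD y hy f hf).trans (le_of_eq ?_)
    · have := Nat.one_le_two_pow (n := j); omega
    · congr 2
      push_cast
      rw [Real.mul_rpow (by positivity) (by norm_num), ← Real.rpow_natCast, ← Real.rpow_mul (by norm_num),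
        mul_comm (j:ℝ) θ, Real.rpow_mul (by norm_num), Real.rpow_natCast]
      ring
  have hnice : ∀ j (y : κ × Fin (2 ^ j + 1) → ℂ),
      Nice fun ξ => ∑ P, (levelSet lo hi (F j) _ P).indicator (fun _ => y P) ξ := fun j y =>
    Nice.sum fun P _ => nice_indicator_const (levelSet_ordConnected (hFmono j) P).measurableSet
      (fun ξ hξ => (hshell' j P ξ hξ).2) (y P)
  set v : ℕ → ℝ → ℂ := fun j ξ =>
    ∑ P : κ × Fin (2 ^ j + 1), (levelSet lo hi (F j) _ P).indicator (fun _ => z j P.1 P.2) ξ with hv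
  have hvnice : ∀ j, Nice (v j) := fun j => hnice j _
  classical
  have hdiff : ∀ j, ∃ y : κ × Fin (2 ^ (j + 1) + 1) → ℂ, (∀ P, ‖y P‖ ≤ 2 * B * r ^ j) ∧
      v (j + 1) = fun ξ => v j ξ + ∑ P, (levelSet lo hi (F (j + 1)) _ P).indicator (fun _ => y P) ξ := by
    intro j
    set g : κ → ℕ → ℂ := fun a i =>
      if ∃ ξ ∈ Ico (lo a) (hi a), F (j + 1) a ξ = i then z (j + 1) a i - z j a (i / 2) else 0 with hg
    refine ⟨fun P => g P.1 P.2, fun P => ?_, ?_⟩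
    · simp only [hg]
      split_ifs with h
      · obtain ⟨ξ, hξ, he⟩ := h
        have h1 := hz (j + 1) P.1 ξ hξ
        have h2 := hz j P.1 ξ hξ
        rw [he] at h1
        rw [← hFhalf, he] at h2
        have h3 : r ^ (j + 1) ≤ r ^ j := by
          rw [pow_succ]
          refine mul_le_of_le_one_right (by positivity) ?_
          exact Real.rpow_le_one_of_one_le_of_nonpos (by norm_num) (by
            have : 0 < 1 / q := by positivity
            linarith)
        have h4 : z (j + 1) P.1 P.2 - z j P.1 (P.2 / 2) =
          (m ξ - z j P.1 (P.2 / 2)) - (m ξ - z (j + 1) P.1 P.2) := by ring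
        rw [h4]
        refine (norm_sub_le _ _).trans ?_
        have h5 := mul_le_mul_of_nonneg_left h3 hB.le
        linarith
      · rw [norm_zero]; positivity
    · funext ξ
      by_cases h : ∃ a, ξ ∈ Ico (lo a) (hi a)
      · obtain ⟨a, ha⟩ := h
        simp only [hv]
        rw [sum_levelSet_indicator_of_mem hdisj (z (j + 1)) ha (hFlt _ _ _ ha),
          sum_levelSet_indicator_of_mem hdisj (z j) ha (hFlt _ _ _ ha),
          sum_levelSet_indicator_of_mem hdisj g ha (hFlt _ _ _ ha), hg]
        dsimp only
        rw [if_pos ⟨ξ, ha, rfl⟩, hFhalf]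
        ring
      · push Not at h
        simp only [hv]
        rw [sum_levelSet_indicator_of_notMem _ h, sum_levelSet_indicator_of_notMem _ h,
          sum_levelSet_indicator_of_notMem _ h, add_zero]
  have hsummable : Summable fun j => 2 * C * 8 ^ θ * τ ^ j :=
    (summable_geometric_of_lt_one hτ0.le hτ1).mul_left _
  have hbound : ∀ J, eLpNorm (mulOp (v J) f) (ENNReal.ofReal p) volume ≤
      ENNReal.ofReal ((C * 8 ^ θ + ∑ j ∈ Finset.range J, 2 * C * 8 ^ θ * τ ^ j) * B) *
        eLpNorm f (ENNReal.ofReal p) volume := by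
    intro J
    induction J with
    | zero =>
      refine (hlevel 0 B hB _ fun P => hzB 0 _ _).trans
        (mul_le_mul_left (ENNReal.ofReal_le_ofReal ?_) _)
      have h48 : (4:ℝ) ^ θ ≤ 8 ^ θ := Real.rpow_le_rpow (by norm_num) (by norm_num) hθ0
      rw [pow_zero, Finset.range_zero, Finset.sum_empty]
      have := mul_le_mul_of_nonneg_left h48 (show 0 ≤ C * B by positivity)
      linarith
    | succ J ih =>
      obtain ⟨y, hy, he⟩ := hdiff J
      have h1 := hlevel (J + 1) (2 * B * r ^ J) (by positivity) y hy
      rw [he, funext (mulOp_add_symbol (hvnice J) (hnice _ y) hf)]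
      have hp1 : 1 ≤ ENNReal.ofReal p := by
        rw [← ENNReal.ofReal_one]; exact ENNReal.ofReal_le_ofReal (by linarith)
      refine (eLpNorm_add_le (continuous_mulOp (hvnice J) hf).aestronglyMeasurable
        (continuous_mulOp (hnice _ y) hf).aestronglyMeasurable hp1).trans ?_
      refine (add_le_add ih h1).trans (le_of_eq ?_)
      rw [← add_mul, ← ENNReal.ofReal_add _ (by positivity)]
      · congr 2
        rw [Finset.sum_range_succ, hτ, show (8:ℝ) = 2 * 4 by norm_num,
          Real.mul_rpow (by norm_num) (by norm_num), mul_pow, pow_succ]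
        ring
      · have : 0 ≤ ∑ j ∈ Finset.range J, 2 * C * 8 ^ θ * τ ^ j :=
          Finset.sum_nonneg fun j _ => by positivity
        positivity
  have hΩmeas : MeasurableSet (⋃ a, Ico (lo a) (hi a)) := MeasurableSet.iUnion fun a => measurableSet_Ico
  refine eLpNorm_le_of_tendsto (F := fun J => mulOp (v J) f)
    (fun J => (continuous_mulOp (hvnice J) hf).measurable) (fun x => ?_) (fun J => (hbound J).trans
      (mul_le_mul_left (ENNReal.ofReal_le_ofReal (mul_le_mul_of_nonneg_right
        (add_le_add le_rfl (hsummable.sum_le_tsum _ fun j _ => by positivity)) hB.le)) _))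
  have hvB : ∀ J ξ, ‖v J ξ‖ ≤ ‖(⋃ a, Ico (lo a) (hi a)).indicator (fun _ => (B:ℂ)) ξ‖ := by
    intro J ξ
    by_cases h : ∃ a, ξ ∈ Ico (lo a) (hi a)
    · obtain ⟨a, ha⟩ := h
      rw [indicator_of_mem (mem_iUnion.2 ⟨a, ha⟩), Complex.norm_real, Real.norm_of_nonneg hB.le]
      simp only [hv]
      rw [sum_levelSet_indicator_of_mem hdisj (z J) ha (hFlt _ _ _ ha)]
      exact hzB _ _ _
    · push Not at h
      simp only [hv]
      rw [sum_levelSet_indicator_of_notMem _ h, norm_zero]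
      exact norm_nonneg _
  have hdom : Nice ((⋃ a, Ico (lo a) (hi a)).indicator fun _ => (B:ℂ)) := by
    refine nice_indicator_const (R := ∑ a, 2 * (c * 2 ^ k a)) hΩmeas (fun ξ hξ => ?_) _
    obtain ⟨a, ha⟩ := mem_iUnion.1 hξ
    exact (hshell a ξ ha).2.trans (Finset.single_le_sum (f := fun a => 2 * (c * 2 ^ k a))
      (fun a _ => by positivity) (Finset.mem_univ a))
  refine tendsto_fourierInv (b := fun ξ => ‖(⋃ a, Ico (lo a) (hi a)).indicator (fun _ => (B:ℂ)) ξ * 𝓕 f ξ‖)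
    (fun J => ((hvnice J).symbol hf).measurable) (hdom.symbol hf).integrable.norm
    (fun J ξ => ?_) (fun ξ => ?_) x
  · rw [norm_mul, norm_mul]
    exact mul_le_mul_of_nonneg_right (hvB J ξ) (norm_nonneg _)
  · refine Tendsto.mul_const _ ?_
    by_cases h : ∃ a, ξ ∈ Ico (lo a) (hi a)
    · obtain ⟨a, ha⟩ := h
      rw [indicator_of_mem (mem_iUnion.2 ⟨a, ha⟩), tendsto_iff_norm_sub_tendsto_zero]
      refine squeeze_zero (fun J => norm_nonneg _) (g := fun J => B * r ^ J) (fun J => ?_) ?_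
      · simp only [hv]
        rw [sum_levelSet_indicator_of_mem hdisj (z J) ha (hFlt _ _ _ ha), norm_sub_rev]
        exact hz J a ξ ha
      · have hr1 : r < 1 := by
          refine Real.rpow_lt_one_of_one_lt_of_neg (by norm_num) ?_
          have : 0 < 1 / q := by positivity
          linarith
        simpa using (tendsto_pow_atTop_nhds_zero_of_lt_one hr0.le hr1).const_mul B
    · push Not at h
      rw [indicator_of_notMem (by simpa using h)]
      simp only [hv]
      simp only [sum_levelSet_indicator_of_notMem _ h]
      exact tendsto_const_nhds

end ShellMultiplier

section Duality
open Set FourierTransform ComplexConjugate Filter Topology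

lemma fourierInv_eq_fourier_neg_arg (f : ℝ → ℂ) (w : ℝ) : 𝓕⁻ f w = 𝓕 f (-w) := by
  simp [fourierInv_eq_ex, fourier_eq_ex]

lemma fourier_comp_neg (f : ℝ → ℂ) (w : ℝ) : 𝓕 (fun x => f (-x)) w = 𝓕⁻ f w := by
  rw [fourierInv_eq_ex, fourier_eq_ex, ← integral_neg_eq_self]
  simp

lemma integral_fourierInv_mul {f g : ℝ → ℂ} (hf : Integrable f) (hg : Integrable g) :
    ∫ ξ, 𝓕⁻ f ξ * g ξ = ∫ x, f x * 𝓕⁻ g x := by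
  rw [← integral_neg_eq_self]
  simp only [fourierInv_eq_fourier_neg_arg f, neg_neg]
  rw [integral_fourier_mul hf hg.comp_neg]
  simp only [fourier_comp_neg]

lemma conj_fourier (f : ℝ → ℂ) (w : ℝ) : conj (𝓕 f w) = 𝓕⁻ (fun x => conj (f x)) w := by
  rw [fourier_eq_ex, fourierInv_eq_ex, ← integral_conj]
  simp [conj_ex]

lemma conj_fourierInv (f : ℝ → ℂ) (w : ℝ) : conj (𝓕⁻ f w) = 𝓕 (fun x => conj (f x)) w := by
  rw [fourier_eq_ex, fourierInv_eq_ex, ← integral_conj]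
  simp [conj_ex]

lemma Nice.conj {f : ℝ → ℂ} (hf : Nice f) : Nice fun x => conj (f x) := by
  obtain ⟨B, hB⟩ := hf.bdd
  exact ⟨Complex.continuous_conj.measurable.comp hf.measurable,
    (LinearIsometryEquiv.integrable_comp_iff Complex.conjLIE).2 hf.integrable, B, by simpa using hB⟩

/-- The adjoint of a multiplier operator is given by the conjugate symbol. -/
lemma integral_mulOp_mul {u f g : ℝ → ℂ} (hu : Nice u) (hf : Nice f) (hg : Nice g) :
    ∫ x, mulOp u f x * g x = ∫ x, f x * conj (mulOp (fun ξ => conj (u ξ)) (fun x => conj (g x)) x) := by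
  have h1 : ∀ ξ, conj (conj (u ξ) * 𝓕 (fun x => conj (g x)) ξ) = u ξ * 𝓕⁻ g ξ := by
    intro ξ
    rw [map_mul, conj_fourier]
    simp
  have h2 : Integrable fun ξ => u ξ * 𝓕⁻ g ξ := by
    simp only [← h1]
    exact ((hu.conj.symbol hg.conj).conj).integrable
  simp only [mulOp, conj_fourierInv, h1]
  rw [integral_fourierInv_mul (hu.symbol hf).integrable hg.integrable,
    ← integral_fourier_mul hf.integrable h2]
  congr 1
  funext ξ
  ring

lemma ENNReal.rpow_le_of_le_mul_rpow {X K : ℝ≥0∞} {p q : ℝ} (hpq : p.HolderConjugate q) (hX : X ≠ ∞)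
    (h : X ≤ K * X ^ (1 / q)) : X ^ (1 / p) ≤ K := by
  have hp := hpq.pos
  have hq := hpq.symm.pos
  rcases eq_or_ne X 0 with rfl | h0
  · rw [ENNReal.zero_rpow_of_pos (by positivity)]
    exact zero_le
  · have hsum : 1 / p + 1 / q = 1 := by simpa using hpq.inv_add_inv_eq_one
    have hXq0 : X ^ (1 / q) ≠ 0 := by
      simp [ENNReal.rpow_eq_zero_iff, h0, hX]
    have hXq : X ^ (1 / q) ≠ ∞ := ENNReal.rpow_ne_top_of_nonneg (by positivity) hX
    have : X ^ (1 / p) * X ^ (1 / q) = X := by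
      rw [← ENNReal.rpow_add _ _ h0 hX, hsum, ENNReal.rpow_one]
    exact (ENNReal.mul_le_mul_iff_left hXq0 hXq).1 (this.trans_le h)

/-- Duality: bounds for the conjugate symbol on `L^q` transfer to the dual exponent. -/
lemma eLpNorm_mulOp_le_of_dual {p q : ℝ} (hpq : p.HolderConjugate q) {u : ℝ → ℂ} (hu : Nice u) {K : ℝ≥0∞}
    (H : ∀ g : ℝ → ℂ, Nice g → eLpNorm (mulOp (fun ξ => conj (u ξ)) g) (ENNReal.ofReal q) volume ≤
      K * eLpNorm g (ENNReal.ofReal q) volume) {f : ℝ → ℂ} (hf : Nice f) :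
    eLpNorm (mulOp u f) (ENNReal.ofReal p) volume ≤ K * eLpNorm f (ENNReal.ofReal p) volume := by
  have hp := hpq.pos
  have hq := hpq.symm.pos
  have hp1 := hpq.lt
  have hp0 : ENNReal.ofReal p ≠ 0 := by simpa using hp
  have hq0 : ENNReal.ofReal q ≠ 0 := by simpa using hq
  set T : ℝ → ℂ := mulOp u f with hT
  have hTc : Continuous T := continuous_mulOp hu hf
  obtain ⟨M, hM⟩ : ∃ M, ∀ x, ‖T x‖ ≤ M := ⟨_, norm_fourierInv_le _⟩
  have hM0 : 0 ≤ M := (norm_nonneg _).trans (hM 0)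
  refine eLpNorm_le_of_tendsto (F := fun n : ℕ => (Icc (-(n:ℝ)) n).indicator T)
    (fun n => hTc.measurable.indicator measurableSet_Icc) (fun x => ?_) (fun n => ?_)
  · refine tendsto_const_nhds.congr' ?_
    obtain ⟨N, hN⟩ := exists_nat_ge |x|
    filter_upwards [eventually_ge_atTop N] with n hn
    have : |x| ≤ n := hN.trans (by exact_mod_cast hn)
    rw [indicator_of_mem (show x ∈ Icc (-(n:ℝ)) n from abs_le.1 this)]
  set E : Set ℝ := Icc (-(n:ℝ)) n with hE
  set G : ℝ → ℂ := fun x => (conj (T x) * (‖T x‖ ^ (p - 2) : ℝ)) * E.indicator (fun _ => (1:ℂ)) x with hG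
  have hnorm : ∀ x, ‖conj (T x) * (‖T x‖ ^ (p - 2) : ℝ)‖ = ‖T x‖ ^ (p - 1) := by
    intro x
    rw [norm_mul, RCLike.norm_conj, Complex.norm_real, Real.norm_of_nonneg (by positivity)]
    rcases (norm_nonneg (T x)).eq_or_lt with h | h
    · rw [← h, zero_mul, Real.zero_rpow (by linarith)]
    · rw [show p - 1 = 1 + (p - 2) by ring, Real.rpow_add h, Real.rpow_one]
  have hGnice : Nice G := by
    refine (nice_indicator_const (R := n) measurableSet_Icc (fun ξ hξ => abs_le.2 hξ) 1).mul_bdd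
      (B := M ^ (p - 1)) ?_ (fun x => ?_)
    · have := hTc.measurable
      have h1 := Complex.continuous_conj.measurable.comp this
      exact h1.mul (Complex.measurable_ofReal.comp (this.norm.pow_const _))
    · rw [hnorm]
      exact Real.rpow_le_rpow (norm_nonneg _) (hM x) (by linarith)
  have hTG : ∀ x, T x * G x = ((‖E.indicator T x‖ ^ p : ℝ) : ℂ) := by
    intro x
    simp only [hG]
    by_cases hx : x ∈ E
    · rw [indicator_of_mem hx, indicator_of_mem hx, mul_one, ← mul_assoc, Complex.mul_conj,
        Complex.normSq_eq_norm_sq, ← Complex.ofReal_mul]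
      congr 1
      rcases (norm_nonneg (T x)).eq_or_lt with h | h
      · rw [← h, Real.zero_rpow hp.ne']; simp
      · rw [← Real.rpow_natCast, ← Real.rpow_add h]
        congr 1
        push_cast
        ring
    · rw [indicator_of_notMem hx, indicator_of_notMem hx, norm_zero, Real.zero_rpow hp.ne']
      simp
  have hGq : ∀ x, ‖G x‖ₑ ^ q = ‖E.indicator T x‖ₑ ^ p := by
    intro x
    simp only [hG]
    by_cases hx : x ∈ E
    · rw [indicator_of_mem hx, indicator_of_mem hx, mul_one, ← ofReal_norm, hnorm,
        ← ENNReal.ofReal_rpow_of_nonneg (norm_nonneg _) (by linarith), ofReal_norm, ← ENNReal.rpow_mul,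
        hpq.sub_one_mul_conj]
    · rw [indicator_of_notMem hx, indicator_of_notMem hx, mul_zero, enorm_zero,
        ENNReal.zero_rpow_of_pos hp, ENNReal.zero_rpow_of_pos hq]
  have hTGint : Integrable fun x => T x * G x := (hGnice.mul_bdd hTc.measurable hM).integrable
  have henorm : ∀ x, ‖T x * G x‖ₑ = ‖E.indicator T x‖ₑ ^ p := by
    intro x
    rw [hTG, ← ofReal_norm, Complex.norm_real, Real.norm_of_nonneg (by positivity),
      ← ENNReal.ofReal_rpow_of_nonneg (norm_nonneg _) hp.le, ofReal_norm]
  set X : ℝ≥0∞ := ∫⁻ x, ‖E.indicator T x‖ₑ ^ p with hX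
  have hXtop : X ≠ ∞ := by
    rw [hX]
    simp only [← henorm]
    exact hTGint.2.ne
  have hXint : X = ‖∫ x, T x * G x‖ₑ := by
    simp only [hTG]
    have hreal : Integrable fun x => ‖E.indicator T x‖ ^ p := by
      have := hTGint.norm
      simp only [hTG, Complex.norm_real] at this
      refine this.congr (.of_forall fun x => ?_)
      exact Real.norm_of_nonneg (by positivity)
    rw [integral_complex_ofReal, ← ofReal_norm, Complex.norm_real,
      Real.norm_of_nonneg (integral_nonneg fun x => by positivity),
      ofReal_integral_eq_lintegral_ofReal hreal (.of_forall fun x => by positivity), hX]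
    refine lintegral_congr fun x => ?_
    rw [← ENNReal.ofReal_rpow_of_nonneg (norm_nonneg _) hp.le, ofReal_norm]
  set S : ℝ → ℂ := mulOp (fun ξ => conj (u ξ)) (fun x => conj (G x)) with hS
  have hSc : Continuous S := continuous_mulOp hu.conj hGnice.conj
  have hHolder : X ≤ eLpNorm f (ENNReal.ofReal p) volume * eLpNorm S (ENNReal.ofReal q) volume := by
    rw [hXint, hT, integral_mulOp_mul hu hf hGnice]
    refine (enorm_integral_le_lintegral_enorm _).trans ?_
    have h1 := ENNReal.lintegral_mul_le_Lp_mul_Lq volume hpq hf.measurable.enorm.aemeasurable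
      hSc.measurable.enorm.aemeasurable
    rw [eLpNorm_eq_lintegral_rpow_enorm_toReal hp0 ENNReal.ofReal_ne_top,
      eLpNorm_eq_lintegral_rpow_enorm_toReal hq0 ENNReal.ofReal_ne_top, ENNReal.toReal_ofReal hp.le,
      ENNReal.toReal_ofReal hq.le]
    refine le_trans (le_of_eq (lintegral_congr fun x => ?_)) h1
    rw [enorm_mul, ← ofReal_norm (conj _), RCLike.norm_conj, ofReal_norm]
    rfl
  have hGnorm : eLpNorm (fun x => conj (G x)) (ENNReal.ofReal q) volume = X ^ (1 / q) := by
    rw [eLpNorm_eq_lintegral_rpow_enorm_toReal hq0 ENNReal.ofReal_ne_top, ENNReal.toReal_ofReal hq.le, hX]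
    congr 1
    refine lintegral_congr fun x => ?_
    rw [← hGq, ← ofReal_norm (conj _), RCLike.norm_conj, ofReal_norm]
  have hfinal := hHolder.trans (mul_le_mul_right (H _ hGnice.conj) _)
  rw [hGnorm, ← mul_assoc, mul_comm _ K] at hfinal
  rw [eLpNorm_eq_lintegral_rpow_enorm_toReal hp0 ENNReal.ofReal_ne_top, ENNReal.toReal_ofReal hp.le]
  exact ENNReal.rpow_le_of_le_mul_rpow hpq hXtop hfinal

end Duality

section Lacunary
open Set FourierTransform ComplexConjugate Filter Topology

lemma mem_Ico_lac_abs {k : ℤ} {ε : Bool} {ξ : ℝ} (h : ξ ∈ Ico (lacLo k ε) (lacHi k ε)) :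
    (2:ℝ) ^ k ≤ |ξ| ∧ |ξ| ≤ 2 ^ (k + 1) := by
  have h2 : (0:ℝ) < 2 ^ k := by positivity
  cases ε
  · simp only [lacLo, lacHi, Bool.false_eq_true, if_false] at h
    rw [abs_of_neg (by linarith [h.2])]
    constructor <;> linarith [h.1, h.2]
  · simp only [lacLo, lacHi, if_true] at h
    rw [abs_of_pos (by linarith [h.1])]
    exact ⟨h.1, h.2.le⟩

lemma lac_index_unique {k k' : ℤ} {ε ε' : Bool} {ξ : ℝ} (h : ξ ∈ Ico (lacLo k ε) (lacHi k ε))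
    (h' : ξ ∈ Ico (lacLo k' ε') (lacHi k' ε')) : k = k' ∧ ε = ε' := by
  have h2 : (0:ℝ) < 2 ^ k := by positivity
  have h2' : (0:ℝ) < 2 ^ k' := by positivity
  have key : ∀ a b : ℤ, (2:ℝ) ^ a < 2 ^ (b + 1) → a ≤ b := fun a b hab =>
    Int.lt_add_one_iff.1 ((zpow_lt_zpow_iff_right₀ (by norm_num)).1 hab)
  cases ε <;> cases ε' <;>
    simp only [lacLo, lacHi, Bool.false_eq_true, if_false, if_true, mem_Ico] at h h'
  · exact ⟨le_antisymm (key _ _ (by linarith [h.1, h.2, h'.1, h'.2]))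
      (key _ _ (by linarith [h.1, h.2, h'.1, h'.2])), rfl⟩
  · linarith [h.2, h'.1]
  · linarith [h'.2, h.1]
  · exact ⟨le_antisymm (key _ _ (by linarith [h.1, h.2, h'.1, h'.2]))
      (key _ _ (by linarith [h.1, h.2, h'.1, h'.2])), rfl⟩

lemma exists_mem_Ico_lac {ξ : ℝ} (hξ : ξ ≠ 0) : ∃ k ε, ξ ∈ Ico (lacLo k ε) (lacHi k ε) := by
  rcases lt_or_gt_of_ne hξ with h | h
  · obtain ⟨k, hk⟩ := exists_mem_Ioc_zpow (neg_pos.2 h) (one_lt_two (α := ℝ))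
    refine ⟨k, false, ?_⟩
    simp only [lacLo, lacHi, Bool.false_eq_true, if_false]
    exact ⟨by linarith [hk.2], by linarith [hk.1]⟩
  · obtain ⟨k, hk⟩ := exists_mem_Ico_zpow h (one_lt_two (α := ℝ))
    exact ⟨k, true, by simpa only [lacLo, lacHi, if_true] using hk⟩

/-- The union of the lacunary intervals with `-R ≤ k < R`. -/
def lacUnion (R : ℕ) : Set ℝ :=
  ⋃ a : Fin (2 * R) × Bool, Ico (lacLo ((a.1 : ℕ) - (R:ℤ)) a.2) (lacHi ((a.1 : ℕ) - (R:ℤ)) a.2)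

lemma measurableSet_lacUnion (R : ℕ) : MeasurableSet (lacUnion R) :=
  MeasurableSet.iUnion fun _ => measurableSet_Ico

lemma abs_le_of_mem_lacUnion {R : ℕ} {ξ : ℝ} (h : ξ ∈ lacUnion R) : |ξ| ≤ 2 ^ (R:ℤ) := by
  obtain ⟨a, ha⟩ := mem_iUnion.1 h
  refine (mem_Ico_lac_abs ha).2.trans (zpow_le_zpow_right₀ (by norm_num) ?_)
  have := a.1.2
  omega

lemma eventually_mem_lacUnion {ξ : ℝ} (hξ : ξ ≠ 0) : ∀ᶠ R : ℕ in atTop, ξ ∈ lacUnion R := by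
  obtain ⟨k, ε, h⟩ := exists_mem_Ico_lac hξ
  filter_upwards [eventually_gt_atTop k.natAbs] with R hR
  refine mem_iUnion.2 ⟨(⟨(k + R).toNat, by omega⟩, ε), ?_⟩
  have : (((k + R).toNat : ℕ) : ℤ) - R = k := by omega
  dsimp only
  rwa [this]

lemma nice_lacUnion_indicator {m : ℝ → ℂ} (hm : Measurable m) {B : ℝ} (hB : ∀ ξ, ‖m ξ‖ ≤ B) (R : ℕ) :
    Nice ((lacUnion R).indicator m) := by
  have := (nice_indicator_const (measurableSet_lacUnion R) (fun ξ => abs_le_of_mem_lacUnion) 1).mul_bdd hm hB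
  convert this using 1
  funext ξ
  by_cases h : ξ ∈ lacUnion R <;> simp [h]

/-- The hypotheses on a symbol: it is bounded by `B`, with `q`-variation at most `B` on every
lacunary interval. -/
structure LacVarBound (q : ℝ) (m : ℝ → ℂ) (B : ℝ) : Prop where
  measurable : Measurable m
  bound : ∀ ξ, ‖m ξ‖ ≤ B
  variation : ∀ (k : ℤ) (ε : Bool) (K : ℕ) (ξ : ℕ → ℝ), ξ 0 = lacLo k ε → ξ (K + 1) = lacHi k ε →
    (∀ i ≤ K, ξ i < ξ (i + 1)) →
    ∑ i ∈ Finset.range (K + 1), ‖m (ξ (i + 1)) - m (ξ i)‖ ^ q ≤ B ^ q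

lemma LacVarBound.conj {q B : ℝ} {m : ℝ → ℂ} (h : LacVarBound q m B) :
    LacVarBound q (fun ξ => conj (m ξ)) B := by
  refine ⟨Complex.continuous_conj.measurable.comp h.measurable, by simpa using h.bound, ?_⟩
  simpa only [← map_sub, RCLike.norm_conj] using h.variation

/-- The truncated multiplier theorem above `L²`. -/
lemma eLpNorm_lacUnion_le_of_two_lt {p q : ℝ} (hp : 2 < p) (hq : 0 < q) (hpq : 1 / 2 - 1 / p < 1 / q) :
    ∃ C : ℝ, 0 < C ∧ ∀ (m : ℝ → ℂ) (B : ℝ), 0 < B → LacVarBound q m B → ∀ (R : ℕ) (f : ℝ → ℂ), Nice f →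
    eLpNorm (mulOp ((lacUnion R).indicator m) f) (ENNReal.ofReal p) volume ≤
      ENNReal.ofReal (C * B) * eLpNorm f (ENNReal.ofReal p) volume := by
  obtain ⟨C, hC, H⟩ := eLpNorm_shell_multiplier_le hp hq hpq
  refine ⟨C, hC, fun m B hB hm R f hf => ?_⟩
  refine H (Fin (2 * R) × Bool) _ _ ?_ (2 ^ (-(R:ℤ))) (by positivity) (fun a => a.1) ?_ ?_ m B hB hm.bound
    (fun a => hm.variation _ _) f hf
  · rintro ξ ⟨a, ε⟩ ⟨a', ε'⟩ h h'
    obtain ⟨h1, h2⟩ := lac_index_unique h h'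
    dsimp only at h1 h2
    have : a = a' := Fin.ext (by omega)
    rw [this, h2]
  · intro a ξ hξ
    have h := mem_Ico_lac_abs hξ
    have h1 : (2:ℝ) ^ (-(R:ℤ)) * 2 ^ (a.1:ℕ) = 2 ^ (((a.1:ℕ):ℤ) - R) := by
      rw [← zpow_natCast, ← zpow_add₀ (by norm_num)]
      congr 1
      ring
    rw [h1]
    refine ⟨h.1, h.2.trans (le_of_eq ?_)⟩
    rw [zpow_add_one₀ (by norm_num), mul_comm]
  · intro i
    refine (Finset.card_le_card_of_injOn Prod.snd (t := Finset.univ)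
      (fun _ _ => Finset.mem_coe.2 (Finset.mem_univ _)) ?_).trans (by simp)
    rintro ⟨a, ε⟩ h ⟨a', ε'⟩ h' he
    have h1 : (a:ℕ) = i := by simpa using h
    have h2 : (a':ℕ) = i := by simpa using h'
    have : a = a' := Fin.ext (h1.trans h2.symm)
    dsimp only at he
    rw [this, he]

lemma eLpNorm_mulOp_two_le {u f : ℝ → ℂ} (hu : Nice u) (hf : Nice f) {B : ℝ} (hB : 0 < B)
    (huB : ∀ ξ, ‖u ξ‖ ≤ B) :
    eLpNorm (mulOp u f) (ENNReal.ofReal 2) volume ≤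
      ENNReal.ofReal B * eLpNorm f (ENNReal.ofReal 2) volume := by
  have hB' : (B:ℂ) ≠ 0 := by exact_mod_cast hB.ne'
  have hn : Nice fun ξ => (B:ℂ)⁻¹ * u ξ := hu.mul_bdd measurable_const (fun _ => le_rfl)
  have h1 := lintegral_enorm_mulOp_sq_le hn (fun ξ => by
    rw [norm_mul, norm_inv, Complex.norm_real, Real.norm_of_nonneg hB.le, inv_mul_le_iff₀ hB, mul_one]
    exact huB ξ) hf
  have h2 := eLpNorm_le_of_lintegral_rpow_le (p := 2) (by norm_num) zero_le_one
    (by simpa only [ENNReal.rpow_two, ENNReal.ofReal_one, one_mul] using h1)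
  have h3 : u = fun ξ => (B:ℂ) * ((B:ℂ)⁻¹ * u ξ) := by
    funext ξ
    rw [mul_inv_cancel_left₀ hB']
  rw [Real.one_rpow, ENNReal.ofReal_one, one_mul] at h2
  rw [h3, eLpNorm_mulOp_const_mul, ← ofReal_norm, Complex.norm_real, Real.norm_of_nonneg hB.le]
  exact mul_le_mul_right h2 _

/-- The truncated multiplier theorem. -/
lemma eLpNorm_lacUnion_le {p q : ℝ} (hp : 1 < p) (hq : 0 < q) (hpq : |1 / 2 - 1 / p| < 1 / q) :
    ∃ C : ℝ, 0 < C ∧ ∀ (m : ℝ → ℂ) (B : ℝ), 0 < B → LacVarBound q m B → ∀ (R : ℕ) (f : ℝ → ℂ), Nice f →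
    eLpNorm (mulOp ((lacUnion R).indicator m) f) (ENNReal.ofReal p) volume ≤
      ENNReal.ofReal (C * B) * eLpNorm f (ENNReal.ofReal p) volume := by
  rw [abs_lt] at hpq
  rcases lt_trichotomy p 2 with h | rfl | h
  · have hconj : p.HolderConjugate (p / (p - 1)) := .conjExponent hp
    have hr : 2 < p / (p - 1) := by rw [lt_div_iff₀ (by linarith)]; linarith
    have hsum : 1 / p + 1 / (p / (p - 1)) = 1 := by simpa using hconj.inv_add_inv_eq_one
    obtain ⟨C, hC, H⟩ := eLpNorm_lacUnion_le_of_two_lt hr hq (by linarith [hpq.1])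
    refine ⟨C, hC, fun m B hB hm R f hf => ?_⟩
    refine eLpNorm_mulOp_le_of_dual hconj (nice_lacUnion_indicator hm.measurable hm.bound R)
      (fun g hg => ?_) hf
    convert H _ B hB hm.conj R g hg using 3
    funext ξ
    by_cases hξ : ξ ∈ lacUnion R <;> simp [hξ]
  · refine ⟨1, one_pos, fun m B hB hm R f hf => ?_⟩
    rw [one_mul]
    refine eLpNorm_mulOp_two_le (nice_lacUnion_indicator hm.measurable hm.bound R) hf hB fun ξ => ?_
    exact (norm_indicator_le_norm_self _ _).trans (hm.bound ξ)
  · exact eLpNorm_lacUnion_le_of_two_lt h hq hpq.2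

lemma integrable_fourier_schwartz (f : SchwartzMap ℝ ℂ) : Integrable (𝓕 (f : ℝ → ℂ)) := by
  rw [← SchwartzMap.fourier_coe]
  exact (𝓕 f).integrable

/-- The multiplier theorem for Schwartz functions in the normalisation of `mulOp`. -/
lemma eLpNorm_mulOp_schwartz_le {p q : ℝ} (hp : 1 < p) (hq : 0 < q) (hpq : |1 / 2 - 1 / p| < 1 / q) :
    ∃ C : ℝ, 0 < C ∧ ∀ (m : ℝ → ℂ) (B : ℝ), 0 < B → LacVarBound q m B → ∀ f : SchwartzMap ℝ ℂ,
    eLpNorm (mulOp m f) (ENNReal.ofReal p) volume ≤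
      ENNReal.ofReal (C * B) * eLpNorm f (ENNReal.ofReal p) volume := by
  obtain ⟨C, hC, H⟩ := eLpNorm_lacUnion_le hp hq hpq
  refine ⟨C, hC, fun m B hB hm f => ?_⟩
  have hfn := nice_schwartz f
  have hn := fun R => nice_lacUnion_indicator hm.measurable hm.bound R
  refine eLpNorm_le_of_tendsto (F := fun R => mulOp ((lacUnion R).indicator m) f)
    (fun R => (continuous_mulOp (hn R) hfn).measurable) (fun x => ?_) (fun R => H m B hB hm R f hfn)
  have hlim : mulOp m f x = 𝓕⁻ (fun ξ => ({0}ᶜ : Set ℝ).indicator m ξ * 𝓕 (f : ℝ → ℂ) ξ) x := by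
    rw [mulOp, fourierInv_eq_ex, fourierInv_eq_ex]
    refine integral_congr_ae ?_
    filter_upwards [(countable_singleton (0:ℝ)).ae_notMem volume] with ξ hξ
    rw [indicator_of_mem (show ξ ∈ ({0}ᶜ : Set ℝ) from hξ)]
  rw [hlim]
  refine tendsto_fourierInv (b := fun ξ => B * ‖𝓕 (f : ℝ → ℂ) ξ‖) (fun R => ((hn R).symbol hfn).measurable)
    ((integrable_fourier_schwartz f).norm.const_mul B) (fun R ξ => ?_) (fun ξ => ?_) x
  · rw [norm_mul]
    exact mul_le_mul_of_nonneg_right ((norm_indicator_le_norm_self _ _).trans (hm.bound ξ))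
      (norm_nonneg _)
  · refine Tendsto.mul_const _ ?_
    refine tendsto_const_nhds.congr' ?_
    rcases eq_or_ne ξ 0 with rfl | hξ
    · refine .of_forall fun R => ?_
      dsimp only
      rw [indicator_of_notMem (by simp), indicator_of_notMem]
      intro h
      obtain ⟨a, ha⟩ := mem_iUnion.1 h
      have h1 := (mem_Ico_lac_abs ha).1
      rw [abs_zero] at h1
      exact absurd h1 (not_le.2 (by positivity))
    · filter_upwards [eventually_mem_lacUnion hξ] with R hR
      rw [indicator_of_mem hR, indicator_of_mem (show ξ ∈ ({0}ᶜ : Set ℝ) from hξ)]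

end Lacunary

section Scaling
open Set FourierTransform ComplexConjugate Filter Topology

lemma eLpNorm_comp_mul_left {s : ℝ} (hs : s ≠ 0) {f : ℝ → ℂ} (hf : Measurable f) {p : ℝ≥0∞} (hp : p ≠ ∞) :
    eLpNorm (fun x => f (s * x)) p volume =
      ENNReal.ofReal |s⁻¹| ^ (1 / p).toReal * eLpNorm f p volume := by
  rw [← smul_eq_mul, ← eLpNorm_smul_measure_of_ne_top hp, ← Real.map_volume_mul_left hs,
    eLpNorm_map_measure hf.aestronglyMeasurable (measurable_const_mul s).aemeasurable]
  rfl

/-- Dilation by `s ≠ 0` of a Schwartz function. -/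
noncomputable def schwartzDilation (s : ℝ) (hs : s ≠ 0) (f : SchwartzMap ℝ ℂ) : SchwartzMap ℝ ℂ :=
  SchwartzMap.compCLMOfContinuousLinearEquiv ℂ (ContinuousLinearEquiv.smulLeft (Units.mk0 s hs)) f

lemma schwartzDilation_apply {s : ℝ} (hs : s ≠ 0) (f : SchwartzMap ℝ ℂ) (x : ℝ) :
    schwartzDilation s hs f x = f (s * x) := rfl

lemma ft_eq_fourier_dilation (f : SchwartzMap ℝ ℂ) (ξ : ℝ) :
    ft f ξ = (2 * Real.pi : ℝ) * 𝓕 (schwartzDilation (2 * Real.pi) Real.two_pi_pos.ne' f : ℝ → ℂ) ξ := by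
  rw [fourier_eq_ex, ft]
  have h := Measure.integral_comp_mul_left
    (fun x : ℝ => f x * Complex.exp (-(I * (x : ℂ) * (ξ : ℂ)))) (2 * Real.pi)
  rw [abs_of_pos (inv_pos.2 Real.two_pi_pos), eq_inv_smul_iff₀ Real.two_pi_pos.ne', Complex.real_smul] at h
  rw [← h]
  congr 1
  refine integral_congr_ae (.of_forall fun x => ?_)
  dsimp only
  rw [schwartzDilation_apply, ex, mul_comm]
  congr 2
  push_cast
  ring

lemma multOp_eq_mulOp_dilation (m : ℝ → ℂ) (f : SchwartzMap ℝ ℂ) (x : ℝ) :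
    mulOp m (schwartzDilation (2 * Real.pi) Real.two_pi_pos.ne' f) x =
      ((2 * Real.pi : ℝ) : ℂ)⁻¹ * multOp m f (2 * Real.pi * x) := by
  have h2 : ((2 * Real.pi : ℝ) : ℂ) ≠ 0 := by exact_mod_cast Real.two_pi_pos.ne'
  rw [mulOp, fourierInv_eq_ex, multOp, ← integral_const_mul]
  refine integral_congr_ae (.of_forall fun ξ => ?_)
  dsimp only
  rw [ft_eq_fourier_dilation, ex]
  have : I * (ξ:ℂ) * ((2 * Real.pi * x : ℝ) : ℂ) = 2 * Real.pi * ((ξ * x : ℝ) : ℂ) * I := by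
    push_cast; ring
  rw [this]
  field_simp

end Scaling

/-- **The Coifman–Rubio de Francia–Semmes multiplier theorem.**  Let `1 < p, q < ∞`
with `|1/2 − 1/p| < 1/q`.  If `‖m‖_∞ ≤ B` and on every lacunary interval `I ∈ Δ` the
`q`-variation of `m` is at most `B` (i.e. `sup_{I∈Δ} ‖m‖_{V_q(I)} ≲ B`), then
`‖A_m f‖_p ≤ C_{p,q} B ‖f‖_p` for all Schwartz `f`, i.e.
`‖A_m‖_{L^p→L^p} ≤ C_{p,q} sup_{I∈Δ} ‖m‖_{V_q(I)}`. -/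
theorem coifman_rubio_semmes (p q : ℝ) (hp : 1 < p) (hq : 1 < q)
    (hpq : |1/2 - 1/p| < 1/q) :
    ∃ C : ℝ, 0 < C ∧
      ∀ m : ℝ → ℂ, Measurable m →
      ∀ B : ℝ, (∀ ξ : ℝ, ‖m ξ‖ ≤ B) →
        (∀ (k : ℤ) (ε : Bool) (K : ℕ) (ξ : ℕ → ℝ),
          ξ 0 = lacLo k ε → ξ (K + 1) = lacHi k ε → (∀ i ≤ K, ξ i < ξ (i + 1)) →
          (∑ i ∈ Finset.range (K + 1), ‖m (ξ (i + 1)) - m (ξ i)‖ ^ q) ≤ B ^ q) →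
        ∀ f : SchwartzMap ℝ ℂ,
          eLpNorm (multOp m (⇑f)) (ENNReal.ofReal p) volume
            ≤ ENNReal.ofReal (C * B) * eLpNorm (⇑f) (ENNReal.ofReal p) volume := by
  obtain ⟨C, hC, H⟩ := eLpNorm_mulOp_schwartz_le hp (zero_lt_one.trans hq) hpq
  have hpi := Real.two_pi_pos
  refine ⟨2 * Real.pi * C, by positivity, fun m hm B hB hvar f => ?_⟩
  have hB0 : 0 ≤ B := (norm_nonneg _).trans (hB 0)
  rcases hB0.eq_or_lt with rfl | hBpos
  · have hm0 : ∀ ξ, m ξ = 0 := fun ξ => norm_le_zero_iff.1 (hB ξ)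
    have : multOp m f = 0 := by
      funext x
      simp [multOp, hm0]
    rw [this, eLpNorm_zero]
    exact zero_le
  set g := schwartzDilation (2 * Real.pi) hpi.ne' f with hg
  have h1 := H m B hBpos ⟨hm, hB, hvar⟩ g
  have hscale : multOp m f = fun x => ((2 * Real.pi : ℝ) : ℂ) * mulOp m g ((2 * Real.pi)⁻¹ * x) := by
    funext x
    have h2 : ((2 * Real.pi : ℝ) : ℂ) ≠ 0 := by exact_mod_cast hpi.ne'
    rw [hg, multOp_eq_mulOp_dilation, mul_inv_cancel_left₀ h2, mul_inv_cancel_left₀ hpi.ne']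
  have hfg : (f : ℝ → ℂ) = fun x => g ((2 * Real.pi)⁻¹ * x) := by
    funext x
    rw [hg, schwartzDilation_apply, mul_inv_cancel_left₀ hpi.ne']
  have hmeas : Measurable (mulOp m g) :=
    (continuous_fourierInv_of_integrable ((integrable_fourier_schwartz g).bdd_mul
      hm.aestronglyMeasurable (.of_forall hB))).measurable
  have hinv : (2 * Real.pi)⁻¹ ≠ 0 := inv_ne_zero hpi.ne'
  have hL : eLpNorm (multOp m f) (ENNReal.ofReal p) volume = ENNReal.ofReal (2 * Real.pi) *
      eLpNorm (fun x => mulOp m g ((2 * Real.pi)⁻¹ * x)) (ENNReal.ofReal p) volume := by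
    rw [hscale, ← Real.norm_of_nonneg hpi.le, ← Complex.norm_real, ofReal_norm, ← eLpNorm_const_smul,
      Complex.norm_real, Real.norm_of_nonneg hpi.le]
    rfl
  rw [hL, eLpNorm_comp_mul_left hinv hmeas ENNReal.ofReal_ne_top]
  conv_rhs => rw [hfg, eLpNorm_comp_mul_left hinv g.continuous.measurable ENNReal.ofReal_ne_top]
  rw [mul_assoc (2 * Real.pi) C B, ENNReal.ofReal_mul hpi.le, mul_assoc]
  refine mul_le_mul_right ?_ _
  rw [mul_left_comm]
  exact mul_le_mul_right h1 _
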